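/- Let 0 ≤ s ≤ r be odd integers with s ≥ 2^{t_1} + 1 and r ≥ 2^{t_2} (or r ≥ 2^{t_1} + 1 and s ≥ 2^{t_2}) for positive integers t_1, t_2, and let n ≥ 2 be an integer. Then, for the free S^1-action on ℝH_{r,s} (which exists since r and s are odd), n(2^{t_1} + 2^{t_2}) − 1 ≤ TC_{S^1,n}(ℝH_{r,s}) ≤ n(s+r−1). -/

import Mathlib

open scoped unitInterval

noncomputable section

/-- Topology on the projectivization, as a quotient of the nonzero vectors. -/
instance projTop (K V : Type*) [DivisionRing K] [AddCommGroup V] [Module K V]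
    [TopologicalSpace V] : TopologicalSpace (Projectivization K V) :=
  inferInstanceAs (TopologicalSpace (Quotient (projectivizationSetoid K V)))

/-- The real Milnor manifold `ℝH_{r,s}`, as the subspace of `ℝPʳ × ℝPˢ` of pairs
`([x], [y])` with `x₀y₀ + ⋯ + x_sy_s = 0` (for `s ≤ r`). -/
def RealMilnor (r s : ℕ) :
    Set (Projectivization ℝ (Fin (r + 1) → ℝ) × Projectivization ℝ (Fin (s + 1) → ℝ)) :=
  {p | ∑ i : Fin (min (s + 1) (r + 1)),
      p.1.rep (Fin.castLE (min_le_right _ _) i) * p.2.rep (Fin.castLE (min_le_left _ _) i) = 0}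

/-- The complex Milnor manifold `ℂH_{r,s}`, as the subspace of `ℂPʳ × ℂPˢ` of pairs
`([z], [w])` with `z₀w̄₀ + ⋯ + z_sw̄_s = 0` (for `s ≤ r`). -/
def ComplexMilnor (r s : ℕ) :
    Set (Projectivization ℂ (Fin (r + 1) → ℂ) × Projectivization ℂ (Fin (s + 1) → ℂ)) :=
  {p | ∑ i : Fin (min (s + 1) (r + 1)),
      p.1.rep (Fin.castLE (min_le_right _ _) i) *
        (starRingEnd ℂ) (p.2.rep (Fin.castLE (min_le_left _ _) i)) = 0}

/-- The Lusternik–Schnirelmann category of `X`: the least number of open sets covering `X`,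
each of whose inclusion into `X` is null-homotopic. -/
def lsCat (X : Type*) [TopologicalSpace X] : ℕ :=
  sInf {k | 0 < k ∧ ∃ U : Fin k → Set X,
    (∀ i, IsOpen (U i)) ∧ (⋃ i, U i) = Set.univ ∧
    ∀ i, ∃ x₀ : X, ∃ H : C(U i × I, X),
      (∀ u : U i, H (u, 0) = (u : X)) ∧ (∀ u : U i, H (u, 1) = x₀)}

/-- The fibration `π_n : X^I → X^n`, evaluating a path at the times `i/(n-1)`,
`i = 0, …, n-1`. -/
def tcPi (X : Type*) [TopologicalSpace X] (n : ℕ) (γ : C(I, X)) : Fin n → X :=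
  fun i => γ (Set.projIcc (0 : ℝ) 1 zero_le_one ((i : ℝ) / ((n : ℝ) - 1)))

/-- The `n`-th higher (sequential) topological complexity of `X`: the least number of open
sets covering `X^n`, each admitting a continuous local section of `π_n : X^I → X^n`. -/
def higherTC (X : Type*) [TopologicalSpace X] (n : ℕ) : ℕ :=
  sInf {k | 0 < k ∧ ∃ U : Fin k → Set (Fin n → X),
    (∀ i, IsOpen (U i)) ∧ (⋃ i, U i) = Set.univ ∧
    ∀ i, ∃ sec : C(U i, C(I, X)), ∀ u : U i, tcPi X n (sec u) = (u : Fin n → X)}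

/-- The `n`-th higher equivariant topological complexity of a `G`-space `X`:
the least number of `G`-invariant open sets covering `X^n` (with the diagonal action),
each admitting a `G`-equivariant map to `X^I` whose composite with `π_n` is
`G`-homotopic to the inclusion. -/
def eqHigherTC (G : Type*) [Group G] (X : Type*) [TopologicalSpace X] [MulAction G X]
    (n : ℕ) : ℕ :=
  sInf {k | 0 < k ∧ ∃ U : Fin k → Set (Fin n → X),
    (∀ i, IsOpen (U i)) ∧ (⋃ i, U i) = Set.univ ∧
    (∀ i (g : G), ∀ v ∈ U i, g • v ∈ U i) ∧
    ∀ i, ∃ sec : C(U i, C(I, X)),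
      (∀ (g : G) (v : U i) (hgv : g • (v : Fin n → X) ∈ U i) (t : I),
        (sec ⟨g • (v : Fin n → X), hgv⟩) t = g • (sec v) t) ∧
      ∃ H : C(U i × I, Fin n → X),
        (∀ v : U i, H (v, 0) = tcPi X n (sec v)) ∧
        (∀ v : U i, H (v, 1) = (v : Fin n → X)) ∧
        (∀ (g : G) (v : U i) (hgv : g • (v : Fin n → X) ∈ U i) (t : I),
          H (⟨g • (v : Fin n → X), hgv⟩, t) = g • H (v, t))}

/-- `X` has covering dimension at most `m`: every finite open cover admits an open
refinement which still covers `X` and in which every point lies in at most `m + 1` sets. -/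
def HasCovDimLE (X : Type*) [TopologicalSpace X] (m : ℕ) : Prop :=
  ∀ 𝒰 : Set (Set X), 𝒰.Finite → (∀ U ∈ 𝒰, IsOpen U) → ⋃₀ 𝒰 = Set.univ →
    ∃ 𝒱 : Set (Set X), (∀ V ∈ 𝒱, IsOpen V) ∧ ⋃₀ 𝒱 = Set.univ ∧
      (∀ V ∈ 𝒱, ∃ U ∈ 𝒰, V ⊆ U) ∧
      ∀ x : X, {V ∈ 𝒱 | x ∈ V}.encard ≤ (m + 1 : ℕ)

/-- The covering dimension of `X`. -/
def covDim (X : Type*) [TopologicalSpace X] : ℕ :=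
  sInf {m | HasCovDimLE X m}

end

namespace MilnorTC

/-- Every finite open cover of `A` has an open shrinking of order at most `k` on `A`. -/
def DimLE {Y : Type*} [TopologicalSpace Y] (k : ℕ) (A : Set Y) : Prop :=
  ∀ (ι : Type) [Finite ι] (U : ι → Set Y), (∀ i, IsOpen (U i)) → A ⊆ ⋃ i, U i →
    ∃ V : ι → Set Y, (∀ i, IsOpen (V i)) ∧ (∀ i, V i ⊆ U i) ∧ A ⊆ ⋃ i, V i ∧
      ∀ x ∈ A, ∀ J : Finset ι, (∀ j ∈ J, x ∈ V j) → J.card ≤ k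

section
variable {Y : Type*} [TopologicalSpace Y]

theorem DimLE.empty (k : ℕ) : DimLE k (∅ : Set Y) := by
  intro ι _ U hU hA
  exact ⟨U, hU, fun i => subset_rfl, hA, by simp⟩

theorem DimLE.union {k : ℕ} {A B : Set Y} (hAc : IsClosed A) (hBc : IsClosed B)
    (hA : DimLE k A) (hB : DimLE k B) : DimLE k (A ∪ B) := by
  intro ι _ U hU hAB
  obtain ⟨V, hV, hVU, hAV, hord⟩ := hA ι U hU (Set.subset_union_left.trans hAB)
  have hU' : ∀ i, IsOpen ((U i \ A) ∪ V i) := fun i => ((hU i).sdiff hAc).union (hV i)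
  have hcov' : A ∪ B ⊆ ⋃ i, ((U i \ A) ∪ V i) := by
    intro x hx
    by_cases hxA : x ∈ A
    · obtain ⟨i, hi⟩ := Set.mem_iUnion.1 (hAV hxA)
      exact Set.mem_iUnion.2 ⟨i, Or.inr hi⟩
    · obtain ⟨i, hi⟩ := Set.mem_iUnion.1 (hAB hx)
      exact Set.mem_iUnion.2 ⟨i, Or.inl ⟨hi, hxA⟩⟩
  obtain ⟨W, hW, hWU, hBW, hord2⟩ := hB ι _ hU' (Set.subset_union_right.trans hcov')
  refine ⟨fun i => (((U i \ A) ∪ V i) \ B) ∪ W i, fun i => ((hU' i).sdiff hBc).union (hW i),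
    ?_, ?_, ?_⟩
  · rintro i x (⟨(h | h), _⟩ | h)
    · exact h.1
    · exact hVU i h
    · rcases hWU i h with h | h
      · exact h.1
      · exact hVU i h
  · intro x hx
    by_cases hxB : x ∈ B
    · obtain ⟨i, hi⟩ := Set.mem_iUnion.1 (hBW hxB)
      exact Set.mem_iUnion.2 ⟨i, Or.inr hi⟩
    · obtain ⟨i, hi⟩ := Set.mem_iUnion.1 (hcov' hx)
      exact Set.mem_iUnion.2 ⟨i, Or.inl ⟨hi, hxB⟩⟩
  · rintro x hx J hJ
    by_cases hxB : x ∈ B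
    · refine hord2 x hxB J fun j hj => ?_
      rcases hJ j hj with h | h
      · exact absurd hxB h.2
      · exact h
    · have hxA : x ∈ A := hx.resolve_right hxB
      refine hord x hxA J fun j hj => ?_
      have : x ∈ (U j \ A) ∪ V j := by
        rcases hJ j hj with h | h
        · exact h.1
        · exact hWU j h
      rcases this with h | h
      · exact absurd hxA h.2
      · exact h

theorem DimLE.biUnion {k : ℕ} {τ : Type*} (s : Finset τ) (A : τ → Set Y)
    (hAc : ∀ t ∈ s, IsClosed (A t)) (hA : ∀ t ∈ s, DimLE k (A t)) :
    DimLE k (⋃ t ∈ s, A t) := by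
  classical
  induction s using Finset.induction_on with
  | empty => simpa using DimLE.empty k
  | insert a s ha ih =>
    rw [Finset.set_biUnion_insert]
    refine DimLE.union (hAc a (by simp)) ?_ (hA a (by simp)) (ih ?_ ?_)
    · exact s.finite_toSet.isClosed_biUnion fun t ht => hAc t (Finset.mem_insert_of_mem ht)
    · exact fun t ht => hAc t (Finset.mem_insert_of_mem ht)
    · exact fun t ht => hA t (Finset.mem_insert_of_mem ht)

/-- strong form: the shrinking may be taken of order at most `k` everywhere. -/
theorem DimLE.strong [NormalSpace Y] {k : ℕ} {A : Set Y} (hAc : IsClosed A) (hA : DimLE k A)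
    {ι : Type} [Finite ι] (U : ι → Set Y) (hU : ∀ i, IsOpen (U i)) (hAU : A ⊆ ⋃ i, U i) :
    ∃ V : ι → Set Y, (∀ i, IsOpen (V i)) ∧ (∀ i, V i ⊆ U i) ∧ A ⊆ ⋃ i, V i ∧
      ∀ x, ∀ J : Finset ι, (∀ j ∈ J, x ∈ V j) → J.card ≤ k := by
  obtain ⟨V, hV, hVU, hAV, hord⟩ := hA ι U hU hAU
  obtain ⟨W, hAW, hW, hWV⟩ := exists_subset_iUnion_closure_subset hAc hV
    (fun x _ => Set.toFinite _) hAV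
  have hO : IsClosed (⋃ J ∈ {J : Finset ι | k < J.card}, ⋂ j ∈ J, closure (W j)) := by
    refine Set.Finite.isClosed_biUnion (Set.toFinite _) fun J _ => ?_
    exact isClosed_biInter fun j _ => isClosed_closure
  refine ⟨fun i => W i \ (⋃ J ∈ {J : Finset ι | k < J.card}, ⋂ j ∈ J, closure (W j)),
    fun i => (hW i).sdiff hO, fun i x hx => hVU i (hWV i (subset_closure hx.1)), ?_, ?_⟩
  · intro x hx
    obtain ⟨i, hi⟩ := Set.mem_iUnion.1 (hAW hx)
    refine Set.mem_iUnion.2 ⟨i, hi, ?_⟩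
    simp only [Set.mem_iUnion, Set.mem_iInter, not_exists]
    intro J hJ h
    exact absurd (hord x hx J fun j hj => hWV j (h j hj)) (not_le.2 hJ)
  · intro x J hJ
    by_contra hk
    push Not at hk
    obtain ⟨j, hj⟩ : J.Nonempty := Finset.card_pos.1 (by omega)
    apply (hJ j hj).2
    simp only [Set.mem_iUnion, Set.mem_iInter]
    exact ⟨J, hk, fun i hi => subset_closure (hJ i hi).1⟩

theorem DimLE.transport {K Y' : Type*} [TopologicalSpace K] [CompactSpace K]
    [TopologicalSpace Y'] [T2Space Y] [T2Space Y'] {k : ℕ} (f : K → Y) (g : K → Y')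
    (hf : Continuous f) (hg : Continuous g) (hfi : Function.Injective f)
    (hgi : Function.Injective g) (h : DimLE k (Set.range f)) : DimLE k (Set.range g) := by
  have hfe := (hf.isClosedEmbedding hfi).isInducing
  have hge := (hg.isClosedEmbedding hgi).isInducing
  intro ι _ U hU hc
  have h1 : ∀ i, ∃ U', IsOpen U' ∧ f ⁻¹' U' = g ⁻¹' (U i) := fun i =>
    hfe.isOpen_iff.1 ((hU i).preimage hg)
  choose U' hU' hUU' using h1
  obtain ⟨V, hV, hVU, hAV, hord⟩ := h ι U' hU' (by
    rintro _ ⟨x, rfl⟩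
    obtain ⟨i, hi⟩ := Set.mem_iUnion.1 (hc ⟨x, rfl⟩)
    refine Set.mem_iUnion.2 ⟨i, ?_⟩
    change x ∈ f ⁻¹' U' i
    rw [hUU']; exact hi)
  have h2 : ∀ i, ∃ V', IsOpen V' ∧ g ⁻¹' V' = f ⁻¹' (V i) := fun i =>
    hge.isOpen_iff.1 ((hV i).preimage hf)
  choose V' hV' hVV' using h2
  have key : ∀ x i, g x ∈ V' i ↔ f x ∈ V i := fun x i => by
    change x ∈ g ⁻¹' V' i ↔ _
    rw [hVV']; rfl
  refine ⟨fun i => V' i ∩ U i, fun i => (hV' i).inter (hU i), fun i => Set.inter_subset_right,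
    ?_, ?_⟩
  · rintro _ ⟨x, rfl⟩
    obtain ⟨i, hi⟩ := Set.mem_iUnion.1 (hAV ⟨x, rfl⟩)
    refine Set.mem_iUnion.2 ⟨i, (key x i).2 hi, ?_⟩
    change x ∈ g ⁻¹' U i
    rw [← hUU']; exact hVU i hi
  · rintro _ ⟨x, rfl⟩ J hJ
    exact hord (f x) ⟨x, rfl⟩ J fun j hj => (key x j).1 (hJ j hj).1

end

/-- A compact set in `ℝ^κ` without interior avoids a translate of the rational points. -/
theorem exists_translate {κ : Type} [Fintype κ] (A : Set (κ → ℝ)) (hA : IsCompact A)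
    (hAint : interior A = ∅) : ∃ τ : κ → ℝ, ∀ q : κ → ℚ, (fun i => (q i : ℝ) + τ i) ∉ A := by
  have hd : Dense (⋂ q : κ → ℚ, {τ : κ → ℝ | (fun i => (q i : ℝ) + τ i) ∉ A}) := by
    apply dense_iInter_of_isOpen
    · intro q
      exact hA.isClosed.isOpen_compl.preimage (by fun_prop)
    · intro q
      have h1 : Dense (Aᶜ) := interior_eq_empty_iff_dense_compl.1 hAint
      exact h1.preimage (Homeomorph.addLeft (fun i => (q i : ℝ))).isOpenMap
  obtain ⟨τ, hτ⟩ := hd.nonempty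
  exact ⟨τ, fun q => Set.mem_iInter.1 hτ q⟩

theorem exists_wall (a x b t : ℝ) (h1 : a < x) (h2 : x < b) :
    ∃ l u : ℚ, a < l + t ∧ (l : ℝ) + t < x ∧ x < u + t ∧ (u : ℝ) + t < b := by
  obtain ⟨l, hl1, hl2⟩ := exists_rat_btwn (show a - t < x - t by linarith)
  obtain ⟨u, hu1, hu2⟩ := exists_rat_btwn (show x - t < b - t by linarith)
  exact ⟨l, u, by linarith, by linarith, by linarith, by linarith⟩

theorem dimLE_aux {κ : Type} [Fintype κ] [DecidableEq κ] (A : Set (κ → ℝ)) (hA : IsCompact A)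
    (τ : κ → ℝ) (hτ : ∀ q : κ → ℚ, (fun i => (q i : ℝ) + τ i) ∉ A) (k : ℕ) :
    ∀ (J : Finset κ) (q : κ → ℚ), Fintype.card κ = k + J.card →
      DimLE k (A ∩ {x | ∀ i ∈ J, x i = q i + τ i}) := by
  induction k with
  | zero =>
    intro J q hJ
    have hJ' : J = Finset.univ := by
      rw [← Finset.card_eq_iff_eq_univ]; omega
    have : A ∩ {x | ∀ i ∈ J, x i = q i + τ i} = ∅ := by
      ext x
      simp only [Set.mem_inter_iff, Set.mem_ofPred_eq, Set.mem_empty_iff_false, iff_false, not_and]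
      intro hx h
      apply hτ q
      have : x = (fun i => (q i : ℝ) + τ i) := by
        ext i; exact h i (by simp [hJ'])
      rwa [← this]
    rw [this]; exact DimLE.empty 0
  | succ k ih =>
    intro J q hJ ι _ U hU hcov
    set B := A ∩ {x | ∀ i ∈ J, x i = q i + τ i} with hB
    have hcl : ∀ (J : Finset κ) (q : κ → ℚ), IsClosed {x : κ → ℝ | ∀ i ∈ J, x i = q i + τ i} := by
      intro J q
      simp only [Set.ofPred_forall]
      exact isClosed_iInter fun i => isClosed_iInter fun _ =>
        isClosed_eq (continuous_apply i) continuous_const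
    have hBc : IsCompact B := hA.inter_right (hcl J q)
    have hbox : ∀ x : B, ∃ (i : ι) (l u : κ → ℚ), (∀ a, (l a : ℝ) + τ a < x.1 a ∧
        x.1 a < u a + τ a) ∧ (∀ y : κ → ℝ, (∀ a, (l a : ℝ) + τ a ≤ y a ∧ y a ≤ u a + τ a) →
          y ∈ U i) := by
      rintro ⟨x, hx⟩
      obtain ⟨i, hi⟩ := Set.mem_iUnion.1 (hcov hx)
      obtain ⟨ε, hε, hball⟩ := Metric.isOpen_iff.1 (hU i) x hi
      choose l u h1 h2 h3 h4 using fun a => exists_wall (x a - ε) (x a) (x a + ε) (τ a)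
        (by linarith) (by linarith)
      refine ⟨i, l, u, fun a => ⟨h2 a, h3 a⟩, fun y hy => hball ?_⟩
      rw [Metric.mem_ball, dist_pi_lt_iff hε]
      intro a
      rw [Real.dist_eq, abs_lt]
      constructor <;> linarith [h1 a, h4 a, (hy a).1, (hy a).2]
    choose ix l u hlu hbx using hbox
    let N : B → Set (κ → ℝ) := fun x => {y | ∀ a, (l x a : ℝ) + τ a < y a ∧ y a < u x a + τ a}
    let M : B → Set (κ → ℝ) := fun x => {y | ∀ a, (l x a : ℝ) + τ a ≤ y a ∧ y a ≤ u x a + τ a}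
    have hN : ∀ x, IsOpen (N x) := by
      intro x
      simp only [N, Set.ofPred_forall]
      refine isOpen_iInter_of_finite fun a => ?_
      exact (isOpen_lt continuous_const (continuous_apply a)).inter
        (isOpen_lt (continuous_apply a) continuous_const)
    have hM : ∀ x, IsClosed (M x) := by
      intro x
      simp only [M, Set.ofPred_forall]
      refine isClosed_iInter fun a => ?_
      exact (isClosed_le continuous_const (continuous_apply a)).inter
        (isClosed_le (continuous_apply a) continuous_const)
    obtain ⟨s, hs⟩ := hBc.elim_finite_subcover N hN
      (fun x hx => Set.mem_iUnion.2 ⟨⟨x, hx⟩, hlu ⟨x, hx⟩⟩)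
    -- walls
    let J' : B × κ × Bool → Set (κ → ℝ) := fun p =>
      A ∩ {x | ∀ i ∈ insert p.2.1 J, x i =
        Function.update q p.2.1 (if p.2.2 then u p.1 p.2.1 else l p.1 p.2.1) i + τ i}
    let walls : Finset (B × κ × Bool) := s ×ˢ (Jᶜ ×ˢ Finset.univ)
    have hwc : ∀ p ∈ walls, IsClosed (J' p) := fun p _ => hA.isClosed.inter (hcl _ _)
    have hwd : ∀ p ∈ walls, DimLE k (J' p) := by
      intro p hp
      apply ih
      have : p.2.1 ∉ J := by simpa [walls] using (Finset.mem_product.1 (Finset.mem_product.1 hp).2).1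
      rw [Finset.card_insert_of_notMem this]; omega
    have hZd := DimLE.biUnion walls J' hwc hwd
    set Z := ⋃ p ∈ walls, J' p with hZ
    have hZc : IsClosed Z := walls.finite_toSet.isClosed_biUnion hwc
    have hmemZ : ∀ x ∈ B, ∀ t ∈ s, x ∈ M t → x ∉ N t → x ∈ Z := by
      intro x hx t ht hM hN
      simp only [N, Set.mem_ofPred_eq, not_forall] at hN
      obtain ⟨a, ha⟩ := hN
      have haJ : a ∉ J := by
        intro haJ
        have h1 := hlu t a
        rw [t.2.2 a haJ, ← hx.2 a haJ] at h1
        exact ha h1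
      have key : ∀ bb : Bool, x a = (if bb then u t a else l t a : ℚ) + τ a → x ∈ Z := by
        intro bb hbb
        refine Set.mem_biUnion (x := (t, a, bb)) (by simp [walls, ht, haJ]) ⟨hx.1, ?_⟩
        intro i hi
        by_cases hia : i = a
        · subst hia; simpa using hbb
        · simp only [Function.update_of_ne hia]
          exact hx.2 i ((Finset.mem_insert.1 hi).resolve_left hia)
      have h2 := hM a
      by_cases h3 : (l t a : ℝ) + τ a < x a
      · apply key true
        have : ¬ x a < u t a + τ a := fun h => ha ⟨h3, h⟩
        simp only [if_true]
        linarith [h2.2]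
      · apply key false
        simp only [Bool.false_eq_true, if_false]
        linarith [h2.1]
    obtain ⟨V, hV, hVU, hZV, hord⟩ := DimLE.strong (A := Z ∩ B) (hZc.inter hBc.isClosed) (by
      have : Z ∩ B = Z := by
        rw [Set.inter_eq_left]
        rintro x hx
        simp only [hZ, Set.mem_iUnion] at hx
        obtain ⟨p, hp, hx⟩ := hx
        refine ⟨hx.1, fun i hi => ?_⟩
        have h := hx.2 i (Finset.mem_insert_of_mem hi)
        have : p.2.1 ∉ J := by
          simpa [walls] using (Finset.mem_product.1 (Finset.mem_product.1 hp).2).1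
        rwa [Function.update_of_ne (by rintro rfl; exact this hi)] at h
      rw [this]; exact hZd) U hU (Set.inter_subset_right.trans hcov)
    -- order the boxes
    let e := s.equivFin
    let E : s → Set (κ → ℝ) := fun t => N t \ ⋃ t' ∈ {t' : s | e t' < e t}, M t'
    have hE : ∀ t, IsOpen (E t) := fun t => (hN t).sdiff
      (Set.Finite.isClosed_biUnion (Set.toFinite _) fun t' _ => hM t')
    have hEdisj : ∀ t t' x, x ∈ E t → x ∈ E t' → t = t' := by
      have hNM : ∀ t x, x ∈ N t → x ∈ M t := fun t x h a => ⟨(h a).1.le, (h a).2.le⟩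
      intro t t' x h h'
      by_contra hne
      rcases lt_or_gt_of_ne (fun h => hne (e.injective h)) with hlt | hlt
      · exact h'.2 (Set.mem_biUnion (x := t) hlt (hNM _ _ h.1))
      · exact h.2 (Set.mem_biUnion (x := t') hlt (hNM _ _ h'.1))
    refine ⟨fun i => V i ∪ ⋃ t ∈ {t : s | ix t = i}, E t, fun i => (hV i).union
      (isOpen_biUnion fun t _ => hE t), ?_, ?_, ?_⟩
    · rintro i x (h | h)
      · exact hVU i h
      · simp only [Set.mem_iUnion] at h
        obtain ⟨t, rfl, h⟩ := h
        exact hbx t x fun a => ⟨(h.1 a).1.le, (h.1 a).2.le⟩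
    · intro x hx
      by_cases hxZ : x ∈ Z
      · obtain ⟨i, hi⟩ := Set.mem_iUnion.1 (hZV ⟨hxZ, hx⟩)
        exact Set.mem_iUnion.2 ⟨i, Or.inl hi⟩
      · have hne : (Finset.univ.filter fun t : s => x ∈ M t).Nonempty := by
          have := hs hx
          simp only [Set.mem_iUnion] at this
          obtain ⟨t, ht, h⟩ := this
          exact ⟨⟨t, ht⟩, by
            simp only [Finset.mem_filter, Finset.mem_univ, true_and]
            exact fun a => ⟨(h a).1.le, (h a).2.le⟩⟩
        obtain ⟨t, ht, hmin⟩ := Finset.exists_min_image _ e hne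
        simp only [Finset.mem_filter, Finset.mem_univ, true_and] at ht hmin
        refine Set.mem_iUnion.2 ⟨ix t, Or.inr (Set.mem_biUnion (x := t) rfl ⟨?_, ?_⟩)⟩
        · by_contra hxN
          exact hxZ (hmemZ x hx t t.2 ht hxN)
        · simp only [Set.mem_iUnion, not_exists]
          intro t' h1 h2
          exact absurd (hmin t' h2) (not_le.2 h1)
    · intro x hx F hF
      classical
      by_cases hxE : ∃ t, x ∈ E t
      · obtain ⟨t, ht⟩ := hxE
        have := hord x (F.erase (ix t)) (by
          intro j hj
          rw [Finset.mem_erase] at hj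
          rcases hF j hj.2 with h | h
          · exact h
          · simp only [Set.mem_iUnion] at h
            obtain ⟨t', rfl, h⟩ := h
            exact absurd (by rw [hEdisj t t' x ht h]) hj.1)
        have := Finset.pred_card_le_card_erase (s := F) (a := ix t)
        omega
      · have := hord x F (by
          intro j hj
          rcases hF j hj with h | h
          · exact h
          · simp only [Set.mem_iUnion] at h
            obtain ⟨t', rfl, h⟩ := h
            exact absurd ⟨t', h⟩ hxE)
        omega

theorem dimLE_of_interior_empty {κ : Type} [Fintype κ] (A : Set (κ → ℝ)) (hA : IsCompact A)
    (hAint : interior A = ∅) : DimLE (Fintype.card κ) A := by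
  classical
  obtain ⟨τ, hτ⟩ := exists_translate A hA hAint
  have := dimLE_aux A hA τ hτ (Fintype.card κ) ∅ 0 (by simp)
  simpa using this

theorem exists_colored_cover {B : Type*} [TopologicalSpace B] [NormalSpace B] {k : ℕ}
    (hB : DimLE k (Set.univ : Set B)) {ι : Type} [Finite ι] (U : ι → Set B)
    (hU : ∀ i, IsOpen (U i)) (hcov : ⋃ i, U i = Set.univ) :
    ∃ O : Finset ι → Set B, (∀ J, IsOpen (O J)) ∧ (∀ J, ∀ j ∈ J, O J ⊆ U j) ∧
      (∀ J J', J.card = J'.card → J ≠ J' → Disjoint (O J) (O J')) ∧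
      ∀ x, ∃ J, x ∈ O J ∧ 1 ≤ J.card ∧ J.card ≤ k := by
  classical
  obtain ⟨V, hV, hVU, hAV, hord⟩ := hB ι U hU hcov.ge
  obtain ⟨W, hAW, hWo, hWV⟩ := exists_subset_iUnion_closure_subset isClosed_univ hV
    (fun x _ => Set.toFinite _) hAV
  have hf : ∀ i, ∃ f : C(B, ℝ), Set.EqOn f 0 (V i)ᶜ ∧ Set.EqOn f 1 (closure (W i)) ∧
      ∀ x, f x ∈ Set.Icc (0 : ℝ) 1 := fun i =>
    exists_continuous_zero_one_of_isClosed (hV i).isClosed_compl isClosed_closure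
      (Set.disjoint_left.2 fun x h1 h2 => h1 (hWV i h2))
  choose f hf0 hf1 hf01 using hf
  haveI := Fintype.ofFinite ι
  have hpos : ∀ x i, 0 < f i x → x ∈ V i := by
    intro x i h
    by_contra hx
    have := hf0 i hx
    simp only [Pi.zero_apply] at this
    linarith
  refine ⟨fun J => (⋂ j ∈ J, ⋂ i ∈ Jᶜ, {x | f i x < f j x}) ∩ ⋂ j ∈ J, {x | 0 < f j x},
    ?_, ?_, ?_, ?_⟩
  · intro J
    refine IsOpen.inter ?_ ?_
    · refine isOpen_biInter_finset fun j _ => isOpen_biInter_finset fun i _ => ?_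
      exact isOpen_lt (f i).continuous (f j).continuous
    · exact isOpen_biInter_finset fun j _ => isOpen_lt continuous_const (f j).continuous
  · intro J j hj x hx
    have := Set.mem_iInter₂.1 hx.2 j hj
    exact hVU j (hpos x j this)
  · intro J J' hc hne
    rw [Set.disjoint_left]
    intro x hx hx'
    have h1 : ∃ a ∈ J, a ∉ J' := by
      by_contra h
      push Not at h
      exact hne (Finset.eq_of_subset_of_card_le h hc.ge)
    have h2 : ∃ a ∈ J', a ∉ J := by
      by_contra h
      push Not at h
      exact hne (Finset.eq_of_subset_of_card_le h hc.le).symm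
    obtain ⟨a, ha, ha'⟩ := h1
    obtain ⟨b, hb, hb'⟩ := h2
    have e1 := Set.mem_iInter₂.1 (Set.mem_iInter₂.1 hx.1 a ha) b (by simpa using hb')
    have e2 := Set.mem_iInter₂.1 (Set.mem_iInter₂.1 hx'.1 b hb) a (by simpa using ha')
    simp only [Set.mem_ofPred_eq] at e1 e2
    linarith
  · intro x
    refine ⟨Finset.univ.filter fun i => 0 < f i x, ⟨?_, ?_⟩, ?_, ?_⟩
    · simp only [Set.mem_iInter, Finset.mem_filter, Finset.mem_univ, true_and,
        Finset.mem_compl, Set.mem_ofPred_eq]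
      intro j hj i hi
      linarith
    · simp
    · obtain ⟨i, hi⟩ := Set.mem_iUnion.1 (hAW (Set.mem_univ x))
      refine Finset.card_pos.2 ⟨i, ?_⟩
      have := hf1 i (subset_closure hi)
      simp [this]
    · exact hord x trivial _ fun j hj => hpos x j (by simpa using hj)

end MilnorTC

open scoped unitInterval

namespace MilnorTC

/-- A local model: an open neighbourhood of `x` with `d` coordinates that deforms to `O`. -/
def LocModel (X : Type*) [TopologicalSpace X] (O : X) (d : ℕ) : Prop :=
  ∀ x : X, ∃ N : Set X, IsOpen N ∧ x ∈ N ∧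
    (∃ c : X → (Fin d → ℝ), ContinuousOn c N ∧ Set.InjOn c N) ∧
    ∃ h : X × I → X, ContinuousOn h (N ×ˢ Set.univ) ∧ (∀ w ∈ N, h (w, 0) = w) ∧
      ∀ w ∈ N, h (w, 1) = O

section
variable {X : Type*} [TopologicalSpace X]

theorem exists_section (O : X) (n : ℕ) (hn : 2 ≤ n) (N : Fin n → Set X)
    (h : Fin n → X × I → X) (hc : ∀ j, ContinuousOn (h j) (N j ×ˢ Set.univ))
    (h0 : ∀ j, ∀ w ∈ N j, h j (w, 0) = w) (h1 : ∀ j, ∀ w ∈ N j, h j (w, 1) = O) :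
    ∃ sg : C(Set.pi Set.univ N, C(I, X)), ∀ w, tcPi X n (sg w) = (w : Fin n → X) := by
  classical
  have hn1 : (0 : ℝ) < (n : ℝ) - 1 := by
    have : (2 : ℝ) ≤ n := by exact_mod_cast hn
    linarith
  let P := Set.pi Set.univ N
  let C : Fin n → Set (P × I) := fun j => {p | |(p.2 : ℝ) * ((n : ℝ) - 1) - j| ≤ 1 / 2}
  have hCc : ∀ j, IsClosed (C j) := fun j => by
    refine isClosed_le ?_ continuous_const
    fun_prop
  have hcov : ∀ p : P × I, ∃ j, p ∈ C j := by
    intro p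
    have hp0 := p.2.2.1
    have hp1 := p.2.2.2
    have hx0 : 0 ≤ (p.2 : ℝ) * ((n : ℝ) - 1) + 1 / 2 := by positivity
    have hlt : ⌊(p.2 : ℝ) * ((n : ℝ) - 1) + 1 / 2⌋₊ < n := by
      rw [Nat.floor_lt hx0]
      nlinarith
    refine ⟨⟨_, hlt⟩, ?_⟩
    have e1 := Nat.floor_le hx0
    have e2 := Nat.lt_floor_add_one ((p.2 : ℝ) * ((n : ℝ) - 1) + 1 / 2)
    change |(p.2 : ℝ) * ((n : ℝ) - 1) - ((⌊(p.2 : ℝ) * ((n : ℝ) - 1) + 1 / 2⌋₊ : ℕ) : ℝ)| ≤ 1 / 2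
    rw [abs_le]
    constructor <;> linarith
  let th : Fin n → P × I → I := fun j p =>
    Set.projIcc (0 : ℝ) 1 zero_le_one (2 * |(p.2 : ℝ) * ((n : ℝ) - 1) - j|)
  have hth : ∀ j, Continuous (th j) := fun j => continuous_projIcc.comp (by fun_prop)
  let F : Fin n → P × I → X := fun j p => h j (p.1.1 j, th j p)
  have hF : ∀ j, Continuous (F j) := by
    intro j
    have : Continuous fun p : P × I => (p.1.1 j, th j p) :=
      ((continuous_apply j).comp (continuous_subtype_val.comp continuous_fst)).prodMk (hth j)
    exact (hc j).comp_continuous this fun p => ⟨p.1.2 j trivial, trivial⟩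
  choose jj hjj using hcov
  have hagree : ∀ p i j, p ∈ C i → p ∈ C j → F i p = F j p := by
    intro p i j hi hj
    by_cases hij : i = j
    · rw [hij]
    · have hi' : |(p.2 : ℝ) * ((n : ℝ) - 1) - i| ≤ 1 / 2 := hi
      have hj' : |(p.2 : ℝ) * ((n : ℝ) - 1) - j| ≤ 1 / 2 := hj
      have hd : (1 : ℝ) ≤ |(i : ℝ) - j| := by
        have : (i : ℤ) - j ≠ 0 := by
          intro h; apply hij; ext; omega
        have := Int.one_le_abs this
        exact_mod_cast this
      have htri := abs_sub_le (i : ℝ) ((p.2 : ℝ) * ((n : ℝ) - 1)) j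
      rw [abs_sub_comm (i : ℝ) ((p.2 : ℝ) * ((n : ℝ) - 1))] at htri
      have e1 : th i p = 1 := Set.projIcc_of_right_le _ (by linarith)
      have e2 : th j p = 1 := Set.projIcc_of_right_le _ (by linarith)
      simp only [F, e1, e2]
      rw [h1 i _ (p.1.2 i trivial), h1 j _ (p.1.2 j trivial)]
  let G : P × I → X := fun p => F (jj p) p
  have hG : Continuous G := by
    refine (locallyFinite_of_finite C).continuous ?_ hCc ?_
    · exact Set.eq_univ_of_forall fun p => Set.mem_iUnion.2 ⟨jj p, hjj p⟩
    · intro i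
      exact (hF i).continuousOn.congr fun p hp => hagree p _ _ (hjj p) hp
  refine ⟨ContinuousMap.curry ⟨G, hG⟩, fun w => ?_⟩
  funext i
  have hi0 : (0 : ℝ) ≤ (i : ℝ) / ((n : ℝ) - 1) := by positivity
  have hi1 : (i : ℝ) / ((n : ℝ) - 1) ≤ 1 := by
    rw [div_le_one hn1]
    have : (i : ℕ) + 1 ≤ n := i.2
    have : ((i : ℕ) : ℝ) + 1 ≤ n := by exact_mod_cast this
    linarith
  have hproj : ((Set.projIcc (0 : ℝ) 1 zero_le_one ((i : ℝ) / ((n : ℝ) - 1)) : I) : ℝ)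
      = (i : ℝ) / ((n : ℝ) - 1) := by
    rw [Set.projIcc_of_mem _ ⟨hi0, hi1⟩]
  change G (w, _) = _
  have hz : ((Set.projIcc (0 : ℝ) 1 zero_le_one ((i : ℝ) / ((n : ℝ) - 1)) : I) : ℝ)
      * ((n : ℝ) - 1) - i = 0 := by
    rw [hproj]; field_simp; ring
  rw [show G (w, _) = F i (w, _) from hagree _ _ _ (hjj _) (by
    change |((Set.projIcc (0 : ℝ) 1 zero_le_one ((i : ℝ) / ((n : ℝ) - 1)) : I) : ℝ)
      * ((n : ℝ) - 1) - i| ≤ 1 / 2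
    rw [hz]; norm_num)]
  have e1 : th i (w, Set.projIcc (0 : ℝ) 1 zero_le_one ((i : ℝ) / ((n : ℝ) - 1))) = 0 := by
    simp only [th]
    apply Set.projIcc_of_le_left
    rw [hz]; simp
  simp only [F, e1]
  exact h0 i _ (w.2 i trivial)

end
end MilnorTC

open scoped unitInterval

namespace MilnorTC

/-- real projective space -/
abbrev Pr (m : ℕ) := Projectivization ℝ (Fin m → ℝ)

theorem sumsq_pos {m : ℕ} {x : Fin m → ℝ} (hx : x ≠ 0) : 0 < ∑ k, x k ^ 2 := by
  obtain ⟨i, hi⟩ := Function.ne_iff.1 hx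
  refine Finset.sum_pos' (fun k _ => sq_nonneg _) ⟨i, Finset.mem_univ _, ?_⟩
  have : x i ≠ 0 := hi
  positivity

/-- The orthogonal projection matrix of a line. -/
noncomputable def pm {m : ℕ} (p : Pr m) (i j : Fin m) : ℝ := p.rep i * p.rep j / ∑ k, p.rep k ^ 2

theorem pm_mk {m : ℕ} (x : Fin m → ℝ) (hx : x ≠ 0) (i j : Fin m) :
    pm (Projectivization.mk ℝ x hx) i j = x i * x j / ∑ k, x k ^ 2 := by
  obtain ⟨a, ha⟩ := Projectivization.exists_smul_eq_mk_rep ℝ x hx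
  have ha0 : (a : ℝ) ≠ 0 := a.ne_zero
  have hr : ∀ i, (Projectivization.mk ℝ x hx).rep i = a * x i := fun i => by
    rw [← ha]; rfl
  simp only [pm, hr, mul_pow, ← Finset.mul_sum]
  have := (sumsq_pos hx).ne'
  field_simp

theorem mk_cont (m : ℕ) : Continuous fun x : {x : Fin m → ℝ // x ≠ 0} =>
    Projectivization.mk ℝ x.1 x.2 := continuous_quotient_mk'

theorem pm_cont {m : ℕ} (i j : Fin m) : Continuous fun p : Pr m => pm p i j := by
  refine continuous_quot_lift (r := (projectivizationSetoid ℝ (Fin m → ℝ)))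
    (f := fun x : {x : Fin m → ℝ // x ≠ 0} => x.1 i * x.1 j / ∑ k, x.1 k ^ 2) ?_ ?_ |>.congr ?_
  · intro a b h
    have : Projectivization.mk ℝ a.1 a.2 = Projectivization.mk ℝ b.1 b.2 := Quotient.sound h
    rw [← pm_mk a.1 a.2, this, pm_mk]
  · have hc : ∀ k, Continuous fun x : {x : Fin m → ℝ // x ≠ 0} => x.1 k := fun k =>
      (continuous_apply k).comp continuous_subtype_val
    exact ((hc i).mul (hc j)).div (continuous_finsetSum _ fun k _ => (hc k).pow 2)
      fun x => (sumsq_pos x.2).ne'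
  · intro p
    induction p using Projectivization.ind with
    | h x hx => rw [pm_mk]; rfl

theorem pm_diag_ne {m : ℕ} (p : Pr m) (i : Fin m) : pm p i i ≠ 0 ↔ p.rep i ≠ 0 := by
  have := (sumsq_pos p.rep_nonzero).ne'
  simp [pm, this]

theorem pm_col {m : ℕ} (p : Pr m) (a i : Fin m) (h : p.rep a ≠ 0) :
    pm p i a / pm p a a = (p.rep a)⁻¹ * p.rep i := by
  have := (sumsq_pos p.rep_nonzero).ne'
  simp only [pm]
  field_simp

theorem mk_eq_of_smul {m : ℕ} (p : Pr m) (x : Fin m → ℝ) (hx : x ≠ 0) (c : ℝ)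
    (h : ∀ i, x i = c * p.rep i) : Projectivization.mk ℝ x hx = p := by
  rw [← Projectivization.mk_rep p]
  rw [Projectivization.mk_eq_mk_iff']
  exact ⟨c, by funext i; simp [h i]⟩

theorem pm_inj {m : ℕ} : Function.Injective (fun (p : Pr m) => (fun i j => pm p i j : Fin m → Fin m → ℝ)) := by
  intro p q h
  have hpq : ∀ i j, pm p i j = pm q i j := fun i j => congrFun (congrFun h i) j
  obtain ⟨a, ha⟩ := Function.ne_iff.1 p.rep_nonzero
  have ha' : p.rep a ≠ 0 := ha
  have hb' : q.rep a ≠ 0 := by rw [← pm_diag_ne, ← hpq, pm_diag_ne]; exact ha'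
  rw [← Projectivization.mk_rep p]
  refine mk_eq_of_smul q _ _ (p.rep a * (q.rep a)⁻¹) fun i => ?_
  have h1 := pm_col p a i ha'
  have h2 := pm_col q a i hb'
  rw [hpq, hpq, h2] at h1
  rw [mul_assoc, h1]
  field_simp

instance pr_t2 (m : ℕ) : T2Space (Pr m) :=
  T2Space.of_injective_continuous (pm_inj (m := m))
    (continuous_pi fun i => continuous_pi fun j => pm_cont i j)

instance pr_compact (m : ℕ) : CompactSpace (Pr m) := by
  let S : Set (EuclideanSpace ℝ (Fin m)) := Metric.sphere 0 1
  have : CompactSpace S := isCompact_iff_compactSpace.1 (isCompact_sphere 0 1)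
  have hne : ∀ x : S, (x : EuclideanSpace ℝ (Fin m)).ofLp ≠ 0 := by
    intro x hx
    have h1 : ‖(x : EuclideanSpace ℝ (Fin m))‖ = 1 := mem_sphere_zero_iff_norm.1 x.2
    have h2 : (x : EuclideanSpace ℝ (Fin m)) = 0 := by
      ext i; simpa using congrFun hx i
    rw [h2] at h1; simp at h1
  let f : S → Pr m := fun x => Projectivization.mk ℝ _ (hne x)
  have hf : Continuous f := (mk_cont m).comp (Continuous.subtype_mk
    ((PiLp.continuous_ofLp 2 _).comp continuous_subtype_val) hne)
  have hs : Function.Surjective f := by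
    intro p
    have hx : (WithLp.toLp 2 p.rep : EuclideanSpace ℝ (Fin m)) ≠ 0 := by
      intro h
      apply p.rep_nonzero
      funext i
      have := congrArg (fun v : EuclideanSpace ℝ (Fin m) => v i) h
      simpa using this
    refine ⟨⟨‖(WithLp.toLp 2 p.rep : EuclideanSpace ℝ (Fin m))‖⁻¹ • WithLp.toLp 2 p.rep, ?_⟩, ?_⟩
    · simp only [S, mem_sphere_zero_iff_norm, norm_smul, norm_inv, norm_norm]
      exact inv_mul_cancel₀ (norm_ne_zero_iff.2 hx)
    · exact mk_eq_of_smul p _ _ _ fun i => rfl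
  exact hs.compactSpace hf

section
variable {r s : ℕ}

/-- The bilinear form defining the Milnor manifold. -/
noncomputable def dot (hsr : s ≤ r) (x : Fin (r + 1) → ℝ) (y : Fin (s + 1) → ℝ) : ℝ :=
  ∑ i : Fin (s + 1), x (Fin.castLE (by omega) i) * y i

theorem mem_milnor (hsr : s ≤ r) (p : Pr (r + 1) × Pr (s + 1)) :
    p ∈ RealMilnor r s ↔ dot hsr p.1.rep p.2.rep = 0 := by
  have : (∑ i : Fin (min (s + 1) (r + 1)),
      p.1.rep (Fin.castLE (min_le_right _ _) i) * p.2.rep (Fin.castLE (min_le_left _ _) i))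
      = dot hsr p.1.rep p.2.rep := by
    unfold dot
    exact Fintype.sum_equiv (finCongr (by omega)) _ _ fun i => rfl
  rw [← this]; rfl

theorem mem_milnor_mk (hsr : s ≤ r) (x : Fin (r + 1) → ℝ) (hx : x ≠ 0) (y : Fin (s + 1) → ℝ)
    (hy : y ≠ 0) : (Projectivization.mk ℝ x hx, Projectivization.mk ℝ y hy) ∈ RealMilnor r s ↔
      dot hsr x y = 0 := by
  rw [mem_milnor hsr]
  obtain ⟨a, ha⟩ := Projectivization.exists_smul_eq_mk_rep ℝ x hx
  obtain ⟨b, hb⟩ := Projectivization.exists_smul_eq_mk_rep ℝ y hy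
  have h1 : dot hsr (Projectivization.mk ℝ x hx).rep (Projectivization.mk ℝ y hy).rep
      = a * b * dot hsr x y := by
    rw [← ha, ← hb]
    simp only [dot, Finset.mul_sum]
    refine Finset.sum_congr rfl fun i _ => ?_
    change (a : ℝ) * x _ * ((b : ℝ) * y i) = _
    ring
  simp only [h1, mul_eq_zero, a.ne_zero, b.ne_zero, false_or]

theorem milnor_closed (hsr : s ≤ r) : IsClosed (RealMilnor r s) := by
  have : RealMilnor r s = {p | ∑ i : Fin (s + 1), ∑ j : Fin (s + 1),
      pm p.1 (Fin.castLE (by omega) i) (Fin.castLE (by omega) j) * pm p.2 i j = 0} := by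
    ext p
    rw [mem_milnor hsr]
    have h1 := (sumsq_pos p.1.rep_nonzero).ne'
    have h2 := (sumsq_pos p.2.rep_nonzero).ne'
    have : (∑ i : Fin (s + 1), ∑ j : Fin (s + 1),
      pm p.1 (Fin.castLE (by omega) i) (Fin.castLE (by omega) j) * pm p.2 i j)
      = dot hsr p.1.rep p.2.rep ^ 2 / ((∑ k, p.1.rep k ^ 2) * ∑ k, p.2.rep k ^ 2) := by
      rw [sq, dot, Finset.sum_mul_sum, Finset.sum_div]
      refine Finset.sum_congr rfl fun i _ => ?_
      rw [Finset.sum_div]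
      refine Finset.sum_congr rfl fun j _ => ?_
      simp only [pm]
      field_simp
    rw [Set.mem_ofPred_eq, this]
    simp [h1, h2]
  rw [this]
  refine isClosed_eq ?_ continuous_const
  refine continuous_finsetSum _ fun i _ => continuous_finsetSum _ fun j _ => ?_
  exact ((pm_cont _ _).comp continuous_fst).mul ((pm_cont _ _).comp continuous_snd)

theorem milnor_compact (hsr : s ≤ r) : CompactSpace (RealMilnor r s) :=
  isCompact_iff_compactSpace.1 (milnor_closed hsr).isCompact

/-- normalized `x`-vector with the `b` entry solving the equation -/
noncomputable def chX (hsr : s ≤ r) (a : Fin (r + 1)) (b : Fin (s + 1)) (u : Fin (r + 1) → ℝ)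
    (w : Fin (s + 1) → ℝ) : Fin (r + 1) → ℝ := fun i =>
  if i = Fin.castLE (by omega) b then
    - ∑ j ∈ Finset.univ.erase b, (Function.update u a 1) (Fin.castLE (by omega) j) *
      (Function.update w b 1) j
  else Function.update u a 1 i

theorem chX_a (hsr : s ≤ r) {a : Fin (r + 1)} {b : Fin (s + 1)} (hab : a ≠ Fin.castLE (by omega) b)
    (u : Fin (r + 1) → ℝ) (w : Fin (s + 1) → ℝ) : chX hsr a b u w a = 1 := by
  simp [chX, hab]

theorem chX_dot (hsr : s ≤ r) {a : Fin (r + 1)} {b : Fin (s + 1)}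
    (u : Fin (r + 1) → ℝ) (w : Fin (s + 1) → ℝ) :
    dot hsr (chX hsr a b u w) (Function.update w b 1) = 0 := by
  unfold dot
  rw [← Finset.add_sum_erase _ _ (Finset.mem_univ b)]
  have h1 : ∀ j ∈ Finset.univ.erase b, chX hsr a b u w (Fin.castLE (by omega) j) * Function.update w b 1 j
     = (Function.update u a 1) (Fin.castLE (by omega) j) * (Function.update w b 1) j := by
    intro j hj
    have hj' : j ≠ b := (Finset.mem_erase.1 hj).1
    have : Fin.castLE (by omega : s + 1 ≤ r + 1) j ≠ Fin.castLE (by omega) b := fun h => hj' (Fin.castLE_injective _ h)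
    simp only [chX, this, if_false]
  rw [Finset.sum_congr rfl h1]
  simp [chX]

/-- chart parametrization -/
noncomputable def pt (hsr : s ≤ r) {a : Fin (r + 1)} {b : Fin (s + 1)} (hab : a ≠ Fin.castLE (by omega) b)
    (u : (Fin (r + 1) → ℝ) × (Fin (s + 1) → ℝ)) : RealMilnor r s :=
  ⟨(Projectivization.mk ℝ (chX hsr a b u.1 u.2) (fun h => by
      have := chX_a hsr hab u.1 u.2; rw [h] at this; simp at this),
    Projectivization.mk ℝ (Function.update u.2 b 1) (fun h => by
      have := congrFun h b; simp at this)), (mem_milnor_mk hsr _ _ _ _).2 (chX_dot hsr _ _)⟩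

theorem chX_ne (hsr : s ≤ r) {a : Fin (r + 1)} {b : Fin (s + 1)} (hab : a ≠ Fin.castLE (by omega) b)
    (u : Fin (r + 1) → ℝ) (w : Fin (s + 1) → ℝ) : chX hsr a b u w ≠ 0 := fun h => by
  have := chX_a hsr hab u w; rw [h] at this; simp at this

theorem upd_ne (b : Fin (s + 1)) (w : Fin (s + 1) → ℝ) : Function.update w b 1 ≠ 0 := fun h => by
  have := congrFun h b; simp at this

theorem pt_cont (hsr : s ≤ r) {a : Fin (r + 1)} {b : Fin (s + 1)} (hab : a ≠ Fin.castLE (by omega) b) :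
    Continuous (pt hsr hab) := by
  have hu1 : Continuous fun u : (Fin (r + 1) → ℝ) × (Fin (s + 1) → ℝ) => Function.update u.1 a (1 : ℝ) :=
    continuous_fst.update a continuous_const
  have hu2 : Continuous fun u : (Fin (r + 1) → ℝ) × (Fin (s + 1) → ℝ) => Function.update u.2 b (1 : ℝ) :=
    continuous_snd.update b continuous_const
  have hc : Continuous fun u : (Fin (r + 1) → ℝ) × (Fin (s + 1) → ℝ) => chX hsr a b u.1 u.2 := by
    refine continuous_pi fun i => ?_
    unfold chX
    split_ifs
    · refine (continuous_finsetSum _ fun j _ => ?_).neg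
      exact (continuous_pi_iff.1 hu1 _).mul (continuous_pi_iff.1 hu2 _)
    · exact continuous_pi_iff.1 hu1 _
  refine Continuous.subtype_mk (Continuous.prodMk ?_ ?_) _
  · exact (mk_cont _).comp (Continuous.subtype_mk hc fun u => chX_ne hsr hab u.1 u.2)
  · exact (mk_cont _).comp (Continuous.subtype_mk hu2 fun u => upd_ne b u.2)

theorem chX_eq (hsr : s ≤ r) {a : Fin (r + 1)} {b : Fin (s + 1)} (_hab : a ≠ Fin.castLE (by omega) b)
    (u : Fin (r + 1) → ℝ) (w : Fin (s + 1) → ℝ) (ha : u a = 1) (hb : w b = 1) (h : dot hsr u w = 0) :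
    chX hsr a b u w = u ∧ Function.update w b 1 = w := by
  have hw : Function.update w b 1 = w := by rw [← hb]; simp
  have hu : Function.update u a 1 = u := by rw [← ha]; simp
  refine ⟨?_, hw⟩
  funext i
  unfold chX
  rw [hw, hu]
  split_ifs with hi
  · subst hi
    unfold dot at h
    rw [← Finset.add_sum_erase _ _ (Finset.mem_univ b), hb] at h
    linarith
  · rfl

/-- normalized coordinates -/
noncomputable def nrm (a : Fin (r + 1)) (b : Fin (s + 1)) (p : RealMilnor r s) :
    (Fin (r + 1) → ℝ) × (Fin (s + 1) → ℝ) :=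
  (fun i => pm p.1.1 i a / pm p.1.1 a a, fun i => pm p.1.2 i b / pm p.1.2 b b)

theorem pt_nrm (hsr : s ≤ r) {a : Fin (r + 1)} {b : Fin (s + 1)} (hab : a ≠ Fin.castLE (by omega) b)
    (p : RealMilnor r s) (ha : pm p.1.1 a a ≠ 0) (hb : pm p.1.2 b b ≠ 0) : pt hsr hab (nrm a b p) = p := by
  have ha' := (pm_diag_ne _ _).1 ha
  have hb' := (pm_diag_ne _ _).1 hb
  have hx : ∀ i, (nrm a b p).1 i = (p.1.1.rep a)⁻¹ * p.1.1.rep i := fun i => pm_col _ _ _ ha'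
  have hy : ∀ i, (nrm a b p).2 i = (p.1.2.rep b)⁻¹ * p.1.2.rep i := fun i => pm_col _ _ _ hb'
  have hd : dot hsr (nrm a b p).1 (nrm a b p).2 = 0 := by
    have h0 := (mem_milnor hsr p.1).1 p.2
    have : dot hsr (nrm a b p).1 (nrm a b p).2
        = (p.1.1.rep a)⁻¹ * (p.1.2.rep b)⁻¹ * dot hsr p.1.1.rep p.1.2.rep := by
      simp only [dot, hx, hy, Finset.mul_sum]
      refine Finset.sum_congr rfl fun i _ => by ring
    rw [this, h0, mul_zero]
  obtain ⟨e1, e2⟩ := chX_eq hsr hab (nrm a b p).1 (nrm a b p).2 (by rw [hx, inv_mul_cancel₀ ha'])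
    (by rw [hy, inv_mul_cancel₀ hb']) hd
  apply Subtype.ext
  refine Prod.ext ?_ ?_
  · refine mk_eq_of_smul _ _ _ (p.1.1.rep a)⁻¹ fun i => ?_
    rw [e1]; exact hx i
  · refine mk_eq_of_smul _ _ _ (p.1.2.rep b)⁻¹ fun i => ?_
    rw [e2]; exact hy i

theorem pt_congr (hsr : s ≤ r) {a : Fin (r + 1)} {b : Fin (s + 1)} (hab : a ≠ Fin.castLE (by omega) b)
    (u u' : (Fin (r + 1) → ℝ) × (Fin (s + 1) → ℝ))
    (h1 : ∀ i, i ≠ a → i ≠ Fin.castLE (by omega) b → u.1 i = u'.1 i)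
    (h2 : ∀ i, i ≠ b → u.2 i = u'.2 i) : pt hsr hab u = pt hsr hab u' := by
  have e2 : Function.update u.2 b 1 = Function.update u'.2 b 1 := by
    funext i
    by_cases hi : i = b
    · subst hi; simp
    · simp [hi, h2 i hi]
  have e0 : ∀ i, i ≠ Fin.castLE (by omega) b → Function.update u.1 a 1 i = Function.update u'.1 a 1 i := by
    intro i hi
    by_cases hia : i = a
    · subst hia; simp
    · simp [hia, h1 i hia hi]
  have e1 : chX hsr a b u.1 u.2 = chX hsr a b u'.1 u'.2 := by
    funext i
    unfold chX
    split_ifs with hi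
    · rw [e2]
      congr 1
      refine Finset.sum_congr rfl fun j hj => ?_
      rw [e0]
      exact fun h => (Finset.mem_erase.1 hj).1 (Fin.castLE_injective _ h)
    · exact e0 i hi
  unfold pt
  simp only [e1, e2]

/-- alternating vector -/
noncomputable def alt (m : ℕ) : Fin m → ℝ := fun i => (-1) ^ (i : ℕ)

theorem alt_ne (i : Fin (r + 1)) : alt (r + 1) i ≠ 0 := by
  unfold alt; positivity

theorem dot_alt (hsr : s ≤ r) (hs : Odd s) (c : ℝ) :
    dot hsr (fun i => c * alt (r + 1) i) (fun _ => 1) = 0 := by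
  have : ∑ i : Fin (s + 1), (-1 : ℝ) ^ (i : ℕ) = 0 := by
    rw [Fin.sum_univ_eq_sum_range (fun i => (-1 : ℝ) ^ i)]
    rw [neg_one_geom_sum, if_pos (by exact hs.add_one)]
  simp only [dot, alt, mul_one, Fin.val_castLE, ← Finset.mul_sum, this, mul_zero]

/-- the base point -/
noncomputable def basePt (hsr : s ≤ r) (hs : Odd s) : RealMilnor r s :=
  ⟨(Projectivization.mk ℝ (alt (r + 1)) (fun h => alt_ne 0 (congrFun h 0)),
    Projectivization.mk ℝ (fun _ => 1) (fun h => by simpa using congrFun h 0)),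
    (mem_milnor_mk hsr _ _ _ _).2 (by simpa using dot_alt hsr hs 1)⟩

theorem pt_base (hsr : s ≤ r) (hs : Odd s) {a : Fin (r + 1)} {b : Fin (s + 1)} (hab : a ≠ Fin.castLE (by omega) b) :
    pt hsr hab (fun i => (alt (r + 1) a)⁻¹ * alt (r + 1) i, fun _ => 1) = basePt hsr hs := by
  obtain ⟨e1, e2⟩ := chX_eq hsr hab (fun i => (alt (r + 1) a)⁻¹ * alt (r + 1) i) (fun _ => 1)
    (inv_mul_cancel₀ (alt_ne a)) rfl (dot_alt hsr hs _)
  apply Subtype.ext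
  refine Prod.ext ?_ ?_
  · change Projectivization.mk ℝ _ _ = Projectivization.mk ℝ _ _
    rw [Projectivization.mk_eq_mk_iff']
    exact ⟨(alt (r + 1) a)⁻¹, by rw [e1]; rfl⟩
  · change Projectivization.mk ℝ _ _ = Projectivization.mk ℝ _ _
    rw [Projectivization.mk_eq_mk_iff']
    exact ⟨1, by rw [e2]; simp⟩

theorem exists_chart (hsr : s ≤ r) (p : RealMilnor r s) : ∃ (a : Fin (r + 1)) (b : Fin (s + 1)),
    a ≠ Fin.castLE (by omega) b ∧ p.1.1.rep a ≠ 0 ∧ p.1.2.rep b ≠ 0 := by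
  obtain ⟨b, hb⟩ := Function.ne_iff.1 p.1.2.rep_nonzero
  have hb' : p.1.2.rep b ≠ 0 := hb
  by_contra hcon
  push Not at hcon
  have h0 : ∀ a, a ≠ Fin.castLE (by omega) b → p.1.1.rep a = 0 := fun a ha => by
    by_contra h
    exact hb' (hcon a b ha h)
  have hd := (mem_milnor hsr p.1).1 p.2
  unfold dot at hd
  rw [← Finset.add_sum_erase _ _ (Finset.mem_univ b), Finset.sum_eq_zero, add_zero] at hd
  · rcases mul_eq_zero.1 hd with h | h
    · apply p.1.1.rep_nonzero
      funext i
      by_cases hi : i = Fin.castLE (by omega) b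
      · rw [hi, h]; rfl
      · exact h0 i hi
    · exact hb' h
  · intro j hj
    rw [h0, zero_mul]
    exact fun h => (Finset.mem_erase.1 hj).1 (Fin.castLE_injective _ h)

theorem card_idx (hsr : s ≤ r) {a : Fin (r + 1)} {b : Fin (s + 1)} (hab : a ≠ Fin.castLE (by omega) b) :
    Fintype.card ({i : Fin (r + 1) // i ≠ a ∧ i ≠ Fin.castLE (by omega) b} ⊕ {i : Fin (s + 1) // i ≠ b})
      = r + s - 1 := by
  rw [Fintype.card_sum, Fintype.card_subtype, Fintype.card_subtype]
  have h1 : (Finset.univ.filter fun i : Fin (r + 1) => i ≠ a ∧ i ≠ Fin.castLE (by omega) b)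
      = Finset.univ \ {a, Fin.castLE (by omega) b} := by ext; simp
  have h2 : (Finset.univ.filter fun i : Fin (s + 1) => i ≠ b) = Finset.univ.erase b := by ext; simp
  rw [h1, h2, Finset.card_univ_sdiff, Finset.card_pair hab, Finset.card_erase_of_mem (Finset.mem_univ _)]
  have : 0 < r := by
    by_contra h
    have : r = 0 := by omega
    subst this
    apply hab
    ext; simp
  simp
  omega

theorem milnor_locModel (hsr : s ≤ r) (hs : Odd s) :
    LocModel (RealMilnor r s) (basePt hsr hs) (r + s - 1) := by
  intro p
  obtain ⟨a, b, hab, ha, hb⟩ := exists_chart hsr p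
  have hpc1 : ∀ i j, Continuous fun p : RealMilnor r s => pm p.1.1 i j := fun i j =>
    (pm_cont i j).comp (continuous_fst.comp continuous_subtype_val)
  have hpc2 : ∀ i j, Continuous fun p : RealMilnor r s => pm p.1.2 i j := fun i j =>
    (pm_cont i j).comp (continuous_snd.comp continuous_subtype_val)
  let N : Set (RealMilnor r s) := {p | pm p.1.1 a a ≠ 0} ∩ {p | pm p.1.2 b b ≠ 0}
  have hN : IsOpen N := (isOpen_ne_fun (hpc1 a a) continuous_const).inter
    (isOpen_ne_fun (hpc2 b b) continuous_const)
  have hn1 : ContinuousOn (fun p => (nrm a b p).1) N :=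
    continuousOn_pi.2 fun i => (hpc1 i a).continuousOn.div (hpc1 a a).continuousOn fun p hp => hp.1
  have hn2 : ContinuousOn (fun p => (nrm a b p).2) N :=
    continuousOn_pi.2 fun i => (hpc2 i b).continuousOn.div (hpc2 b b).continuousOn fun p hp => hp.2
  have e := Fintype.equivFinOfCardEq (card_idx hsr hab)
  refine ⟨N, hN, ⟨(pm_diag_ne _ _).2 ha, (pm_diag_ne _ _).2 hb⟩,
    ⟨fun p k => Sum.elim (fun i => (nrm a b p).1 i.1) (fun i => (nrm a b p).2 i.1) (e.symm k), ?_, ?_⟩, ?_⟩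
  · refine continuousOn_pi.2 fun k => ?_
    rcases e.symm k with i | i
    · exact continuousOn_pi.1 hn1 i.1
    · exact continuousOn_pi.1 hn2 i.1
  · intro p hp p' hp' h
    rw [← pt_nrm hsr hab p hp.1 hp.2, ← pt_nrm hsr hab p' hp'.1 hp'.2]
    apply pt_congr
    · intro i hia hib
      have := congrFun h (e (Sum.inl ⟨i, hia, hib⟩))
      simpa using this
    · intro i hib
      have := congrFun h (e (Sum.inr ⟨i, hib⟩))
      simpa using this
  · refine ⟨fun w => pt hsr hab ((1 - (w.2 : ℝ)) • (nrm a b w.1).1 +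
        (w.2 : ℝ) • (fun i => (alt (r + 1) a)⁻¹ * alt (r + 1) i),
      (1 - (w.2 : ℝ)) • (nrm a b w.1).2 + (w.2 : ℝ) • (fun _ => 1)), ?_, ?_, ?_⟩
    · have hc2 : ContinuousOn (fun w : RealMilnor r s × I => (w.2 : ℝ)) (N ×ˢ Set.univ) :=
        (continuous_subtype_val.comp continuous_snd).continuousOn
      have hc1 : ContinuousOn (fun w : RealMilnor r s × I => 1 - (w.2 : ℝ)) (N ×ˢ Set.univ) :=
        continuousOn_const.sub hc2
      refine (pt_cont hsr hab).comp_continuousOn (ContinuousOn.prodMk ?_ ?_)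
      · refine ContinuousOn.add (ContinuousOn.smul hc1 ?_) (hc2.smul continuousOn_const)
        exact hn1.comp continuousOn_fst fun w hw => hw.1
      · refine ContinuousOn.add (ContinuousOn.smul hc1 ?_) (hc2.smul continuousOn_const)
        exact hn2.comp continuousOn_fst fun w hw => hw.1
    · intro w hw
      simp only [Set.Icc.coe_zero, sub_zero, one_smul, zero_smul, add_zero]
      exact pt_nrm hsr hab w hw.1 hw.2
    · intro w hw
      simp only [Set.Icc.coe_one, sub_self, one_smul, zero_smul, zero_add]
      exact pt_base hsr hs hab

end
end MilnorTC

open scoped unitInterval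

namespace MilnorTC

set_option linter.unusedSectionVars false

theorem circle_continuous_coe : Continuous (fun g : Circle => (g : ℂ)) := continuous_subtype_val

section
variable {M : Type*} [TopologicalSpace M] [CompactSpace M] [T2Space M] [MulAction Circle M]
  [ContinuousSMul Circle M]

/-- The integrand of the averaging construction. -/
noncomputable def avgF (h : C(M, ℝ)) (v : M) (θ : ℝ) : ℂ :=
  (((Circle.exp θ)⁻¹ : Circle) : ℂ) * (h (Circle.exp θ • v) : ℂ)

theorem avgF_cont (h : C(M, ℝ)) : Continuous (Function.uncurry (avgF h)) := by
  refine Continuous.mul (circle_continuous_coe.comp ?_) (Complex.continuous_ofReal.comp (h.continuous.comp ?_))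
  · exact (Circle.exp.continuous.comp continuous_snd).inv
  · exact (Circle.exp.continuous.comp continuous_snd).smul continuous_fst

/-- The averaged function. -/
noncomputable def avg (h : C(M, ℝ)) (v : M) : ℂ := ∫ θ in (-Real.pi)..Real.pi, avgF h v θ

theorem avg_cont (h : C(M, ℝ)) : Continuous (avg h) :=
  intervalIntegral.continuous_parametric_intervalIntegral_of_continuous' (avgF_cont h) _ _

theorem avg_smul (h : C(M, ℝ)) (g : Circle) (v : M) : avg h (g • v) = g * avg h v := by
  obtain ⟨α, rfl⟩ := Circle.exp_surjective g
  have h1 : ∀ θ, avgF h (Circle.exp α • v) θ = (Circle.exp α : ℂ) * avgF h v (θ + α) := by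
    intro θ
    have e : ((Circle.exp (θ + α))⁻¹ : Circle) = (Circle.exp α)⁻¹ * (Circle.exp θ)⁻¹ := by
      rw [Circle.exp_add, mul_inv_rev]
    unfold avgF
    rw [e, Circle.exp_add, mul_smul, Circle.coe_mul, ← mul_assoc, ← mul_assoc, ← Circle.coe_mul,
      mul_inv_cancel, Circle.coe_one, one_mul]
  have hper : Function.Periodic (avgF h v) (2 * Real.pi) := by
    intro θ
    unfold avgF
    rw [Circle.periodic_exp θ]
  have h2 := hper.intervalIntegral_add_eq (-Real.pi + α) (-Real.pi)
  rw [show -Real.pi + 2 * Real.pi = Real.pi by ring,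
      show -Real.pi + α + 2 * Real.pi = Real.pi + α by ring] at h2
  unfold avg
  rw [← h2, ← intervalIntegral.integral_comp_add_right, ← intervalIntegral.integral_const_mul]
  exact intervalIntegral.integral_congr fun θ _ => h1 θ

theorem avgF_re (h : C(M, ℝ)) (v : M) (θ : ℝ) :
    (avgF h v θ).re = Real.cos θ * h (Circle.exp θ • v) := by
  unfold avgF
  rw [Complex.re_mul_ofReal, Circle.coe_inv_eq_conj, Complex.conj_re, Circle.coe_exp,
    Complex.exp_ofReal_mul_I_re]

theorem avg_pos (h : C(M, ℝ)) (v0 : M) (hh : ∀ x, 0 ≤ h x) (h1 : h v0 = 1)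
    (h0 : ∀ θ : ℝ, Real.cos θ ≤ 1 / 2 → h (Circle.exp θ • v0) = 0) : 0 < (avg h v0).re := by
  have hFv : Continuous (avgF h v0) :=
    Continuous.comp (g := Function.uncurry (avgF h)) (f := fun θ : ℝ => (v0, θ)) (avgF_cont h)
      (Continuous.prodMk_right v0)
  have e1 : (avg h v0).re = ∫ θ in (-Real.pi)..Real.pi, (avgF h v0 θ).re := by
    have := ContinuousLinearMap.intervalIntegral_comp_comm (𝕜 := ℝ) Complex.reCLM
      (hFv.intervalIntegrable (μ := MeasureTheory.volume) (-Real.pi) Real.pi)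
    simp only [Complex.reCLM_apply] at this
    rw [this, avg]
  rw [e1]
  refine intervalIntegral.integral_pos (by linarith [Real.pi_pos])
    (Complex.continuous_re.comp hFv).continuousOn ?_ ⟨0, ⟨by linarith [Real.pi_pos], Real.pi_pos.le⟩, ?_⟩
  · intro θ _
    rw [avgF_re]
    by_cases hc : Real.cos θ ≤ 1 / 2
    · rw [h0 θ hc]; simp
    · exact mul_nonneg (by linarith) (hh _)
  · rw [avgF_re, Circle.exp_zero, one_smul, h1]; simp

theorem exists_equivariant_fn (v0 : M) (hfree : ∀ g : Circle, g • v0 = v0 → g = 1) :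
    ∃ φ : M → ℂ, Continuous φ ∧ (∀ (g : Circle) v, φ (g • v) = g * φ v) ∧ φ v0 = 1 := by
  let S : Set M := (fun g : Circle => g • v0) '' {g | (g : ℂ).re ≤ 1 / 2}
  have hS : IsClosed S := by
    refine (IsCompact.image ?_ (by fun_prop)).isClosed
    exact (isClosed_le (Complex.continuous_re.comp circle_continuous_coe) continuous_const).isCompact
  have hv0 : v0 ∉ S := by
    rintro ⟨g, hg, h⟩
    have hg' : (g : ℂ).re ≤ 1 / 2 := hg
    rw [hfree g h] at hg'
    norm_num at hg'
  obtain ⟨h, hh0, hh1, hh⟩ := exists_continuous_zero_one_of_isClosed hS (isClosed_singleton (x := v0))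
    (Set.disjoint_singleton_right.2 hv0)
  have hpos := avg_pos h v0 (fun x => (hh x).1) (hh1 (Set.mem_singleton v0)) (fun θ hc =>
    hh0 ⟨Circle.exp θ, by
      change (Circle.exp θ : ℂ).re ≤ 1 / 2
      rw [Circle.coe_exp, Complex.exp_ofReal_mul_I_re]; exact hc, rfl⟩)
  have hne : avg h v0 ≠ 0 := fun h => by rw [h] at hpos; simp at hpos
  refine ⟨fun v => avg h v / avg h v0, (avg_cont h).div_const _, fun g v => ?_, div_self hne⟩
  change avg h (g • v) / avg h v0 = g * (avg h v / avg h v0)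
  rw [avg_smul, mul_div_assoc]

/-- the unit complex number in the direction of `z` -/
noncomputable def dir (z : ℂ) : Circle :=
  if h : z ≠ 0 then ⟨z / ‖z‖, by
    have h' : ‖z‖ ≠ 0 := by simpa using h
    have : ‖z / (‖z‖ : ℂ)‖ = 1 := by rw [norm_div]; simp [h']
    exact mem_sphere_zero_iff_norm.2 this⟩ else 1

theorem dir_coe {z : ℂ} (h : z ≠ 0) : (dir z : ℂ) = z / ‖z‖ := by
  simp [dir, h]

theorem dir_mul (g : Circle) {z : ℂ} (h : z ≠ 0) : dir (g * z) = g * dir z := by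
  apply Circle.ext
  rw [dir_coe (mul_ne_zero g.coe_ne_zero h), Circle.coe_mul, dir_coe h]
  rw [norm_mul, Circle.norm_coe, one_mul, mul_div_assoc]

theorem continuousOn_dir : ContinuousOn dir {z : ℂ | z ≠ 0} := by
  rw [continuousOn_iff_continuous_domRestrict]
  refine Continuous.subtype_mk (p := fun z => z ∈ Submonoid.unitSphere ℂ)
    (f := fun z : {z : ℂ | z ≠ 0} => ((dir z : Circle) : ℂ)) ?_ (fun z => (dir z).2)
  have : (fun z : {z : ℂ | z ≠ 0} => ((dir z : Circle) : ℂ)) = fun z : {z : ℂ | z ≠ 0} => (z : ℂ) / (‖(z : ℂ)‖ : ℂ) := by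
    funext z; exact dir_coe z.2
  rw [this]
  refine continuous_subtype_val.div (by fun_prop) fun z => ?_
  have h2 : (z : ℂ) ≠ 0 := z.2
  simpa using h2

theorem dir_one : dir 1 = 1 := by
  apply Circle.ext; rw [dir_coe one_ne_zero]; simp

instance properCircle : ProperSMul Circle M where
  isProperMap_smul_pair := Continuous.isProperMap (by fun_prop)

/-- The orbit space. -/
abbrev Orb (M : Type*) [MulAction Circle M] := Quotient (MulAction.orbitRel Circle M)

theorem orb_t2 : T2Space (Orb M) := t2Space_quotient_mulAction_of_properSMul

/-- Local slice theorem. -/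
theorem exists_slice {κ : Type} [Fintype κ] (v0 : M) (hfree : ∀ (g : Circle) (v : M), g • v = v → g = 1)
    (N : Set M) (hN : IsOpen N) (hv : v0 ∈ N) (c : M → κ → ℝ) (hc : ContinuousOn c N)
    (hi : Set.InjOn c N) :
    ∃ gh : M → Circle, ∃ U : Set M, IsOpen U ∧ v0 ∈ U ∧ (∀ (g : Circle), ∀ v ∈ U, g • v ∈ U) ∧
      ContinuousOn gh U ∧ (∀ v ∈ U, (gh v)⁻¹ • v ∈ N) ∧ (∀ (g : Circle), ∀ v ∈ U, gh (g • v) = g * gh v) ∧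
      ∃ A : Set (Orb M), IsClosed A ∧ A ∈ nhds (Quotient.mk _ v0 : Orb M) ∧ DimLE (Fintype.card κ) A := by
  obtain ⟨φ, hφ, hφe, hφ0⟩ := exists_equivariant_fn v0 (fun g => hfree g v0)
  obtain ⟨K, hK, hKN, hKc⟩ := local_compact_nhds (hN.mem_nhds hv)
  let gh : M → Circle := fun v => dir (φ v)
  let U0 : Set M := {v | φ v ≠ 0}
  have hU0 : IsOpen U0 := isOpen_ne_fun hφ continuous_const
  have hgh : ContinuousOn gh U0 := continuousOn_dir.comp hφ.continuousOn fun v hv => hv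
  have hU0v : v0 ∈ U0 := by simp [U0, hφ0]
  have hghe : ∀ (g : Circle), ∀ v ∈ U0, gh (g • v) = g * gh v := fun g v hv => by
    simp only [gh, hφe]; exact dir_mul g hv
  have hgh0 : gh v0 = 1 := by simp only [gh, hφ0, dir_one]
  have hU0i : ∀ (g : Circle), ∀ v ∈ U0, g • v ∈ U0 := fun g v hv => by
    simp only [U0, Set.mem_ofPred_eq, hφe] at hv ⊢
    exact mul_ne_zero g.coe_ne_zero hv
  have hret : ContinuousOn (fun v => (gh v)⁻¹ • v) U0 := hgh.inv.smul continuousOn_id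
  let U : Set M := U0 ∩ (fun v => (gh v)⁻¹ • v) ⁻¹' N
  have hreti : ∀ (g : Circle), ∀ v ∈ U0, (gh (g • v))⁻¹ • (g • v) = (gh v)⁻¹ • v := fun g v hv => by
    rw [hghe g v hv, smul_smul]; congr 1; simp [mul_comm]
  let A0 : Set M := K ∩ {v | (φ v).im = 0 ∧ 1 / 2 ≤ (φ v).re}
  have hA0 : IsCompact A0 := by
    refine hKc.inter_right (IsClosed.inter ?_ ?_)
    · exact isClosed_eq (Complex.continuous_im.comp hφ) continuous_const
    · exact isClosed_le continuous_const (Complex.continuous_re.comp hφ)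
  have horb : ∀ (g : Circle), ∀ v ∈ A0, g • v ∈ A0 → g = 1 := by
    rintro g v ⟨_, h1, h2⟩ ⟨_, h3, h4⟩
    rw [hφe] at h3 h4
    simp only [Complex.mul_im, Complex.mul_re, h1, mul_zero, zero_add, sub_zero] at h3 h4
    have him : (g : ℂ).im = 0 := by
      rcases mul_eq_zero.1 h3 with h | h
      · exact h
      · linarith
    have hre : 0 < (g : ℂ).re := by
      by_contra hc
      nlinarith
    have hn : (g : ℂ).re ^ 2 = 1 := by
      have := Circle.normSq_coe g
      rw [Complex.normSq_apply, him] at this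
      nlinarith
    apply Circle.ext
    apply Complex.ext
    · simp; nlinarith
    · simpa using him
  have := orb_t2 (M := M)
  let q : M → Orb M := Quotient.mk _
  have hq : Continuous q := continuous_quotient_mk'
  refine ⟨gh, U, hret.isOpen_inter_preimage hU0 hN, ⟨hU0v, ?_⟩, ?_, hgh.mono Set.inter_subset_left,
    fun v hv => hv.2, fun g v hv => hghe g v hv.1, q '' A0, (hA0.image hq).isClosed, ?_, ?_⟩
  · simpa [hgh0] using hv
  · intro g v hv
    refine ⟨hU0i g v hv.1, ?_⟩
    change (gh (g • v))⁻¹ • (g • v) ∈ N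
    rw [hreti g v hv.1]; exact hv.2
  · -- neighbourhood
    let W : Set M := (U0 ∩ (fun v => (gh v)⁻¹ • v) ⁻¹' interior K) ∩ {v | 1 / 2 < ‖φ v‖}
    have hW : IsOpen W := (hret.isOpen_inter_preimage hU0 isOpen_interior).inter
      (isOpen_lt continuous_const hφ.norm)
    have hWv : v0 ∈ W := by
      refine ⟨⟨hU0v, ?_⟩, ?_⟩
      · simpa [hgh0] using mem_interior_iff_mem_nhds.2 hK
      · simp [hφ0]; norm_num
    have hqo : IsOpenMap q := isOpenMap_quotient_mk'_mul
    refine Filter.mem_of_superset ((hqo W hW).mem_nhds ⟨v0, hWv, rfl⟩) ?_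
    rintro _ ⟨v, ⟨⟨h1, h2⟩, h3⟩, rfl⟩
    refine ⟨(gh v)⁻¹ • v, ⟨interior_subset h2, ?_⟩, ?_⟩
    · have h1' : φ v ≠ 0 := h1
      have : φ ((gh v)⁻¹ • v) = (‖φ v‖ : ℂ) := by
        rw [hφe, Circle.coe_inv, dir_coe h1']
        have : (‖φ v‖ : ℂ) ≠ 0 := by simpa using h1'
        field_simp
      change (φ ((gh v)⁻¹ • v)).im = 0 ∧ _ ≤ (φ ((gh v)⁻¹ • v)).re
      rw [this]
      exact ⟨Complex.ofReal_im _, le_of_lt h3⟩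
    · exact Quotient.sound ⟨(gh v)⁻¹, rfl⟩
  · -- dimension
    have hA0N : A0 ⊆ N := fun v hv => hKN hv.1
    have hCc : IsCompact (c '' A0) := hA0.image_of_continuousOn (hc.mono hA0N)
    have hAint : interior (c '' A0) = ∅ := by
      rw [Set.eq_empty_iff_forall_notMem]
      intro y hy
      obtain ⟨v, hvA, rfl⟩ := interior_subset hy
      have hcts : Continuous fun θ : ℝ => Circle.exp θ • v :=
        Circle.exp.continuous.smul continuous_const
      have h0 : Circle.exp 0 • v = v := by simp
      have hca : ContinuousAt c v := hc.continuousAt (hN.mem_nhds (hA0N hvA))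
      have hev1 : ∀ᶠ θ in nhds (0 : ℝ), Circle.exp θ • v ∈ N :=
        hcts.continuousAt.eventually_mem (by rw [h0]; exact hN.mem_nhds (hA0N hvA))
      have hev2 : ∀ᶠ θ in nhds (0 : ℝ), c (Circle.exp θ • v) ∈ interior (c '' A0) := by
        have : ContinuousAt (fun θ : ℝ => c (Circle.exp θ • v)) 0 :=
          ContinuousAt.comp (g := c) (by rw [h0]; exact hca) hcts.continuousAt
        exact this.eventually_mem (by rw [h0]; exact isOpen_interior.mem_nhds hy)
      have hev3 : ∀ᶠ θ in nhds (0 : ℝ), θ < Real.pi := eventually_lt_nhds Real.pi_pos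
      have hev : ∀ᶠ θ in nhdsWithin (0 : ℝ) (Set.Ioi 0), False := by
        filter_upwards [self_mem_nhdsWithin, nhdsWithin_le_nhds hev1, nhdsWithin_le_nhds hev2,
          nhdsWithin_le_nhds hev3] with θ hp h1 h2 h3
        obtain ⟨v', hv', he⟩ := interior_subset h2
        have : v' = Circle.exp θ • v := hi (hA0N hv') h1 he
        have := horb _ v hvA (this ▸ hv')
        have h5 : (Circle.exp θ : ℂ).im = 0 := by rw [this]; simp
        rw [Circle.coe_exp, Complex.exp_ofReal_mul_I_im] at h5
        exact (Real.sin_pos_of_pos_of_lt_pi hp h3).ne' h5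
      exact (hev.exists).choose_spec
    have hd := dimLE_of_interior_empty _ hCc hAint
    have : CompactSpace A0 := isCompact_iff_compactSpace.1 hA0
    have hr1 : Set.range (fun v : A0 => c v) = c '' A0 := by
      ext; simp
    have hr2 : Set.range (fun v : A0 => q v) = q '' A0 := by
      ext; simp
    rw [← hr1] at hd
    rw [← hr2]
    refine DimLE.transport (fun v : A0 => c v) (fun v : A0 => q v) ?_ ?_ ?_ ?_ hd
    · exact continuousOn_iff_continuous_domRestrict.1 (hc.mono hA0N)
    · exact hq.comp continuous_subtype_val
    · intro a b hab
      exact Subtype.ext (hi (hA0N a.2) (hA0N b.2) hab)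
    · intro a b hab
      obtain ⟨g, hg⟩ := Quotient.exact hab
      have hg' : g • (b : M) = a := hg
      have := horb g b b.2 (hg' ▸ a.2)
      apply Subtype.ext
      rw [← hg', this, one_smul]

end
end MilnorTC

open scoped unitInterval

namespace MilnorTC

set_option linter.unusedSectionVars false

section
variable {X : Type} [TopologicalSpace X] [CompactSpace X] [T2Space X] [MulAction Circle X]
  [ContinuousSMul Circle X]

/-- The set whose infimum defines `eqHigherTC`. -/
def tcSet (X : Type) [TopologicalSpace X] [MulAction Circle X] (n : ℕ) : Set ℕ :=
  {k | 0 < k ∧ ∃ U : Fin k → Set (Fin n → X),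
    (∀ i, IsOpen (U i)) ∧ (⋃ i, U i) = Set.univ ∧
    (∀ i (g : Circle), ∀ v ∈ U i, g • v ∈ U i) ∧
    ∀ i, ∃ sec : C(U i, C(I, X)),
      (∀ (g : Circle) (v : U i) (hgv : g • (v : Fin n → X) ∈ U i) (t : I),
        (sec ⟨g • (v : Fin n → X), hgv⟩) t = g • (sec v) t) ∧
      ∃ H : C(U i × I, Fin n → X),
        (∀ v : U i, H (v, 0) = tcPi X n (sec v)) ∧
        (∀ v : U i, H (v, 1) = (v : Fin n → X)) ∧
        (∀ (g : Circle) (v : U i) (hgv : g • (v : Fin n → X) ∈ U i) (t : I),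
          H (⟨g • (v : Fin n → X), hgv⟩, t) = g • H (v, t))}

theorem eqHigherTC_eq (n : ℕ) : eqHigherTC Circle X n = sInf (tcSet X n) := rfl

theorem exists_eq_section (O : X) (d n : ℕ) (hn : 2 ≤ n) (hX : LocModel X O d)
    (hfree : ∀ (g : Circle) (x : X), g • x = x → g = 1) (v0 : Fin n → X) :
    ∃ U : Set (Fin n → X), IsOpen U ∧ v0 ∈ U ∧ (∀ (g : Circle), ∀ v ∈ U, g • v ∈ U) ∧
      (∃ sec : (Fin n → X) → C(I, X), ContinuousOn sec U ∧
        (∀ (g : Circle), ∀ v ∈ U, sec (g • v) = g • sec v) ∧ ∀ v ∈ U, tcPi X n (sec v) = v) ∧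
      ∃ A : Set (Orb (Fin n → X)), IsClosed A ∧ A ∈ nhds (Quotient.mk _ v0 : Orb (Fin n → X)) ∧
        DimLE (n * d) A := by
  classical
  choose N hNo hxN c h using hX
  choose hcc hci using c
  choose hci hcj using hci
  choose h hh using h
  have hfreeM : ∀ (g : Circle) (v : Fin n → X), g • v = v → g = 1 := fun g v hv =>
    hfree g (v ⟨0, by omega⟩) (congrFun hv _)
  let P : Set (Fin n → X) := Set.pi Set.univ fun j => N (v0 j)
  have hP : IsOpen P := isOpen_set_pi Set.finite_univ fun j _ => hNo _
  obtain ⟨sg, hsg⟩ := exists_section O n hn (fun j => N (v0 j)) (fun j => h (v0 j))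
    (fun j => (hh _).1) (fun j => (hh _).2.1) (fun j => (hh _).2.2)
  let c : (Fin n → X) → (Fin n × Fin d → ℝ) := fun v p => hcc (v0 p.1) (v p.1) p.2
  obtain ⟨gh, U, hU, hvU, hUi, hgh, hghN, hghe, A, hA, hAn, hAd⟩ := exists_slice v0 hfreeM P hP
    (fun j _ => hxN _) c (by
      rw [continuousOn_pi]
      rintro ⟨j, i⟩
      have := (hci (v0 j)).comp (continuous_apply j).continuousOn
        (fun v (hv : v ∈ P) => hv j trivial)
      exact (continuous_apply i).comp_continuousOn this) (by
      intro v hv w hw hvw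
      funext j
      refine hcj (v0 j) (hv j trivial) (hw j trivial) ?_
      funext i
      exact congrFun hvw (j, i))
  refine ⟨U, hU, hvU, hUi, ?_, A, hA, hAn, ?_⟩
  · let sg' : (Fin n → X) → C(I, X) := fun v => if hv : v ∈ P then sg ⟨v, hv⟩ else .const _ O
    have hsg'v : ∀ v (hv : v ∈ P), sg' v = sg ⟨v, hv⟩ := fun v hv => dif_pos hv
    have hsg' : ContinuousOn sg' P := by
      rw [continuousOn_iff_continuous_domRestrict]
      refine sg.continuous.congr fun v => ?_
      exact (hsg'v v v.2).symm
    refine ⟨fun v => gh v • sg' ((gh v)⁻¹ • v), ?_, ?_, ?_⟩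
    · exact hgh.smul (hsg'.comp (hgh.inv.smul continuousOn_id) fun v hv => hghN v hv)
    · intro g v hv
      have : (gh (g • v))⁻¹ • (g • v) = (gh v)⁻¹ • v := by
        rw [hghe g v hv, smul_smul]; congr 1; simp [mul_comm]
      beta_reduce
      rw [this, hghe g v hv, mul_smul]
    · intro v hv
      have h1 := hsg ⟨_, hghN v hv⟩
      rw [← hsg'v] at h1
      funext i
      have h2 := congrFun h1 i
      change gh v • (sg' ((gh v)⁻¹ • v)) _ = v i
      change (sg' ((gh v)⁻¹ • v)) _ = (gh v)⁻¹ • v i at h2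
      rw [h2, smul_inv_smul]
  · simpa using hAd

theorem upper_mem (O : X) (d n : ℕ) (hn : 2 ≤ n) (hd : 0 < d) (hX : LocModel X O d)
    (hfree : ∀ (g : Circle) (x : X), g • x = x → g = 1) : n * d ∈ tcSet X n := by
  classical
  choose U hU hvU hUi sec A hA hAn hAd using exists_eq_section O d n hn hX hfree
  choose sec hsc hse hst using sec
  let B := Orb (Fin n → X)
  have hT2 : T2Space B := orb_t2
  let q : (Fin n → X) → B := Quotient.mk _
  have hq : Continuous q := continuous_quotient_mk'
  have hqo : IsOpenMap q := isOpenMap_quotient_mk'_mul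
  have hqg : ∀ (g : Circle) v, q (g • v) = q v := fun g v => Quotient.sound ⟨g, rfl⟩
  obtain ⟨t, ht⟩ := CompactSpace.elim_nhds_subcover (fun v0 => U v0 ∩ q ⁻¹' A v0) (fun v0 =>
    Filter.inter_mem ((hU v0).mem_nhds (hvU v0)) (hq.continuousAt (hAn v0)))
  have ht' : ∀ v, ∃ w ∈ t, v ∈ U w ∧ q v ∈ A w := by
    intro v
    have : v ∈ ⋃ x ∈ t, U x ∩ q ⁻¹' A x := by rw [ht]; trivial
    obtain ⟨w, hw, h⟩ := Set.mem_iUnion₂.1 this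
    exact ⟨w, hw, h⟩
  have hdim : DimLE (n * d) (Set.univ : Set B) := by
    have := DimLE.biUnion t A (fun w _ => hA w) (fun w _ => hAd w)
    have hu : (⋃ w ∈ t, A w) = (Set.univ : Set B) := by
      rw [Set.eq_univ_iff_forall]
      intro b
      obtain ⟨v, rfl⟩ := Quotient.exists_rep b
      obtain ⟨w, hw, _, h⟩ := ht' v
      exact Set.mem_biUnion hw h
    rwa [hu] at this
  obtain ⟨W, hW, hWU, hWd, hWc⟩ := exists_colored_cover hdim (ι := t) (fun w => q '' U w)
    (fun w => hqo _ (hU w)) (by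
      rw [Set.eq_univ_iff_forall]
      intro b
      obtain ⟨v, rfl⟩ := Quotient.exists_rep b
      obtain ⟨w, hw, h, _⟩ := ht' v
      exact Set.mem_iUnion.2 ⟨⟨w, hw⟩, v, h, rfl⟩)
  have hqU : ∀ w v, q v ∈ q '' U w → v ∈ U w := by
    rintro w v ⟨v', hv', he⟩
    obtain ⟨g, hg⟩ := Quotient.exact he
    have hg' : g • v = v' := hg
    have := hUi w g⁻¹ v' hv'
    rwa [← hg', inv_smul_smul] at this
  let V : Fin (n * d) → Set (Fin n → X) := fun c => {v | ∃ J : Finset t, J.card = c + 1 ∧ q v ∈ W J}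
  have hV : ∀ c, IsOpen (V c) := by
    intro c
    have : V c = ⋃ J : {J : Finset t // J.card = c + 1}, q ⁻¹' W J := by
      ext v; simp [V]
    rw [this]
    exact isOpen_iUnion fun J => (hW J).preimage hq
  refine ⟨Nat.mul_pos (by omega) hd, V, hV, ?_, ?_, ?_⟩
  · rw [Set.eq_univ_iff_forall]
    intro v
    obtain ⟨J, h1, h2, h3⟩ := hWc (q v)
    exact Set.mem_iUnion.2 ⟨⟨J.card - 1, by omega⟩, J, by simp; omega, h1⟩
  · rintro c g v ⟨J, h1, h2⟩
    exact ⟨J, h1, by rw [hqg]; exact h2⟩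
  · intro c
    have hpick : ∀ v : V c, ∃ J : Finset t, J.card = c + 1 ∧ q v ∈ W J := fun v => v.2
    choose JJ hJc hJW using hpick
    have hJu : ∀ (v : V c) (J : Finset t), J.card = c + 1 → q v ∈ W J → JJ v = J := by
      intro v J h1 h2
      by_contra hne
      exact Set.disjoint_left.1 (hWd _ _ ((hJc v).trans h1.symm) hne) (hJW v) h2
    have hex : ∀ J : Finset t, ∃ j : (Fin n → X), J.card = c + 1 → ∃ hj : j ∈ t, (⟨j, hj⟩ : t) ∈ J := by
      intro J
      by_cases hJ : J.card = c + 1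
      · obtain ⟨j, hj⟩ := Finset.card_pos.1 (by omega : 0 < J.card)
        exact ⟨j.1, fun _ => ⟨j.2, hj⟩⟩
      · exact ⟨fun _ => O, fun h => absurd h hJ⟩
    choose pick hpick using hex
    have hpU : ∀ (v : V c) (J : Finset t), J.card = c + 1 → q v ∈ W J → (v : Fin n → X) ∈ U (pick J) := by
      intro v J h1 h2
      obtain ⟨hj, hjJ⟩ := hpick J h1
      exact hqU _ _ (hWU J _ hjJ h2)
    have hcont : Continuous fun v : V c => sec (pick (JJ v)) v := by
      rw [continuous_iff_continuousAt]
      intro v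
      have h1 : ContinuousAt (fun w : V c => sec (pick (JJ v)) w) v := by
        have hh := (hsc (pick (JJ v))).continuousAt ((hU _).mem_nhds (hpU v _ (hJc v) (hJW v)))
        exact ContinuousAt.comp (f := fun w : V c => (w : Fin n → X)) hh
          continuous_subtype_val.continuousAt
      refine h1.congr ?_
      have : ∀ᶠ w : V c in nhds v, q w ∈ W (JJ v) :=
        (hq.comp continuous_subtype_val).continuousAt.eventually_mem ((hW _).mem_nhds (hJW v))
      filter_upwards [this] with w hw
      rw [hJu w _ (hJc v) hw]
    refine ⟨⟨_, hcont⟩, ?_, ⟨fun p => (p.1 : Fin n → X), by fun_prop⟩, ?_, fun _ => rfl, fun _ _ _ _ => rfl⟩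
    · intro g v hgv tt
      change sec (pick (JJ ⟨g • (v : Fin n → X), hgv⟩)) (g • (v : Fin n → X)) tt = g • sec (pick (JJ v)) v tt
      have : JJ ⟨g • (v : Fin n → X), hgv⟩ = JJ v := by
        apply hJu _ _ (hJc v)
        change q (g • (v : Fin n → X)) ∈ _
        rw [hqg]; exact hJW v
      rw [this, hse _ g v (hpU v _ (hJc v) (hJW v))]
      rfl
    · intro v
      exact (hst _ v (hpU v _ (hJc v) (hJW v))).symm

end
end MilnorTC

namespace MilnorTC

section chains
variable {P : Type*}

/-- Mod 2 (augmented) ordered chains. -/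
abbrev Ch (P : Type*) := List P →₀ ZMod 2

/-- linear extension -/
noncomputable abbrev lin {A : Type*} [AddCommGroup A] [Module (ZMod 2) A] (f : List P → A) :
    Ch P →ₗ[ZMod 2] A := Finsupp.linearCombination (ZMod 2) f

/-- basis chain -/
noncomputable abbrev bs (l : List P) : Ch P := Finsupp.single l 1

theorem lin_bs {A : Type*} [AddCommGroup A] [Module (ZMod 2) A] (f : List P → A) (l : List P) :
    lin f (bs l) = f l := by simp

/-- cone -/
noncomputable def cone (a : P) : Ch P →ₗ[ZMod 2] Ch P := lin fun l => bs (a :: l)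

theorem cone_bs (a : P) (l : List P) : cone a (bs l) = bs (a :: l) := lin_bs _ _

/-- boundary of a list -/
noncomputable def bdL : List P → Ch P
  | [] => 0
  | a :: l => bs l + cone a (bdL l)

/-- boundary -/
noncomputable def bd : Ch P →ₗ[ZMod 2] Ch P := lin bdL

theorem bd_bs (l : List P) : bd (bs l) = bdL l := lin_bs _ _

theorem ch_add_self (c : Ch P) : c + c = 0 := by
  ext l; simp [CharTwo.add_self_eq_zero]

theorem lhom_ext {A : Type*} [AddCommGroup A] [Module (ZMod 2) A] {f g : Ch P →ₗ[ZMod 2] A}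
    (h : ∀ l, f (bs l) = g (bs l)) : f = g := by
  apply Finsupp.lhom_ext'
  intro l
  ext
  exact h l

theorem bd_cone (a : P) (c : Ch P) : bd (cone a c) = c + cone a (bd c) := by
  have : bd ∘ₗ cone a = LinearMap.id + cone a ∘ₗ bd := by
    refine lhom_ext fun l => ?_
    simp only [LinearMap.comp_apply, LinearMap.add_apply, LinearMap.id_apply, cone_bs, bd_bs]
    rfl
  exact LinearMap.congr_fun this c

theorem bd_bdL (l : List P) : bd (bdL l) = 0 := by
  induction l with
  | nil => simp [bdL]
  | cons a l ih =>
    rw [bdL, map_add, bd_bs, bd_cone, ih, map_zero, add_zero, ch_add_self]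

theorem bd_bd (c : Ch P) : bd (bd c) = 0 := by
  have : bd ∘ₗ bd = (0 : Ch P →ₗ[ZMod 2] Ch P) := by
    refine lhom_ext fun l => ?_
    simp only [LinearMap.comp_apply, bd_bs, bd_bdL, LinearMap.zero_apply]
  exact LinearMap.congr_fun this c

variable (b : List P → P)

/-- subdivision -/
noncomputable def Sd : ℕ → Ch P →ₗ[ZMod 2] Ch P
  | 0 => LinearMap.id
  | k + 1 => lin fun l => cone (b l) (Sd k (bdL l))

theorem Sd_succ (k : ℕ) (l : List P) : Sd b (k + 1) (bs l) = cone (b l) (Sd b k (bdL l)) := lin_bs _ _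

theorem bd_Sd (k : ℕ) (c : Ch P) : bd (Sd b (k + 1) c) = Sd b k (bd c) := by
  have : bd ∘ₗ Sd b (k + 1) = Sd b k ∘ₗ bd := by
    induction k with
    | zero =>
      refine lhom_ext fun l => ?_
      simp only [LinearMap.comp_apply, Sd_succ, bd_cone, bd_bs]
      simp [Sd, bd_bdL]
    | succ k ih =>
      refine lhom_ext fun l => ?_
      simp only [LinearMap.comp_apply, bd_bs]
      rw [Sd_succ, bd_cone]
      have := LinearMap.congr_fun ih (bdL l)
      simp only [LinearMap.comp_apply] at this
      rw [this, bd_bdL, map_zero, map_zero, add_zero]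
  exact LinearMap.congr_fun this c

/-- chain homotopy -/
noncomputable def Tc : ℕ → Ch P →ₗ[ZMod 2] Ch P
  | 0 => 0
  | k + 1 => lin fun l => cone (b l) (bs l + Tc k (bdL l))

theorem Tc_succ (k : ℕ) (l : List P) : Tc b (k + 1) (bs l) = cone (b l) (bs l + Tc b k (bdL l)) := lin_bs _ _

theorem bd_Tc (k : ℕ) (c : Ch P) : bd (Tc b (k + 1) c) = c + Sd b (k + 1) c + Tc b k (bd c) := by
  have : bd ∘ₗ Tc b (k + 1) = LinearMap.id + Sd b (k + 1) + Tc b k ∘ₗ bd := by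
    induction k with
    | zero =>
      refine lhom_ext fun l => ?_
      simp only [LinearMap.comp_apply, LinearMap.add_apply, LinearMap.id_apply, Sd_succ, Tc_succ, bd_cone, bd_bs,
        map_add]
      simp [Sd, Tc]
    | succ k ih =>
      refine lhom_ext fun l => ?_
      simp only [LinearMap.comp_apply, LinearMap.add_apply, LinearMap.id_apply, bd_bs]
      rw [Tc_succ, bd_cone, Sd_succ]
      have := LinearMap.congr_fun ih (bdL l)
      simp only [LinearMap.comp_apply, LinearMap.add_apply, LinearMap.id_apply] at this
      rw [map_add, bd_bs, this, bd_bdL, map_zero, add_zero, ← add_assoc, ch_add_self, zero_add]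
      abel
  exact LinearMap.congr_fun this c

/-! supports -/

/-- all lists of the chain satisfy `Q` -/
def Sup (Q : List P → Prop) (c : Ch P) : Prop := ∀ l ∈ c.support, Q l

theorem Sup.zero (Q : List P → Prop) : Sup Q (0 : Ch P) := by intro l hl; simp at hl

theorem Sup.bs {Q : List P → Prop} {l : List P} (h : Q l) : Sup Q (bs l) := by
  intro l' hl'
  have := Finsupp.support_single_subset hl'
  rw [Finset.mem_singleton] at this
  exact this ▸ h

theorem Sup.add {Q : List P → Prop} {c c' : Ch P} (h : Sup Q c) (h' : Sup Q c') : Sup Q (c + c') := by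
  classical
  intro l hl
  rcases Finset.mem_union.1 (Finsupp.support_add hl) with h1 | h1
  · exact h l h1
  · exact h' l h1

theorem Sup.sum {ι : Type*} {Q : List P → Prop} (s : Finset ι) (c : ι → Ch P) (h : ∀ i ∈ s, Sup Q (c i)) :
    Sup Q (∑ i ∈ s, c i) := by
  classical
  induction s using Finset.induction_on with
  | empty => simpa using Sup.zero Q
  | insert a s ha ih =>
    rw [Finset.sum_insert ha]
    exact (h a (Finset.mem_insert_self _ _)).add (ih fun i hi => h i (Finset.mem_insert_of_mem hi))

theorem Sup.smul {Q : List P → Prop} {c : Ch P} (a : ZMod 2) (h : Sup Q c) : Sup Q (a • c) :=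
  fun l hl => h l (Finsupp.support_smul hl)

theorem Sup.lin {Q Q' : List P → Prop} {c : Ch P} (hc : Sup Q c) (f : Ch P →ₗ[ZMod 2] Ch P)
    (h : ∀ l, Q l → Sup Q' (f (MilnorTC.bs l))) : Sup Q' (f c) := by
  have : f c = ∑ l ∈ c.support, c l • f (MilnorTC.bs l) := by
    conv_lhs => rw [← Finsupp.sum_single c, Finsupp.sum, map_sum]
    refine Finset.sum_congr rfl fun l _ => ?_
    rw [← map_smul]; simp
  rw [this]
  exact Sup.sum _ _ fun l hl => (h l (hc l hl)).smul _

theorem Sup.cone {Q Q' : List P → Prop} {c : Ch P} (a : P) (hc : Sup Q c) (h : ∀ l, Q l → Q' (a :: l)) :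
    Sup Q' (cone a c) :=
  hc.lin _ fun l hl => by rw [cone_bs]; exact Sup.bs (h l hl)

theorem Sup.mono {Q Q' : List P → Prop} {c : Ch P} (hc : Sup Q c) (h : ∀ l, Q l → Q' l) : Sup Q' c :=
  fun l hl => h l (hc l hl)

theorem bdL_sup (l : List P) : Sup (fun l' => l'.length + 1 = l.length ∧ ∀ p ∈ l', p ∈ l) (bdL l) := by
  induction l with
  | nil => exact Sup.zero _
  | cons a l ih =>
    refine Sup.add (Sup.bs ⟨rfl, fun p hp => List.mem_cons_of_mem _ hp⟩) (ih.cone a fun l' h => ⟨by simp [h.1], ?_⟩)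
    intro p hp
    rcases List.mem_cons.1 hp with rfl | hp
    · simp
    · exact List.mem_cons_of_mem _ (h.2 p hp)

theorem Sd_len (k : ℕ) (l : List P) (hl : l.length = k) : Sup (fun l' => l'.length = k) (Sd b k (bs l)) := by
  induction k generalizing l with
  | zero => exact Sup.bs hl
  | succ k ih =>
    rw [Sd_succ]
    refine Sup.cone (Q := fun l' => l'.length = k) _ ?_ fun l' h => by simp [h]
    exact (bdL_sup l).lin _ fun l' h => ih l' (by omega)

/-! evaluation and equivariance -/

theorem lin_zero_of_sup {Q : List P → Prop} {c : Ch P} (hc : Sup Q c) (f : Ch P →ₗ[ZMod 2] ZMod 2)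
    (h : ∀ l, Q l → f (bs l) = 0) : f c = 0 := by
  have : f c = ∑ l ∈ c.support, c l • f (MilnorTC.bs l) := by
    conv_lhs => rw [← Finsupp.sum_single c, Finsupp.sum, map_sum]
    refine Finset.sum_congr rfl fun l _ => ?_
    rw [← map_smul]; simp
  rw [this]
  exact Finset.sum_eq_zero fun l hl => by rw [h l (hc l hl), smul_zero]

variable {G : Type*} (act : G → P → P)

/-- induced map on chains -/
noncomputable def mapc (g : G) : Ch P →ₗ[ZMod 2] Ch P := lin fun l => bs (l.map (act g))

theorem mapc_bs (g : G) (l : List P) : mapc act g (bs l) = bs (l.map (act g)) := lin_bs _ _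

theorem mapc_cone (g : G) (a : P) (c : Ch P) : mapc act g (cone a c) = cone (act g a) (mapc act g c) := by
  have : mapc act g ∘ₗ cone a = cone (act g a) ∘ₗ mapc act g := by
    refine lhom_ext fun l => ?_
    simp only [LinearMap.comp_apply, cone_bs, mapc_bs, List.map_cons]
  exact LinearMap.congr_fun this c

theorem mapc_bdL (g : G) (l : List P) : mapc act g (bdL l) = bdL (l.map (act g)) := by
  induction l with
  | nil => simp [bdL]
  | cons a l ih => simp only [bdL, map_add, mapc_bs, mapc_cone, ih, List.map_cons]

theorem lin_eq_of_sup {A : Type*} [AddCommGroup A] [Module (ZMod 2) A] {Q : List P → Prop} {c : Ch P}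
    (hc : Sup Q c) (f f' : Ch P →ₗ[ZMod 2] A) (h : ∀ l, Q l → f (bs l) = f' (bs l)) : f c = f' c := by
  have key : ∀ f : Ch P →ₗ[ZMod 2] A, f c = ∑ l ∈ c.support, c l • f (MilnorTC.bs l) := by
    intro f
    conv_lhs => rw [← Finsupp.sum_single c, Finsupp.sum, map_sum]
    refine Finset.sum_congr rfl fun l _ => ?_
    rw [← map_smul]; simp
  rw [key f, key f']
  exact Finset.sum_congr rfl fun l hl => by rw [h l (hc l hl)]

theorem Sd_map (hb : ∀ g l, l ≠ [] → b (l.map (act g)) = act g (b l))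
    (k : ℕ) (g : G) (l : List P) (hl : l.length = k) :
    Sd b k (bs (l.map (act g))) = mapc act g (Sd b k (bs l)) := by
  induction k generalizing l with
  | zero => simp only [Sd, LinearMap.id_apply, mapc_bs]
  | succ k ih =>
    rw [Sd_succ, Sd_succ, mapc_cone, hb g l (by rintro rfl; simp at hl), ← mapc_bdL]
    congr 1
    refine lin_eq_of_sup (bdL_sup l) (Sd b k ∘ₗ mapc act g) (mapc act g ∘ₗ Sd b k) fun l' h => ?_
    simp only [LinearMap.comp_apply, mapc_bs]
    exact ih l' (by omega)

theorem Tc_map (hb : ∀ g l, l ≠ [] → b (l.map (act g)) = act g (b l))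
    (k : ℕ) (g : G) (l : List P) (hl : l.length = k) :
    Tc b k (bs (l.map (act g))) = mapc act g (Tc b k (bs l)) := by
  induction k generalizing l with
  | zero => simp only [Tc, LinearMap.zero_apply, map_zero]
  | succ k ih =>
    rw [Tc_succ, Tc_succ, mapc_cone, hb g l (by rintro rfl; simp at hl), ← mapc_bdL, map_add (mapc act g), mapc_bs]
    congr 2
    refine lin_eq_of_sup (bdL_sup l) (Tc b k ∘ₗ mapc act g) (mapc act g ∘ₗ Tc b k) fun l' h => ?_
    simp only [LinearMap.comp_apply, mapc_bs]
    exact ih l' (by omega)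

/-- A chain of lists of length `k` which is zero modulo the group action. -/
def NullLen (k : ℕ) (c : Ch P) : Prop :=
  ∀ Ψ : List P → ZMod 2, (∀ g l, l.length = k → Ψ (l.map (act g)) = Ψ l) → lin Ψ c = 0

theorem NullLen.Sd (hb : ∀ g l, l ≠ [] → b (l.map (act g)) = act g (b l))
    {k : ℕ} {c : Ch P} (h : NullLen act k c) : NullLen act k (Sd b k c) := by
  intro Ψ hΨ
  have := h (fun l => lin Ψ (MilnorTC.Sd b k (bs l))) (fun g l hl => by
    rw [Sd_map b act hb k g l hl]
    refine lin_eq_of_sup (Sd_len b k l hl) (lin Ψ ∘ₗ mapc act g) (lin Ψ) fun l' h' => ?_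
    rw [LinearMap.comp_apply, mapc_bs, lin_bs, lin_bs]
    exact hΨ g l' h')
  rw [← this]
  have e : lin Ψ ∘ₗ MilnorTC.Sd b k = lin (fun l => lin Ψ (MilnorTC.Sd b k (bs l))) :=
    lhom_ext fun l => by rw [LinearMap.comp_apply, lin_bs]
  exact LinearMap.congr_fun e c

theorem NullLen.Tc (hb : ∀ g l, l ≠ [] → b (l.map (act g)) = act g (b l))
    {k : ℕ} {c : Ch P} (h : NullLen act k c) (Ψ : List P → ZMod 2)
    (hΨ : ∀ g l, Ψ (l.map (act g)) = Ψ l) : lin Ψ (Tc b k c) = 0 := by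
  have := h (fun l => lin Ψ (MilnorTC.Tc b k (bs l))) (fun g l hl => by
    rw [Tc_map b act hb k g l hl]
    have e : lin Ψ ∘ₗ mapc act g = lin Ψ := lhom_ext fun l => by
      rw [LinearMap.comp_apply, mapc_bs, lin_bs, lin_bs]
      exact hΨ g l
    exact LinearMap.congr_fun e _)
  rw [← this]
  have e : lin Ψ ∘ₗ MilnorTC.Tc b k = lin (fun l => lin Ψ (MilnorTC.Tc b k (bs l))) :=
    lhom_ext fun l => by rw [LinearMap.comp_apply, lin_bs]
  exact LinearMap.congr_fun e c

/-- Evaluation of an invariant cocycle on a relative cycle is unchanged by subdivision. -/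
theorem eval_iterate (hb : ∀ g l, l ≠ [] → b (l.map (act g)) = act g (b l))
    {D : ℕ} {z : Ch P} (hz : NullLen act D (bd z)) (Ψ : List P → ZMod 2)
    (hΨ : ∀ g l, Ψ (l.map (act g)) = Ψ l) (hcoc : ∀ l, lin Ψ (bdL l) = 0) (N : ℕ) :
    NullLen act D (bd ((Sd b (D + 1))^[N] z)) ∧ lin Ψ ((Sd b (D + 1))^[N] z) = lin Ψ z := by
  induction N with
  | zero => exact ⟨hz, rfl⟩
  | succ N ih =>
    rw [Function.iterate_succ_apply']
    set w := (Sd b (D + 1))^[N] z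
    refine ⟨?_, ?_⟩
    · rw [bd_Sd]; exact ih.1.Sd b act hb
    · have hcoc' : ∀ c, lin Ψ (bd c) = 0 := by
        intro c
        have e : lin Ψ ∘ₗ bd = (0 : Ch P →ₗ[ZMod 2] ZMod 2) := lhom_ext fun l => by
          rw [LinearMap.comp_apply, bd_bs]; exact hcoc l
        exact LinearMap.congr_fun e c
      have h1 := congrArg (lin Ψ) (bd_Tc b D w)
      rw [map_add, map_add, hcoc', ih.1.Tc b act hb Ψ hΨ, add_zero] at h1
      rw [← ih.2]
      exact (CharTwo.add_eq_zero.1 h1.symm).symm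

end chains

section cocycle
variable {P : Type*}

/-- Cup product of coboundaries. -/
def Phi : List (P → ZMod 2) → List P → ZMod 2
  | [], [_] => 1
  | e :: es, v :: w :: l => (e v + e w) * Phi es (w :: l)
  | _, _ => 0

theorem phi_nil (es : List (P → ZMod 2)) : Phi es [] = 0 := by
  cases es <;> rfl

theorem phi_cons_one (e : P → ZMod 2) (es : List (P → ZMod 2)) (v : P) : Phi (e :: es) [v] = 0 := rfl

theorem phi_nil_two (v w : P) (l : List P) : Phi [] (v :: w :: l) = 0 := rfl

theorem phi_cons (e : P → ZMod 2) (es : List (P → ZMod 2)) (v w : P) (l : List P) :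
    Phi (e :: es) (v :: w :: l) = (e v + e w) * Phi es (w :: l) := rfl

theorem phi_cone2 (e : P → ZMod 2) (es : List (P → ZMod 2)) (v w : P) (c : Ch P) :
    lin (Phi (e :: es)) (cone v (cone w c)) = (e v + e w) * lin (Phi es) (cone w c) := by
  have : lin (Phi (e :: es)) ∘ₗ cone v ∘ₗ cone w = (e v + e w) • (lin (Phi es) ∘ₗ cone w) := by
    refine lhom_ext fun l => ?_
    simp only [LinearMap.comp_apply, LinearMap.smul_apply, cone_bs, lin_bs, phi_cons, smul_eq_mul]
  exact LinearMap.congr_fun this c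

theorem phi_nil_cone2 (v w : P) (c : Ch P) : lin (Phi []) (cone v (cone w c)) = 0 := by
  have : lin (Phi []) ∘ₗ cone v ∘ₗ cone w = 0 := by
    refine lhom_ext fun l => ?_
    simp only [LinearMap.comp_apply, LinearMap.zero_apply, cone_bs, lin_bs, phi_nil_two]
  exact LinearMap.congr_fun this c

theorem phi_bdL (es : List (P → ZMod 2)) (l : List P) : lin (Phi es) (bdL l) = 0 := by
  induction es generalizing l with
  | nil =>
    match l with
    | [] => simp [bdL]
    | [v] => simp [bdL, phi_nil]
    | v :: w :: l =>
      simp only [bdL, map_add, cone_bs, lin_bs, phi_nil_cone2]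
      cases l with
      | nil => simp only [Phi]; decide
      | cons x l => simp [phi_nil_two]
  | cons e es ih =>
    match l with
    | [] => simp [bdL]
    | [v] => simp [bdL, phi_nil]
    | v :: w :: l =>
      have h := ih (w :: l)
      simp only [bdL, map_add, lin_bs] at h
      simp only [bdL, map_add, cone_bs, lin_bs, phi_cone2]
      have h' : lin (Phi es) (cone w (bdL l)) = Phi es l := (CharTwo.add_eq_zero.1 h).symm
      rw [h']
      cases l with
      | nil => simp [phi_cons_one, phi_nil]
      | cons x l =>
        simp only [phi_cons]
        have h2 : (2 : ZMod 2) = 0 := rfl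
        linear_combination (e v + e w + e x) * Phi es (x :: l) * h2

theorem phi_map {G : Type*} (act : G → P → P) (es : List (P → ZMod 2))
    (h : ∀ e ∈ es, ∀ g v w, e (act g v) + e (act g w) = e v + e w) (g : G) (l : List P) :
    Phi es (l.map (act g)) = Phi es l := by
  induction es generalizing l with
  | nil =>
    match l with
    | [] => rfl
    | [v] => rfl
    | v :: w :: l => rfl
  | cons e es ih =>
    match l with
    | [] => rfl
    | [v] => rfl
    | v :: w :: l =>
      simp only [List.map_cons, phi_cons]
      rw [h e (by simp), ← List.map_cons, ih (fun e he => h e (by simp [he]))]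

theorem phi_ofFn {D : ℕ} (e : Fin D → P → ZMod 2) (v : Fin (D + 1) → P) :
    Phi (List.ofFn e) (List.ofFn v) = ∏ t, (e t (v t.castSucc) + e t (v t.succ)) := by
  induction D with
  | zero => simp [Phi]
  | succ D ih =>
    rw [List.ofFn_succ, List.ofFn_succ, List.ofFn_succ, phi_cons, Fin.prod_univ_succ]
    have := ih (fun t => e t.succ) (fun t => v t.succ)
    rw [List.ofFn_succ] at this
    rw [this]
    rfl

theorem phi_zero_of_const (es : List (P → ZMod 2)) (l : List P) (e : P → ZMod 2) (he : e ∈ es)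
    (h : ∀ v ∈ l, ∀ w ∈ l, e v = e w) : Phi es l = 0 := by
  induction es generalizing l with
  | nil => simp at he
  | cons e' es ih =>
    match l with
    | [] => rfl
    | [v] => rfl
    | v :: w :: l =>
      rw [phi_cons]
      rcases List.mem_cons.1 he with rfl | he
      · rw [h v (by simp) w (by simp), CharTwo.add_self_eq_zero, zero_mul]
      · rw [ih (w :: l) he fun a ha b hb => h a (List.mem_cons_of_mem _ ha) b (List.mem_cons_of_mem _ hb),
          mul_zero]

end cocycle
end MilnorTC

namespace MilnorTC

section mesh
variable {E T : Type*} [NormedAddCommGroup E] [NormedSpace ℝ E]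

/-- positions of points of a list -/
def ppos (p : (E × T) × Bool) : E := p.1.1

/-- average of a list -/
noncomputable def lavg (l : List E) : E := (l.length : ℝ)⁻¹ • l.sum

theorem lavg_mem (l : List E) (hl : l ≠ []) (C : Set E) (hC : Convex ℝ C) (h : ∀ v ∈ l, v ∈ C) :
    lavg l ∈ C := by
  have h0 : (0 : ℝ) < l.length := by exact_mod_cast List.length_pos_of_ne_nil hl
  have : lavg l = ∑ i : Fin l.length, (l.length : ℝ)⁻¹ • l[i] := by
    rw [lavg, ← Finset.smul_sum]
    congr 1
    exact (Fin.sum_univ_getElem l).symm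
  rw [this]
  refine hC.sum_mem (fun _ _ => by positivity) ?_ fun i _ => h _ (List.getElem_mem _)
  simp
  field_simp

theorem norm_sum_le (l : List E) (δ : ℝ) (v : E) (h : ∀ w ∈ l, dist w v ≤ δ) :
    ‖l.sum - (l.length : ℝ) • v‖ ≤ l.length * δ := by
  induction l with
  | nil => simp
  | cons a l ih =>
    have h1 := ih fun w hw => h w (List.mem_cons_of_mem _ hw)
    have h2 := h a (by simp)
    rw [dist_eq_norm] at h2
    have e : (a :: l).sum - ((a :: l).length : ℝ) • v = (a - v) + (l.sum - (l.length : ℝ) • v) := by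
      simp only [List.sum_cons, List.length_cons, Nat.cast_add, Nat.cast_one, add_smul, one_smul]
      abel
    rw [e]
    refine (norm_add_le _ _).trans ?_
    simp only [List.length_cons, Nat.cast_add, Nat.cast_one]
    linarith

theorem lavg_dist (l : List E) (δ : ℝ) (hl : l ≠ []) (h : ∀ v ∈ l, ∀ w ∈ l, dist v w ≤ δ) (v : E) (hv : v ∈ l) :
    dist v (lavg l) ≤ (1 - (l.length : ℝ)⁻¹) * δ := by
  obtain ⟨s, t, rfl⟩ := List.append_of_mem hv
  set k : ℝ := ((s ++ v :: t).length : ℝ) with hk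
  have h0 : (0 : ℝ) < k := by rw [hk]; exact_mod_cast List.length_pos_of_ne_nil hl
  have h1 := norm_sum_le (s ++ t) δ v fun w hw => h w (by
    rcases List.mem_append.1 hw with h | h <;> simp [h]) v hv
  have e : (s ++ v :: t).sum - k • v = (s ++ t).sum - ((s ++ t).length : ℝ) • v := by
    rw [hk]
    simp only [List.sum_append, List.sum_cons, List.length_append, List.length_cons, Nat.cast_add, Nat.cast_one,
      add_smul, one_smul]
    abel
  have e2 : (((s ++ t).length : ℕ) : ℝ) = k - 1 := by
    rw [hk]
    simp only [List.length_append, List.length_cons, Nat.cast_add, Nat.cast_one]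
    ring
  rw [← e, e2] at h1
  have e3 : lavg (s ++ v :: t) - v = k⁻¹ • ((s ++ v :: t).sum - k • v) := by
    rw [lavg, smul_sub, smul_smul, inv_mul_cancel₀ h0.ne', one_smul]
  rw [dist_comm, dist_eq_norm, e3, norm_smul, Real.norm_of_nonneg (by positivity)]
  calc k⁻¹ * _ ≤ k⁻¹ * ((k - 1) * δ) := by gcongr
    _ = _ := by field_simp

/-- barycentre -/
noncomputable def bary [Inhabited T] (l : List ((E × T) × Bool)) : (E × T) × Bool :=
  ((lavg (l.map ppos), (l.map fun p => p.1.2).headD default), true)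

theorem Sd_mesh [Inhabited T] (m : ℕ) (k : ℕ) (hk : k ≤ m) (hm : 1 ≤ m) (l : List ((E × T) × Bool))
    (hl : l.length = k) :
    Sup (fun l' => l'.length = k ∧ (∀ p ∈ l', p.2 = true) ∧
      (∀ C : Set E, Convex ℝ C → (∀ p ∈ l, ppos p ∈ C) → ∀ p ∈ l', ppos p ∈ C) ∧
      (∀ δ : ℝ, 0 ≤ δ → (∀ p ∈ l, ∀ q ∈ l, dist (ppos p) (ppos q) ≤ δ) →
        ∀ p ∈ l', ∀ q ∈ l', dist (ppos p) (ppos q) ≤ (1 - (m : ℝ)⁻¹) * δ)) (Sd bary k (bs l)) := by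
  induction k generalizing l with
  | zero =>
    obtain rfl := List.length_eq_zero_iff.1 hl
    refine Sup.bs ?_
    simp
  | succ k ih =>
    have hl0 : l ≠ [] := by rintro rfl; simp at hl
    have hl1 : l.map ppos ≠ [] := by simpa using hl0
    rw [Sd_succ]
    refine Sup.cone (Q := fun l' => l'.length = k ∧ (∀ p ∈ l', p.2 = true) ∧
      (∀ C : Set E, Convex ℝ C → (∀ p ∈ l, ppos p ∈ C) → ∀ p ∈ l', ppos p ∈ C) ∧
      (∀ δ : ℝ, 0 ≤ δ → (∀ p ∈ l, ∀ q ∈ l, dist (ppos p) (ppos q) ≤ δ) →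
        ∀ p ∈ l', ∀ q ∈ l', dist (ppos p) (ppos q) ≤ (1 - (m : ℝ)⁻¹) * δ)) _ ?_ ?_
    · refine (bdL_sup l).lin _ fun l' h => (ih (by omega) l' (by omega)).mono ?_
      rintro l'' ⟨h1, h2, h3, h4⟩
      exact ⟨h1, h2, fun C hC hh => h3 C hC fun p hp => hh p (h.2 p hp),
        fun δ hδ hh => h4 δ hδ fun p hp q hq => hh p (h.2 p hp) q (h.2 q hq)⟩
    · rintro l' ⟨h1, h2, h3, h4⟩
      refine ⟨by simp [h1], ?_, ?_, ?_⟩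
      · intro p hp
        rcases List.mem_cons.1 hp with rfl | hp
        · rfl
        · exact h2 p hp
      · intro C hC hh p hp
        rcases List.mem_cons.1 hp with rfl | hp
        · refine lavg_mem _ hl1 C hC fun v hv => ?_
          obtain ⟨p, hp, rfl⟩ := List.mem_map.1 hv
          exact hh p hp
        · exact h3 C hC hh p hp
      · intro δ hδ hh
        have hm' : (m : ℝ)⁻¹ ≤ 1 := inv_le_one_of_one_le₀ (by exact_mod_cast hm)
        have hnn : 0 ≤ (1 - (m : ℝ)⁻¹) * δ := mul_nonneg (by linarith) hδ
        have key : ∀ p ∈ l', dist (ppos p) (ppos (bary l)) ≤ (1 - (m : ℝ)⁻¹) * δ := by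
          refine h3 (Metric.closedBall (ppos (bary l)) ((1 - (m : ℝ)⁻¹) * δ)) (convex_closedBall _ _) ?_
          intro p hp
          rw [Metric.mem_closedBall]
          refine (lavg_dist (l.map ppos) δ hl1 ?_ (ppos p) (List.mem_map_of_mem hp)).trans ?_
          · intro v hv w hw
            obtain ⟨p, hp, rfl⟩ := List.mem_map.1 hv
            obtain ⟨q, hq, rfl⟩ := List.mem_map.1 hw
            exact hh p hp q hq
          · have : (m : ℝ)⁻¹ ≤ ((l.map ppos).length : ℝ)⁻¹ := by
              rw [List.length_map, hl]
              apply inv_anti₀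
              · positivity
              · exact_mod_cast hk
            gcongr
        intro p hp q hq
        rcases List.mem_cons.1 hp with rfl | hp <;> rcases List.mem_cons.1 hq with rfl | hq
        · simpa using hnn
        · rw [dist_comm]; exact key q hq
        · exact key p hp
        · exact h4 δ hδ hh p hp q hq

/-- `good` simplices -/
def Good (K : Set E) (m : ℕ) (δ : ℝ) (l : List ((E × T) × Bool)) : Prop :=
  l.length = m ∧ (∃ C : Set E, Convex ℝ C ∧ C ⊆ K ∧ ∀ p ∈ l, ppos p ∈ C) ∧
    ∀ p ∈ l, ∀ q ∈ l, dist (ppos p) (ppos q) ≤ δ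

theorem Sd_iter [Inhabited T] (K : Set E) (m : ℕ) (hm : 1 ≤ m) (δ : ℝ) (hδ : 0 ≤ δ)
    (z : Ch ((E × T) × Bool)) (hz : Sup (Good K m δ) z) (N : ℕ) :
    Sup (fun l => Good K m ((1 - (m : ℝ)⁻¹) ^ (N + 1) * δ) l ∧ ∀ p ∈ l, p.2 = true)
      ((Sd bary m)^[N + 1] z) := by
  have hm' : (m : ℝ)⁻¹ ≤ 1 := inv_le_one_of_one_le₀ (by exact_mod_cast hm)
  have step : ∀ (δ : ℝ), 0 ≤ δ → ∀ w : Ch ((E × T) × Bool), Sup (Good K m δ) w →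
      Sup (fun l => Good K m ((1 - (m : ℝ)⁻¹) * δ) l ∧ ∀ p ∈ l, p.2 = true) (Sd bary m w) := by
    intro δ hδ w hw
    refine hw.lin _ ?_
    rintro l ⟨h1, ⟨C, hC, hCK, hlC⟩, h3⟩
    refine (Sd_mesh m m le_rfl hm l h1).mono ?_
    rintro l' ⟨g1, g2, g3, g4⟩
    exact ⟨⟨g1, ⟨C, hC, hCK, g3 C hC hlC⟩, g4 δ hδ h3⟩, g2⟩
  induction N with
  | zero => simpa using step δ hδ z hz
  | succ N ih =>
    rw [Function.iterate_succ_apply', pow_succ', mul_assoc]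
    exact step _ (mul_nonneg (pow_nonneg (by linarith) _) hδ) _ (ih.mono fun l h => h.1)

end mesh

section bu

/-- sign of an element of `ZMod 2` -/
def sg (a : ZMod 2) : ℝ := if a = 0 then 1 else -1

theorem sg_add (a b : ZMod 2) : sg (a + b) = sg a * sg b := by
  have : ∀ a b : ZMod 2, (a = 0 ∧ b = 0 ∧ a + b = 0) ∨ (a = 0 ∧ b ≠ 0 ∧ a + b ≠ 0) ∨
    (a ≠ 0 ∧ b = 0 ∧ a + b ≠ 0) ∨ (a ≠ 0 ∧ b ≠ 0 ∧ a + b = 0) := by decide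
  rcases this a b with ⟨h1, h2, h3⟩ | ⟨h1, h2, h3⟩ | ⟨h1, h2, h3⟩ | ⟨h1, h2, h3⟩ <;>
    simp only [sg, h1, h2, h3, ↓reduceIte] <;> norm_num <;> assumption

variable {E T : Type*} [NormedAddCommGroup E] [NormedSpace ℝ E] [AddCommGroup T]

/-- action of `T` -/
def tact (ρ : T → E →ₗ[ℝ] E) (g : T) (p : (E × T) × Bool) : (E × T) × Bool :=
  ((ρ g p.1.1, p.1.2 + g), p.2)

instance tagInh : Inhabited T := ⟨0⟩

theorem bary_equiv (ρ : T → E →ₗ[ℝ] E) (g : T) (l : List ((E × T) × Bool)) (hl : l ≠ []) :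
    bary (l.map (tact ρ g)) = tact ρ g (bary l) := by
  have h1 : lavg ((l.map (tact ρ g)).map ppos) = ρ g (lavg (l.map ppos)) := by
    simp only [lavg, map_smul, List.length_map, map_list_sum, List.map_map]
    rfl
  obtain ⟨a, l, rfl⟩ := List.exists_cons_of_ne_nil hl
  rw [bary, h1]
  rfl

/-- one cochain -/
noncomputable def ecoch (χ : T →+ ZMod 2) (f : E → ℝ) (p : (E × T) × Bool) : ZMod 2 :=
  if p.2 = true then (if 0 < f p.1.1 then 0 else if f p.1.1 < 0 then 1 else χ p.1.2) else χ p.1.2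

theorem ecoch_act (ρ : T → E →ₗ[ℝ] E) (χ : T →+ ZMod 2) (f : E → ℝ)
    (hf : ∀ g v, f (ρ g v) = sg (χ g) * f v) (g : T) (p : (E × T) × Bool) :
    ecoch χ f (tact ρ g p) = ecoch χ f p + χ g := by
  have h01 : ∀ a : ZMod 2, a = 0 ∨ a = 1 := by decide
  simp only [ecoch, tact, hf, map_add, sg]
  rcases h01 (χ g) with h | h <;> rw [h] <;> split_ifs <;> simp_all <;> first | linarith | decide

/-- Borsuk-Ulam type theorem, chain version. -/
theorem bu_core (ρ : T → E →ₗ[ℝ] E) (K : Set E) (hK : IsCompact K) (D : ℕ) {ι : Type*} (S : Finset ι)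
    (v : ι → Fin (D + 1) → E × T)
    (hz : NullLen (tact ρ) D (bd (∑ i ∈ S, bs (List.ofFn fun t => (v i t, false)))))
    (hv : ∀ i ∈ S, ∃ C : Set E, Convex ℝ C ∧ C ⊆ K ∧ ∀ t, (v i t).1 ∈ C)
    (χ : Fin D → T →+ ZMod 2) (f : Fin D → E → ℝ) (hfc : ∀ t, ContinuousOn (f t) K)
    (hf : ∀ t g v, f t (ρ g v) = sg (χ t g) * f t v)
    (hne : ∑ i ∈ S, ∏ t : Fin D, (χ t (v i t.castSucc).2 + χ t (v i t.succ).2) ≠ 0) :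
    ∃ x ∈ K, ∀ t, f t x = 0 := by
  by_contra hcon
  push Not at hcon
  set z : Ch ((E × T) × Bool) := ∑ i ∈ S, bs (List.ofFn fun t => (v i t, false)) with hzdef
  set es : List ((E × T) × Bool → ZMod 2) := List.ofFn fun t => ecoch (χ t) (f t) with hes
  have hval : lin (Phi es) z = ∑ i ∈ S, ∏ t : Fin D, (χ t (v i t.castSucc).2 + χ t (v i t.succ).2) := by
    rw [hzdef, map_sum]
    refine Finset.sum_congr rfl fun i _ => ?_
    rw [lin_bs, hes, phi_ofFn]
    rfl
  have hinv := (eval_iterate (b := bary) (tact ρ) (bary_equiv ρ) hz (Phi es) (fun g l => phi_map (tact ρ) es (by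
    intro e he g v w
    obtain ⟨t, rfl⟩ := List.mem_ofFn.1 he
    simp only [ecoch_act ρ (χ t) (f t) (hf t)]
    have h2 : (2 : ZMod 2) = 0 := rfl
    linear_combination (χ t g) * h2) g l) (phi_bdL es))
  -- Lebesgue number
  have hKc : IsCompact (Set.univ : Set K) := isCompact_iff_isCompact_univ.1 hK
  have hfc' : ∀ t, Continuous fun x : K => f t x := fun t => continuousOn_iff_continuous_domRestrict.1 (hfc t)
  obtain ⟨δ, hδ, hL⟩ := lebesgue_number_lemma_of_metric (c := fun i : Fin D × Bool =>
    {x : K | if i.2 = true then 0 < f i.1 x else f i.1 x < 0}) hKc (by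
      rintro ⟨t, β⟩
      cases β
      · simpa using isOpen_lt (hfc' t) continuous_const
      · simpa using isOpen_lt continuous_const (hfc' t)) (by
      rintro ⟨x, hx⟩ _
      obtain ⟨t, ht⟩ := hcon x hx
      rcases lt_or_gt_of_ne ht with h | h
      · exact Set.mem_iUnion.2 ⟨(t, false), by simpa using h⟩
      · exact Set.mem_iUnion.2 ⟨(t, true), by simpa using h⟩)
  -- initial mesh
  have hbd := hK.isBounded
  obtain ⟨δ₀, hδ₀⟩ := Metric.isBounded_iff.1 hbd
  have hgood : Sup (Good K (D + 1) (max δ₀ 0)) z := by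
    refine Sup.sum _ _ fun i hi => Sup.bs ⟨by simp, ?_, ?_⟩
    · obtain ⟨C, hC, hCK, h⟩ := hv i hi
      refine ⟨C, hC, hCK, fun p hp => ?_⟩
      obtain ⟨t, rfl⟩ := List.mem_ofFn.1 hp
      exact h t
    · obtain ⟨C, hC, hCK, h⟩ := hv i hi
      intro p hp q hq
      obtain ⟨t, rfl⟩ := List.mem_ofFn.1 hp
      obtain ⟨t', rfl⟩ := List.mem_ofFn.1 hq
      exact (hδ₀ (hCK (h t)) (hCK (h t'))).trans (le_max_left _ _)
  obtain ⟨N, hN⟩ : ∃ N : ℕ, (1 - ((D + 1 : ℕ) : ℝ)⁻¹) ^ (N + 1) * max δ₀ 0 < δ := by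
    have h1 : (0 : ℝ) ≤ 1 - ((D + 1 : ℕ) : ℝ)⁻¹ := by
      have := inv_le_one_of_one_le₀ (a := ((D + 1 : ℕ) : ℝ)) (by exact_mod_cast Nat.succ_pos D)
      linarith
    have h2 : 1 - ((D + 1 : ℕ) : ℝ)⁻¹ < 1 := by
      have : (0 : ℝ) < ((D + 1 : ℕ) : ℝ)⁻¹ := by positivity
      linarith
    have := ((tendsto_pow_atTop_nhds_zero_of_lt_one h1 h2).comp (Filter.tendsto_add_atTop_nat 1)).mul_const (max δ₀ 0)
    rw [zero_mul] at this
    exact (this.eventually (gt_mem_nhds hδ)).exists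
  have hsup := Sd_iter K (D + 1) (by omega) (max δ₀ 0) (le_max_right _ _) z hgood N
  apply hne
  rw [← hval, ← (hinv (N + 1)).2]
  refine lin_zero_of_sup hsup _ ?_
  rintro l ⟨⟨h1, ⟨C, hC, hCK, h2⟩, h3⟩, h4⟩
  rw [lin_bs]
  obtain ⟨a, l', rfl⟩ : ∃ a l', l = a :: l' := List.exists_cons_of_ne_nil (by rintro rfl; simp at h1)
  obtain ⟨⟨t, β⟩, hb⟩ := hL ⟨ppos a, hCK (h2 a (by simp))⟩ (Set.mem_univ _)
  refine phi_zero_of_const es _ (ecoch (χ t) (f t)) (List.mem_ofFn.2 ⟨t, rfl⟩) ?_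
  have key : ∀ p ∈ a :: l', ecoch (χ t) (f t) p = if β = true then 0 else 1 := by
    intro p hp
    have := @hb ⟨ppos p, hCK (h2 p hp)⟩ (by
      rw [Metric.mem_ball]
      exact (h3 p hp a (by simp)).trans_lt hN)
    rw [ecoch, if_pos (h4 p hp)]
    cases β
    · have h : f t p.1.1 < 0 := by simpa [ppos] using this
      rw [if_neg (by linarith), if_pos h]; rfl
    · have h : 0 < f t p.1.1 := by simpa [ppos] using this
      rw [if_pos h]; rfl
  intro p hp q hq
  rw [key p hp, key q hq]

end bu
end MilnorTC

namespace MilnorTC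

theorem bdL_ofFn {P : Type*} {D : ℕ} (v : Fin (D + 1) → P) :
    bdL (List.ofFn v) = ∑ t : Fin (D + 1), bs (List.ofFn fun j : Fin D => v (t.succAbove j)) := by
  induction D with
  | zero => simp [bdL]
  | succ D ih =>
    rw [List.ofFn_succ, bdL, Fin.sum_univ_succ, ih, map_sum]
    congr 1
    refine Finset.sum_congr rfl fun t _ => ?_
    rw [cone_bs, List.ofFn_succ]
    simp only [Fin.succ_succAbove_zero, Fin.succ_succAbove_succ]

section cyc
set_option linter.unusedSectionVars false
variable {κ : Type*} [Fintype κ] [DecidableEq κ] {D : ℕ}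

/-- weighted count of letters `k` before time `u` -/
def Wt {A : Type*} [AddCommMonoid A] (h : Fin D → A) (c : Fin D → κ) (u : ℕ) (k : κ) : A :=
  ∑ j : Fin D, if (j : ℕ) < u ∧ c j = k then h j else 0

theorem Wt_perm {A : Type*} [AddCommMonoid A] (h : Fin D → A) (c : Fin D → κ) (u : ℕ) (k : κ)
    (e : Equiv.Perm (Fin D)) (he : ∀ j, ((e j : Fin D) : ℕ) < u ↔ (j : ℕ) < u) :
    Wt (h ∘ e) (c ∘ e) u k = Wt h c u k := by
  unfold Wt
  rw [← Equiv.sum_comp e (fun j : Fin D => if (j : ℕ) < u ∧ c j = k then h j else 0)]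
  refine Finset.sum_congr rfl fun j _ => ?_
  simp only [he, Function.comp]

theorem Wt_add {A : Type*} [AddCommMonoid A] (h h' : Fin D → A) (c : Fin D → κ) (u : ℕ) (k : κ) :
    Wt (h + h') c u k = Wt h c u k + Wt h' c u k := by
  unfold Wt
  rw [← Finset.sum_add_distrib]
  refine Finset.sum_congr rfl fun j _ => ?_
  split_ifs <;> simp

theorem Wt_single {A : Type*} [AddCommMonoid A] (a : Fin D) (x : A) (c : Fin D → κ) (u : ℕ) (k : κ) :
    Wt (Pi.single a x) c u k = if (a : ℕ) < u ∧ c a = k then x else 0 := by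
  unfold Wt
  rw [Finset.sum_eq_single a]
  · simp
  · intro j _ hj
    simp [Pi.single_eq_of_ne hj]
  · simp

theorem Wt_succ {A : Type*} [AddCommMonoid A] (h : Fin D → A) (c : Fin D → κ) (t : Fin D) (k : κ) :
    Wt h c (t + 1) k = Wt h c t k + if c t = k then h t else 0 := by
  unfold Wt
  have : (if c t = k then h t else 0) = ∑ j : Fin D, if j = t then (if c j = k then h j else 0) else 0 := by
    simp
  rw [this, ← Finset.sum_add_distrib]
  refine Finset.sum_congr rfl fun j _ => ?_
  by_cases hjt : j = t
  · subst hjt; simp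
  · have : (j : ℕ) ≠ t := fun h => hjt (Fin.ext h)
    have h2 : (j : ℕ) < t + 1 ↔ (j : ℕ) < t := by omega
    simp [h2, hjt]

/-- linear action of the sign group -/
def rho (R : ℕ) (g : κ → ZMod 2) : (κ → Fin R → ℝ) →ₗ[ℝ] (κ → Fin R → ℝ) where
  toFun v := fun k i => sg (g k) * v k i
  map_add' v w := by ext k i; simp [mul_add]
  map_smul' a v := by ext k i; simp; ring

/-- vertex -/
noncomputable def vert (R : ℕ) (m : κ → ℕ) (τ : κ → ZMod 2) : (κ → Fin R → ℝ) × (κ → ZMod 2) :=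
  (fun k i => if (i : ℕ) = m k then sg (τ k) else 0, τ)

theorem vert_act (R : ℕ) (m : κ → ℕ) (τ g : κ → ZMod 2) (β : Bool) :
    tact (rho R) g (vert R m τ, β) = (vert R m (τ + g), β) := by
  have : rho R g (vert R m τ).1 = (vert R m (τ + g)).1 := by
    ext k i
    change sg (g k) * (if (i : ℕ) = m k then sg (τ k) else 0) = if (i : ℕ) = m k then sg (τ k + g k) else 0
    rw [sg_add]
    split_ifs
    · ring
    · ring
  unfold tact
  rw [this]
  rfl

/-- vertices of the simplex with word `c` and bits `η`. -/
noncomputable def vtx (R : ℕ) (p : (Fin D → κ) × (Fin D → ZMod 2)) (u : ℕ) : (κ → Fin R → ℝ) × (κ → ZMod 2) :=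
  vert R (Wt (fun _ => 1) p.1 u) (Wt p.2 p.1 u)

/-- words with prescribed letter counts -/
def words (D : ℕ) (d : κ → ℕ) : Finset (Fin D → κ) :=
  Finset.univ.filter fun c => ∀ k, Wt (fun _ => 1) c D k = d k

/-- the involution exchanging two times -/
def inv2 (a b : Fin D) (p : (Fin D → κ) × (Fin D → ZMod 2)) : (Fin D → κ) × (Fin D → ZMod 2) :=
  if p.1 a = p.1 b then (p.1, p.2 + (Pi.single a 1 + Pi.single b 1)) else (p.1 ∘ Equiv.swap a b, p.2 ∘ Equiv.swap a b)

theorem fun_add_self (h : Fin D → ZMod 2) : h + h = 0 := by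
  ext j; exact CharTwo.add_self_eq_zero _

theorem inv2_inv (a b : Fin D) (p : (Fin D → κ) × (Fin D → ZMod 2)) : inv2 a b (inv2 a b p) = p := by
  obtain ⟨c, η⟩ := p
  by_cases h : c a = c b
  · simp only [inv2, h, if_true]
    rw [add_assoc, fun_add_self, add_zero]
  · have h' : c b ≠ c a := fun e => h e.symm
    simp only [inv2, h, if_false, Function.comp, Equiv.swap_apply_left, Equiv.swap_apply_right, h']
    ext j <;> simp

theorem inv2_ne (a b : Fin D) (hab : a ≠ b) (p : (Fin D → κ) × (Fin D → ZMod 2)) : inv2 a b p ≠ p := by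
  obtain ⟨c, η⟩ := p
  intro e
  by_cases h : c a = c b
  · simp only [inv2, h, if_true] at e
    have := congrFun (congrArg Prod.snd e) a
    simp [hab] at this
  · simp only [inv2, h, if_false] at e
    have := congrFun (congrArg Prod.fst e) a
    simp at this
    exact h this.symm

theorem swap_lt (a b : Fin D) (u : ℕ) (h : (a : ℕ) < u ↔ (b : ℕ) < u) (j : Fin D) :
    ((Equiv.swap a b j : Fin D) : ℕ) < u ↔ (j : ℕ) < u := by
  rcases Equiv.swap_apply_eq_iff.1 (rfl : Equiv.swap a b j = _) with _
  by_cases h1 : j = a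
  · subst h1; rw [Equiv.swap_apply_left]; exact h.symm
  · by_cases h2 : j = b
    · subst h2; rw [Equiv.swap_apply_right]; exact h
    · rw [Equiv.swap_apply_of_ne_of_ne h1 h2]

theorem inv2_vtx (R : ℕ) (a b : Fin D) (u : ℕ) (h : (a : ℕ) < u ↔ (b : ℕ) < u)
    (p : (Fin D → κ) × (Fin D → ZMod 2)) : vtx R (inv2 a b p) u = vtx R p u := by
  obtain ⟨c, η⟩ := p
  unfold inv2
  split_ifs with hc
  · simp only [vtx]
    congr 1
    ext k
    rw [Wt_add, Wt_add, Wt_single, Wt_single]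
    simp only at hc
    simp only [h, hc, CharTwo.add_self_eq_zero, add_zero]
  · simp only [vtx]
    congr 1
    · ext k
      exact Wt_perm (fun _ => 1) c u k _ (swap_lt a b u h)
    · ext k
      exact Wt_perm η c u k _ (swap_lt a b u h)

theorem inv2_words (d : κ → ℕ) (a b : Fin D) (p : (Fin D → κ) × (Fin D → ZMod 2)) (h : p.1 ∈ words D d) :
    (inv2 a b p).1 ∈ words D d := by
  obtain ⟨c, η⟩ := p
  unfold inv2
  split_ifs with hc
  · exact h
  · simp only [words, Finset.mem_filter, Finset.mem_univ, true_and] at h ⊢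
    intro k
    rw [← h k]
    exact Wt_perm (fun _ => 1) c D k _ (swap_lt a b D (by simp))

/-- flipping one bit -/
def flip1 (a : Fin D) (p : (Fin D → κ) × (Fin D → ZMod 2)) : (Fin D → κ) × (Fin D → ZMod 2) :=
  (p.1, p.2 + Pi.single a 1)

theorem flip1_inv (a : Fin D) (p : (Fin D → κ) × (Fin D → ZMod 2)) : flip1 a (flip1 a p) = p := by
  obtain ⟨c, η⟩ := p
  simp only [flip1]
  rw [add_assoc, fun_add_self, add_zero]

theorem flip1_ne (a : Fin D) (p : (Fin D → κ) × (Fin D → ZMod 2)) : flip1 a p ≠ p := by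
  intro e
  have := congrFun (congrArg Prod.snd e) a
  simp [flip1] at this

theorem flip1_vtx (R : ℕ) (a : Fin D) (u : ℕ) (h : u ≤ a) (p : (Fin D → κ) × (Fin D → ZMod 2)) :
    vtx R (flip1 a p) u = vtx R p u := by
  simp only [vtx, flip1]
  congr 1
  ext k
  rw [Wt_add, Wt_single, if_neg (by omega), add_zero]

theorem flip1_vtx' (R : ℕ) (a : Fin D) (u : ℕ) (h : (a : ℕ) < u) (p : (Fin D → κ) × (Fin D → ZMod 2)) :
    ((vtx R (flip1 a p) u, false) : ((κ → Fin R → ℝ) × (κ → ZMod 2)) × Bool) =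
      tact (rho R) (Pi.single (p.1 a) 1) (vtx R p u, false) := by
  simp only [vtx, flip1]
  rw [vert_act]
  congr 2
  ext k
  rw [Wt_add, Wt_single, Pi.add_apply]
  congr 1
  by_cases hk : p.1 a = k
  · subst hk; simp [h]
  · rw [if_neg (by tauto), Pi.single_eq_of_ne (fun e => hk e.symm)]

theorem cyc_null (R : ℕ) (d : κ → ℕ) (hD : 0 < D) :
    NullLen (tact (rho (κ := κ) R)) D (bd (∑ p ∈ words D d ×ˢ (Finset.univ : Finset (Fin D → ZMod 2)),
      bs (List.ofFn fun t : Fin (D + 1) => (vtx R p t, false)))) := by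
  intro Ψ hΨ
  rw [map_sum, map_sum]
  simp only [bd_bs, bdL_ofFn, map_sum, lin_bs]
  rw [Finset.sum_comm]
  refine Finset.sum_eq_zero fun t _ => ?_
  have hone : ∀ x y : ZMod 2, x = y → x + y = 0 := by decide
  rcases Nat.eq_zero_or_pos (t : ℕ) with h0 | h0
  · refine Finset.sum_involution (fun p _ => flip1 ⟨0, hD⟩ p) ?_ (fun p _ _ => flip1_ne _ p) ?_ (fun p _ => flip1_inv _ p)
    · intro p _
      apply hone
      rw [← hΨ (Pi.single (p.1 ⟨0, hD⟩) 1) _ (List.length_ofFn)]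
      congr 1
      rw [List.map_ofFn]
      congr 1
      ext1 j
      simp only [Function.comp]
      refine (flip1_vtx' R _ _ ?_ p).symm
      have : t = 0 := Fin.ext h0
      subst this
      simp
    · intro p hp
      simp only [Finset.mem_product, Finset.mem_univ, and_true] at hp ⊢
      exact hp
  · by_cases hlast : (t : ℕ) = D
    · refine Finset.sum_involution (fun p _ => flip1 ⟨D - 1, by omega⟩ p) ?_ (fun p _ _ => flip1_ne _ p) ?_
        (fun p _ => flip1_inv _ p)
      · intro p _
        apply hone
        congr 2
        ext1 j
        rw [flip1_vtx]
        have : t = Fin.last D := Fin.ext hlast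
        subst this
        simp
        omega
      · intro p hp
        simp only [Finset.mem_product, Finset.mem_univ, and_true] at hp ⊢
        exact hp
    · have htD : (t : ℕ) < D := by omega
      refine Finset.sum_involution (fun p _ => inv2 ⟨t - 1, by omega⟩ ⟨t, htD⟩ p) ?_ (fun p _ _ => inv2_ne _ _ ?_ p) ?_
        (fun p _ => inv2_inv _ _ p)
      · intro p _
        apply hone
        congr 2
        ext1 j
        rw [inv2_vtx]
        have h1 : t.succAbove j ≠ t := Fin.succAbove_ne t j
        have h2 : ((t.succAbove j : Fin (D + 1)) : ℕ) ≠ t := fun e => h1 (Fin.ext e)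
        simp only
        omega
      · intro e
        have := congrArg Fin.val e
        simp at this
        omega
      · intro p hp
        simp only [Finset.mem_product, Finset.mem_univ, and_true] at hp ⊢
        exact inv2_words d _ _ p hp

/-- product of octahedral spheres -/
def Kset (d : κ → ℕ) (R : ℕ) : Set (κ → Fin R → ℝ) :=
  {v | ∀ k, ∑ i, |v k i| = 1 ∧ ∀ i : Fin R, d k < i → v k i = 0}

theorem Kset_compact (d : κ → ℕ) (R : ℕ) : IsCompact (Kset d R) := by
  refine Metric.isCompact_of_isClosed_isBounded ?_ ?_
  · simp only [Kset, Set.ofPred_forall, Set.ofPred_and]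
    refine isClosed_iInter fun k => IsClosed.inter ?_ ?_
    · exact isClosed_eq (by fun_prop) continuous_const
    · refine isClosed_iInter fun i => isClosed_iInter fun _ => ?_
      exact isClosed_eq (by fun_prop) continuous_const
  · refine (Metric.isBounded_closedBall (x := (0 : κ → Fin R → ℝ)) (r := 1)).subset ?_
    intro v hv
    rw [mem_closedBall_zero_iff, pi_norm_le_iff_of_nonneg zero_le_one]
    intro k
    rw [pi_norm_le_iff_of_nonneg zero_le_one]
    intro i
    rw [Real.norm_eq_abs, ← (hv k).1]
    exact Finset.single_le_sum (f := fun i => |v k i|) (fun i _ => abs_nonneg _) (Finset.mem_univ i)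

theorem sg_mul_self (a : ZMod 2) : sg a * sg a = 1 := by
  unfold sg; split_ifs <;> norm_num

theorem abs_sg (a : ZMod 2) : |sg a| = 1 := by
  unfold sg; split_ifs <;> norm_num

theorem cyc_convex (R : ℕ) (d : κ → ℕ) (hR : ∀ k, d k < R) (p : (Fin D → κ) × (Fin D → ZMod 2))
    (hp : p.1 ∈ words D d) :
    ∃ C : Set (κ → Fin R → ℝ), Convex ℝ C ∧ C ⊆ Kset d R ∧ ∀ t : Fin (D + 1), (vtx R p t).1 ∈ C := by
  obtain ⟨c, η⟩ := p
  simp only [words, Finset.mem_filter, Finset.mem_univ, true_and] at hp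
  let tau : κ → ℕ → ZMod 2 := fun k i => ∑ j : Fin D, if Wt (fun _ => 1) c j k < i ∧ c j = k then η j else 0
  have hmono : ∀ (u u' : ℕ) (k : κ), u ≤ u' → Wt (fun _ => 1) c u k ≤ Wt (fun _ => 1) c u' k := by
    intro u u' k h
    refine Finset.sum_le_sum fun j _ => ?_
    by_cases h1 : (j : ℕ) < u ∧ c j = k
    · rw [if_pos h1, if_pos ⟨by omega, h1.2⟩]
    · rw [if_neg h1]; exact Nat.zero_le _
  have htau : ∀ (u : ℕ) (k : κ), Wt η c u k = tau k (Wt (fun _ => 1) c u k) := by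
    intro u k
    refine Finset.sum_congr rfl fun j _ => ?_
    congr 1
    by_cases hj : c j = k
    · simp only [hj, and_true, eq_iff_iff]
      constructor
      · intro h
        have h1 := Wt_succ (fun _ => 1) c j k
        rw [if_pos hj] at h1
        have h2 := hmono (j + 1) u k h
        omega
      · intro h
        by_contra h'
        have := hmono u j k (by omega)
        omega
    · simp [hj]
  refine ⟨{v | ∀ k, (∑ i : Fin R, sg (tau k i) * v k i = 1) ∧ (∀ i : Fin R, 0 ≤ sg (tau k i) * v k i) ∧
    ∀ i : Fin R, d k < i → v k i = 0}, ?_, ?_, ?_⟩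
  · intro v hv w hw a b ha hb hab k
    obtain ⟨v1, v2, v3⟩ := hv k
    obtain ⟨w1, w2, w3⟩ := hw k
    have e : ∀ i : Fin R, sg (tau k i) * (a • v + b • w) k i = a * (sg (tau k i) * v k i) + b * (sg (tau k i) * w k i) := by
      intro i; simp; ring
    refine ⟨?_, ?_, ?_⟩
    · simp only [e, Finset.sum_add_distrib, ← Finset.mul_sum, v1, w1]; linarith
    · intro i
      rw [e]
      exact add_nonneg (mul_nonneg ha (v2 i)) (mul_nonneg hb (w2 i))
    · intro i hi
      simp [v3 i hi, w3 i hi]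
  · intro v hv k
    obtain ⟨v1, v2, v3⟩ := hv k
    refine ⟨?_, v3⟩
    rw [← v1]
    refine Finset.sum_congr rfl fun i _ => ?_
    rw [← abs_of_nonneg (v2 i), abs_mul, abs_sg, one_mul]
  · intro t k
    set m := Wt (fun _ => 1) c t k with hm
    have hmd : m ≤ d k := by
      rw [← hp k]
      exact hmono _ _ _ (by omega)
    have hx : ∀ i : Fin R, (vtx R (c, η) t).1 k i = if (i : ℕ) = m then sg (tau k m) else 0 := by
      intro i
      rw [hm, ← htau]
      rfl
    have hx' : ∀ i : Fin R, sg (tau k i) * (vtx R (c, η) t).1 k i = if i = ⟨m, hmd.trans_lt (hR k)⟩ then 1 else 0 := by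
      intro i
      rw [hx]
      by_cases h : (i : ℕ) = m
      · rw [if_pos h, if_pos (Fin.ext h), h, sg_mul_self]
      · rw [if_neg h, if_neg (fun e => h (congrArg Fin.val e)), mul_zero]
    refine ⟨?_, ?_, ?_⟩
    · simp [hx']
    · intro i
      rw [hx']
      split_ifs <;> norm_num
    · intro i hi
      rw [hx, if_neg (by omega)]

/-- character given by a finset -/
def chr (X : Finset κ) : (κ → ZMod 2) →+ ZMod 2 where
  toFun g := ∑ k ∈ X, g k
  map_zero' := by simp
  map_add' g h := by simp [Finset.sum_add_distrib]

theorem words_coeff (d : κ → ℕ) (X : Fin D → Finset κ) :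
    MvPolynomial.coeff (Finsupp.equivFunOnFinite.symm d)
      (∏ t, ∑ k ∈ X t, (MvPolynomial.X k : MvPolynomial κ (ZMod 2))) =
    ∑ c ∈ words D d, ∏ t, if c t ∈ X t then (1 : ZMod 2) else 0 := by
  rw [Finset.prod_univ_sum, MvPolynomial.coeff_sum]
  have h1 : ∀ c : Fin D → κ, MvPolynomial.coeff (Finsupp.equivFunOnFinite.symm d)
      (∏ t, (MvPolynomial.X (c t) : MvPolynomial κ (ZMod 2))) = if c ∈ words D d then 1 else 0 := by
    intro c
    have : (∏ t, (MvPolynomial.X (c t) : MvPolynomial κ (ZMod 2))) =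
        MvPolynomial.monomial (∑ t, Finsupp.single (c t) 1) 1 := by
      rw [MvPolynomial.monomial_sum_one]
      rfl
    rw [this, MvPolynomial.coeff_monomial]
    congr 1
    simp only [words, Finset.mem_filter, Finset.mem_univ, true_and, eq_iff_iff, Finsupp.ext_iff]
    refine forall_congr' fun k => ?_
    have : (∑ t, Finsupp.single (c t) 1 : κ →₀ ℕ) k = Wt (fun _ => 1) c D k := by
      rw [Finsupp.finsetSum_apply]
      refine Finset.sum_congr rfl fun j _ => ?_
      rw [Finsupp.single_apply]
      simp
    rw [this]
    rfl
  simp only [h1, Finset.prod_ite_zero, Finset.prod_const_one, ← Finset.sum_filter]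
  rw [Finset.sum_const, Finset.sum_const]
  congr 2
  ext c
  simp [and_comm]

theorem cyc_eval (R : ℕ) (d : κ → ℕ) (X : Fin D → Finset κ) :
    ∑ p ∈ words D d ×ˢ (Finset.univ : Finset (Fin D → ZMod 2)),
      ∏ t : Fin D, (chr (X t) (vtx R p (t.castSucc : Fin (D + 1))).2 + chr (X t) (vtx R p (t.succ : Fin (D + 1))).2) =
    ∑ c ∈ words D d, ∏ t, if c t ∈ X t then (1 : ZMod 2) else 0 := by
  rw [Finset.sum_product]
  refine Finset.sum_congr rfl fun c _ => ?_
  have e : ∀ (η : Fin D → ZMod 2) (t : Fin D), chr (X t) (vtx R (c, η) (t.castSucc : Fin (D + 1))).2 +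
      chr (X t) (vtx R (c, η) (t.succ : Fin (D + 1))).2 = (if c t ∈ X t then 1 else 0) * η t := by
    intro η t
    have h1 : (vtx R (c, η) (t.succ : Fin (D + 1))).2 = (vtx R (c, η) (t.castSucc : Fin (D + 1))).2 +
        Pi.single (c t) (η t) := by
      ext k
      change Wt η c (t + 1) k = Wt η c t k + _
      rw [Wt_succ]
      congr 1
      by_cases hk : c t = k
      · subst hk; simp
      · rw [if_neg hk, Pi.single_eq_of_ne (fun e => hk e.symm)]
    rw [h1, map_add, ← add_assoc, CharTwo.add_self_eq_zero, zero_add]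
    change ∑ k ∈ X t, (Pi.single (c t) (η t) : κ → ZMod 2) k = _
    simp [Pi.single_apply]
  simp only [e]
  have := Finset.prod_univ_sum (fun _ : Fin D => (Finset.univ : Finset (ZMod 2)))
    (fun t x => (if c t ∈ X t then 1 else 0) * x)
  rw [Fintype.piFinset_univ] at this
  rw [← this]
  refine Finset.prod_congr rfl fun t _ => ?_
  rw [← Finset.mul_sum]
  have : ∑ x : ZMod 2, x = 1 := by decide
  rw [this, mul_one]

/-- Borsuk–Ulam theorem for products of spheres. -/
theorem bu_fin (d : κ → ℕ) (R : ℕ) (hR : ∀ k, d k < R) (hD : 0 < D) (X : Fin D → Finset κ)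
    (f : Fin D → (κ → Fin R → ℝ) → ℝ) (hfc : ∀ t, ContinuousOn (f t) (Kset d R))
    (hf : ∀ t (g : κ → ZMod 2) v, f t (fun k i => sg (g k) * v k i) = sg (∑ k ∈ X t, g k) * f t v)
    (hne : MvPolynomial.coeff (Finsupp.equivFunOnFinite.symm d)
      (∏ t, ∑ k ∈ X t, (MvPolynomial.X k : MvPolynomial κ (ZMod 2))) ≠ 0) :
    ∃ x ∈ Kset d R, ∀ t, f t x = 0 := by
  refine bu_core (rho R) (Kset d R) (Kset_compact d R) D _ (fun p t => vtx R p t) (cyc_null R d hD) ?_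
    (fun t => chr (X t)) f hfc hf ?_
  · intro p hp
    exact cyc_convex R d hR p (Finset.mem_product.1 hp).1
  · rw [cyc_eval, ← words_coeff]
    exact hne

theorem bu {Λ : Type*} [Fintype Λ] [Nonempty Λ] (d : κ → ℕ) (R : ℕ) (hR : ∀ k, d k < R) (X : Λ → Finset κ)
    (f : Λ → (κ → Fin R → ℝ) → ℝ) (hfc : ∀ t, ContinuousOn (f t) (Kset d R))
    (hf : ∀ t (g : κ → ZMod 2) v, f t (fun k i => sg (g k) * v k i) = sg (∑ k ∈ X t, g k) * f t v)
    (hne : MvPolynomial.coeff (Finsupp.equivFunOnFinite.symm d)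
      (∏ t, ∑ k ∈ X t, (MvPolynomial.X k : MvPolynomial κ (ZMod 2))) ≠ 0) :
    ∃ x ∈ Kset d R, ∀ t, f t x = 0 := by
  let e := (Fintype.equivFin Λ).symm
  obtain ⟨x, hx, h⟩ := bu_fin d R hR Fintype.card_pos (fun t => X (e t)) (fun t => f (e t)) (fun t => hfc _)
    (fun t => hf _) (by
      rw [Equiv.prod_comp e (fun t => ∑ k ∈ X t, (MvPolynomial.X k : MvPolynomial κ (ZMod 2)))]
      exact hne)
  refine ⟨x, hx, fun t => ?_⟩
  have := h (e.symm t)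
  rwa [Equiv.apply_symm_apply] at this

end cyc
end MilnorTC

namespace MilnorTC

section alg
variable {A : Type*} [CommRing A]

theorem frob_two (h2 : (2 : A) = 0) (x y : A) (k : ℕ) : (x + y) ^ (2 ^ k) = x ^ (2 ^ k) + y ^ (2 ^ k) := by
  induction k with
  | zero => simp
  | succ k ih =>
    rw [pow_succ, pow_mul, pow_mul, pow_mul, ih]
    linear_combination (x ^ 2 ^ k * y ^ 2 ^ k) * h2

theorem absorb (u x y : A) (h : u * x = 0) (m : ℕ) : u * (x + y) ^ m = u * y ^ m := by
  induction m with
  | zero => simp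
  | succ m ih =>
    rw [pow_succ, pow_succ, ← mul_assoc, ih, ← mul_assoc]
    linear_combination y ^ m * h

theorem absorb_prod {ι : Type*} (s : Finset ι) (u : A) (x y : ι → A) (h : ∀ i ∈ s, u * x i = 0) (m : ℕ) :
    u * ∏ i ∈ s, (x i + y i) ^ m = u * ∏ i ∈ s, y i ^ m := by
  classical
  induction s using Finset.induction_on with
  | empty => rfl
  | insert a s ha ih =>
    rw [Finset.prod_insert ha, Finset.prod_insert ha]
    have h1 := absorb u (x a) (y a) (h a (by simp)) m
    have h2 := ih fun i hi => h i (Finset.mem_insert_of_mem hi)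
    rw [← mul_assoc, h1, mul_right_comm, h2, mul_right_comm, mul_assoc]

theorem alg_id (h2 : (2 : A) = 0) (N α β : ℕ) (a0 a1 b0 b1 : A) (a b : Fin N → A)
    (ha0 : a0 ^ (2 ^ α + 2) = 0) (ha1 : a1 ^ (2 ^ α + 1) = 0)
    (hb0 : b0 ^ (2 ^ β) = 0) (hb1 : b1 ^ (2 ^ β + 1) = 0) (hb : ∀ j, b j ^ (2 ^ β + 1) = 0) :
    ((a0 + b0) * ((a1 + b1) * ∏ j, (a j + b j))) *
      (((a0 + a1) ^ (2 * 2 ^ α - 1) * ∏ j, (a0 + a j) ^ (2 ^ α)) *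
       ((b0 + b1) ^ (2 * 2 ^ β - 1) * ∏ j, (b0 + b j) ^ (2 ^ β))) =
    (a0 ^ (2 ^ α + 1) * (a1 ^ (2 ^ α) * ∏ j, a j ^ (2 ^ α + 1))) *
      (b0 ^ (2 ^ β - 1) * (b1 ^ (2 ^ β) * ∏ j, b j ^ (2 ^ β))) := by
  obtain ⟨p', hp⟩ : ∃ p', 2 ^ α = p' + 1 := ⟨2 ^ α - 1, by have := Nat.one_le_two_pow (n := α); omega⟩
  obtain ⟨q', hq⟩ : ∃ q', 2 ^ β = q' + 1 := ⟨2 ^ β - 1, by have := Nat.one_le_two_pow (n := β); omega⟩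
  have fa := frob_two h2 a0 a1 α
  have fb := frob_two h2 b0 b1 β
  rw [hp] at fa ha0 ha1 ⊢
  rw [hq] at fb hb0 hb1 ⊢
  simp only [hq] at hb
  have e1 : 2 * (p' + 1) - 1 = (p' + 1) + p' := by omega
  have e2 : 2 * (q' + 1) - 1 = (q' + 1) + q' := by omega
  have e3 : q' + 1 - 1 = q' := by omega
  rw [e1, e2, e3, pow_add (a0 + a1), pow_add (b0 + b1), fa, fb, hb0, zero_add]
  -- B part
  have hB1 : b1 ^ (q' + 1) * (b0 + b1) ^ q' = b1 ^ (q' + 1) * b0 ^ q' := by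
    rw [add_comm b0]; exact absorb _ _ _ (by rw [← pow_succ]; exact hb1) _
  rw [hB1]
  have hB2 : b1 ^ (q' + 1) * b0 ^ q' * ∏ j, (b0 + b j) ^ (q' + 1) = b1 ^ (q' + 1) * b0 ^ q' * ∏ j, b j ^ (q' + 1) :=
    absorb_prod _ _ (fun _ => b0) b (fun j _ => by rw [mul_assoc, ← pow_succ, hb0, mul_zero]) _
  rw [hB2]
  set B := b1 ^ (q' + 1) * b0 ^ q' * ∏ j, b j ^ (q' + 1) with hBd
  have hBb0 : B * b0 = 0 := by
    rw [hBd]; linear_combination (b1 ^ (q' + 1) * ∏ j, b j ^ (q' + 1)) * hb0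
  have hBb1 : B * b1 = 0 := by
    rw [hBd]; linear_combination (b0 ^ q' * ∏ j, b j ^ (q' + 1)) * hb1
  have hBb : ∀ j, B * b j = 0 := by
    intro j
    rw [hBd, ← Finset.mul_prod_erase _ _ (Finset.mem_univ j)]
    linear_combination (b1 ^ (q' + 1) * b0 ^ q' * ∏ j ∈ Finset.univ.erase j, b j ^ (q' + 1)) * hb j
  have hB3 : B * ∏ j, (a j + b j) = B * ∏ j, a j := by
    have := absorb_prod Finset.univ B b a (fun j _ => hBb j) 1
    simp only [pow_one, add_comm (b _)] at this
    exact this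
  -- A part
  have hA1 : a0 ^ (p' + 1 + 1) * (a0 + a1) ^ p' = a0 ^ (p' + 1 + 1) * a1 ^ p' :=
    absorb _ _ _ (by rw [← pow_succ]; exact ha0) _
  have hA2 : a0 ^ (p' + 1 + 1) * ∏ j, (a0 + a j) ^ (p' + 1) = a0 ^ (p' + 1 + 1) * ∏ j, a j ^ (p' + 1) :=
    absorb_prod _ _ (fun _ => a0) a (fun j _ => by rw [← pow_succ]; exact ha0) _
  have hA3 : ∏ j, a j ^ (p' + 1 + 1) = (∏ j, a j) * ∏ j, a j ^ (p' + 1) := by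
    rw [← Finset.prod_mul_distrib]; exact Finset.prod_congr rfl fun j _ => by ring
  rw [hA3]
  have s1 : B * ((a0 + b0) * ((a1 + b1) * ∏ j, (a j + b j))) = B * (a0 * (a1 * ∏ j, a j)) := by
    linear_combination (a1 + b1) * (∏ j, (a j + b j)) * hBb0 + a0 * (∏ j, (a j + b j)) * hBb1 + a0 * a1 * hB3
  have s2 : a0 * a1 * ((a0 ^ (p' + 1) + a1 ^ (p' + 1)) * (a0 + a1) ^ p' * ∏ j, (a0 + a j) ^ (p' + 1)) =
      a0 ^ (p' + 1 + 1) * a1 ^ (p' + 1) * ∏ j, a j ^ (p' + 1) := by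
    linear_combination a0 * (a0 + a1) ^ p' * (∏ j, (a0 + a j) ^ (p' + 1)) * ha1 +
      a1 * (∏ j, (a0 + a j) ^ (p' + 1)) * hA1 + a1 ^ (p' + 1) * hA2
  have hB : b0 ^ q' * (b1 ^ (q' + 1) * ∏ j, b j ^ (q' + 1)) = B := by rw [hBd]; ring
  rw [hB]
  linear_combination ((a0 ^ (p' + 1) + a1 ^ (p' + 1)) * (a0 + a1) ^ p' * ∏ j, (a0 + a j) ^ (p' + 1)) * s1 +
    B * (∏ j, a j) * s2

end alg

section coeffs

/-- multiplicities -/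
def mu (N p : ℕ) : Fin (N + 2) → ℕ := Fin.cons 0 (Fin.cons (2 * p - 1) fun _ => p)

/-- dimensions -/
def dd (N p q : ℕ) : Fin (N + 2) ⊕ Fin (N + 2) → ℕ :=
  Sum.elim (Fin.cons (p + 1) (Fin.cons p fun _ => p + 1)) (Fin.cons (q - 1) (Fin.cons q fun _ => q))

/-- index set of the equations coming from motion planners -/
abbrev Lam (N p q : ℕ) := (Σ j : Fin (N + 2), Fin (mu N p j)) ⊕ (Σ j : Fin (N + 2), Fin (mu N q j))

/-- characters -/
def Xs (N p q : ℕ) : Fin (N + 2) ⊕ Lam N p q → Finset (Fin (N + 2) ⊕ Fin (N + 2))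
  | Sum.inl j => {Sum.inl j, Sum.inr j}
  | Sum.inr (Sum.inl x) => {Sum.inl 0, Sum.inl x.1}
  | Sum.inr (Sum.inr x) => {Sum.inr 0, Sum.inr x.1}

theorem mu_sum (N p : ℕ) (hp : 1 ≤ p) : ∑ j, mu N p j = (N + 2) * p - 1 := by
  rw [Fin.sum_univ_succ, Fin.sum_univ_succ]
  simp [mu]
  have : (N + 2) * p = N * p + 2 * p := by ring
  omega

theorem card_Lam (N p q : ℕ) (hp : 1 ≤ p) (hq : 1 ≤ q) :
    Fintype.card (Lam N p q) = (N + 2) * (p + q) - 2 := by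
  rw [Fintype.card_sum, Fintype.card_sigma, Fintype.card_sigma]
  simp only [Fintype.card_fin]
  rw [mu_sum N p hp, mu_sum N q hq, mul_add]
  have h1 : 1 ≤ (N + 2) * p := Nat.mul_pos (by omega) hp
  have h2 : 1 ≤ (N + 2) * q := Nat.mul_pos (by omega) hq
  omega

theorem mu_pos_ne {N p : ℕ} (x : Σ j : Fin (N + 2), Fin (mu N p j)) : x.1 ≠ 0 := by
  obtain ⟨j, i⟩ := x
  rintro rfl
  exact Fin.elim0 i

theorem coeff_ideal {κ : Type*} [Fintype κ] (d : κ → ℕ) (f : MvPolynomial κ (ZMod 2))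
    (hf : f ∈ Ideal.span (Set.range fun k => (MvPolynomial.X k : MvPolynomial κ (ZMod 2)) ^ (d k + 1))) :
    MvPolynomial.coeff (Finsupp.equivFunOnFinite.symm d) f = 0 := by
  classical
  obtain ⟨c, rfl⟩ := (Submodule.mem_span_range_iff_exists_fun _).1 hf
  rw [MvPolynomial.coeff_sum]
  refine Finset.sum_eq_zero fun k _ => ?_
  rw [smul_eq_mul, MvPolynomial.X_pow_eq_monomial, MvPolynomial.coeff_mul_monomial', if_neg]
  intro h
  have := h k
  simp at this

theorem alg_coeff (N α β : ℕ) :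
    MvPolynomial.coeff (Finsupp.equivFunOnFinite.symm (dd N (2 ^ α) (2 ^ β)))
      (∏ t, ∑ k ∈ Xs N (2 ^ α) (2 ^ β) t, (MvPolynomial.X k : MvPolynomial _ (ZMod 2))) ≠ 0 := by
  set p := 2 ^ α with hp
  set q := 2 ^ β with hq
  have hp1 : 1 ≤ p := Nat.one_le_two_pow
  have hq1 : 1 ≤ q := Nat.one_le_two_pow
  let JJ := Ideal.span (Set.range fun k => (MvPolynomial.X k : MvPolynomial (Fin (N + 2) ⊕ Fin (N + 2)) (ZMod 2)) ^ (dd N p q k + 1))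
  let x : Fin (N + 2) ⊕ Fin (N + 2) → MvPolynomial (Fin (N + 2) ⊕ Fin (N + 2)) (ZMod 2) ⧸ JJ :=
    fun k => Ideal.Quotient.mk JJ (MvPolynomial.X k)
  have hx : ∀ k, x k ^ (dd N p q k + 1) = 0 := by
    intro k
    rw [← map_pow]
    exact Ideal.Quotient.eq_zero_iff_mem.2 (Ideal.subset_span ⟨k, rfl⟩)
  have h2 : (2 : MvPolynomial (Fin (N + 2) ⊕ Fin (N + 2)) (ZMod 2) ⧸ JJ) = 0 := by
    have := map_ofNat ((Ideal.Quotient.mk JJ).comp (MvPolynomial.C (R := ZMod 2))) 2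
    rw [← this]
    have h : (OfNat.ofNat 2 : ZMod 2) = 0 := rfl
    rw [h, map_zero]
  have key := alg_id h2 N α β (x (Sum.inl 0)) (x (Sum.inl 1)) (x (Sum.inr 0)) (x (Sum.inr 1))
    (fun j => x (Sum.inl j.succ.succ)) (fun j => x (Sum.inr j.succ.succ)) (hx (Sum.inl 0)) (hx (Sum.inl 1))
    (by have := hx (Sum.inr 0)
        have e : dd N p q (Sum.inr 0) + 1 = q := by simp [dd]; omega
        rwa [e] at this) (hx (Sum.inr 1)) (fun j => hx (Sum.inr j.succ.succ))
  have hmk : Ideal.Quotient.mk JJ (∏ t, ∑ k ∈ Xs N p q t, MvPolynomial.X k) = Ideal.Quotient.mk JJ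
      (MvPolynomial.monomial (Finsupp.equivFunOnFinite.symm (dd N p q)) 1) := by
    have hL : Ideal.Quotient.mk JJ (∏ t, ∑ k ∈ Xs N p q t, MvPolynomial.X k) = ∏ t, ∑ k ∈ Xs N p q t, x k := by
      simp only [map_prod, map_sum]; rfl
    have hR : Ideal.Quotient.mk JJ (MvPolynomial.monomial (Finsupp.equivFunOnFinite.symm (dd N p q)) 1) =
        ∏ k, x k ^ dd N p q k := by
      rw [MvPolynomial.monomial_eq, Finsupp.prod_fintype _ _ (fun _ => pow_zero _)]
      simp only [map_prod, map_pow, map_one, one_mul]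
      rfl
    rw [hL, hR, Fintype.prod_sum_type, Fintype.prod_sum_type, Fintype.prod_sum_type, Fintype.prod_sigma, Fintype.prod_sigma]
    have g1 : ∀ j : Fin (N + 2), ∑ k ∈ Xs N p q (Sum.inl j), x k = x (Sum.inl j) + x (Sum.inr j) := by
      intro j
      rw [Xs, Finset.sum_pair (by simp)]
    have g2 : ∀ j : Fin (N + 2), ∏ i : Fin (mu N p j), ∑ k ∈ Xs N p q (Sum.inr (Sum.inl ⟨j, i⟩)), x k =
        (x (Sum.inl 0) + x (Sum.inl j)) ^ mu N p j := by
      intro j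
      rw [Finset.prod_congr rfl (g := fun _ => x (Sum.inl 0) + x (Sum.inl j))]
      · simp
      · intro i _
        have := mu_pos_ne ⟨j, i⟩
        rw [Xs, Finset.sum_pair]
        simpa using this.symm
    have g3 : ∀ j : Fin (N + 2), ∏ i : Fin (mu N q j), ∑ k ∈ Xs N p q (Sum.inr (Sum.inr ⟨j, i⟩)), x k =
        (x (Sum.inr 0) + x (Sum.inr j)) ^ mu N q j := by
      intro j
      rw [Finset.prod_congr rfl (g := fun _ => x (Sum.inr 0) + x (Sum.inr j))]
      · simp
      · intro i _
        have := mu_pos_ne ⟨j, i⟩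
        rw [Xs, Finset.sum_pair]
        simpa using this.symm
    simp only [g1, g2, g3]
    simp only [Fin.prod_univ_succ (n := N + 1), Fin.prod_univ_succ (n := N)]
    have m0 : ∀ p, mu N p 0 = 0 := fun _ => rfl
    have m1 : ∀ p, mu N p (Fin.succ 0) = 2 * p - 1 := fun _ => rfl
    have m2 : ∀ p (j : Fin N), mu N p j.succ.succ = p := fun _ _ => rfl
    simp only [m0, m1, m2, pow_zero, one_mul]
    exact key
  have hsub := coeff_ideal (dd N p q) _ (Ideal.Quotient.eq.1 hmk)
  rw [MvPolynomial.coeff_sub, MvPolynomial.coeff_monomial, if_pos rfl, sub_eq_zero] at hsub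
  rw [hsub]
  exact one_ne_zero

end coeffs
end MilnorTC

open scoped unitInterval

namespace MilnorTC

section transport
variable {m : ℕ}

theorem pm_pair (p q : Pr m) : ∑ i, ∑ j, pm p i j * pm q i j =
    (∑ i, p.rep i * q.rep i) ^ 2 / ((∑ k, p.rep k ^ 2) * ∑ k, q.rep k ^ 2) := by
  rw [sq, Finset.sum_mul_sum, Finset.sum_div]
  refine Finset.sum_congr rfl fun i _ => ?_
  rw [Finset.sum_div]
  refine Finset.sum_congr rfl fun j _ => ?_
  simp only [pm]
  rw [div_mul_div_comm]
  congr 1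
  ring

theorem pm_pair_ne (p q : Pr m) (h : ∑ i, ∑ j, pm p i j * pm q i j ≠ 0) : ∑ i, p.rep i * q.rep i ≠ 0 := by
  intro h'
  rw [pm_pair, h'] at h
  simp at h

theorem pm_pair_self (p : Pr m) : ∑ i, ∑ j, pm p i j * pm p i j ≠ 0 := by
  rw [pm_pair]
  have := sumsq_pos p.rep_nonzero
  have h2 : ∑ i, p.rep i * p.rep i = ∑ k, p.rep k ^ 2 := Finset.sum_congr rfl fun i _ => by ring
  rw [h2]
  positivity

theorem pm_apply (q : Pr m) (x : Fin m → ℝ) (i : Fin m) :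
    ∑ j, pm q i j * x j = ((∑ j, q.rep j * x j) / ∑ k, q.rep k ^ 2) * q.rep i := by
  rw [Finset.sum_div, Finset.sum_mul]
  refine Finset.sum_congr rfl fun j _ => ?_
  simp only [pm]
  ring

/-- matrices transporting the line `f` to the line `g`. -/
def HasQ {K : Type*} [TopologicalSpace K] (f g : K → Pr m) : Prop :=
  ∃ Q : K → Fin m → Fin m → ℝ, Continuous Q ∧ ∀ w, ∃ c : ℝ, c ≠ 0 ∧ ∀ i, ∑ j, Q w i j * (f w).rep j = c * (g w).rep i

theorem HasQ.trans {K : Type*} [TopologicalSpace K] {f g h : K → Pr m} (h1 : HasQ f g) (h2 : HasQ g h) :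
    HasQ f h := by
  obtain ⟨Q, hQ, e⟩ := h1
  obtain ⟨Q', hQ', e'⟩ := h2
  refine ⟨fun w i j => ∑ k, Q' w i k * Q w k j, by fun_prop, fun w => ?_⟩
  obtain ⟨c, hc, e⟩ := e w
  obtain ⟨c', hc', e'⟩ := e' w
  refine ⟨c * c', mul_ne_zero hc hc', fun i => ?_⟩
  simp only [Finset.sum_mul]
  rw [Finset.sum_comm]
  have : ∀ k, ∑ j, Q' w i k * Q w k j * (f w).rep j = c * (Q' w i k * (g w).rep k) := by
    intro k
    simp only [mul_assoc, ← Finset.mul_sum, e]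
    ring
  rw [Finset.sum_congr rfl fun k _ => this k, ← Finset.mul_sum, e']; ring

theorem hasQ_near {K : Type*} [TopologicalSpace K] {f g : K → Pr m} (hg : Continuous g)
    (h : ∀ w, ∑ i, ∑ j, pm (f w) i j * pm (g w) i j ≠ 0) : HasQ f g := by
  refine ⟨fun w i j => pm (g w) i j, continuous_pi fun i => continuous_pi fun j => (pm_cont i j).comp hg, fun w => ?_⟩
  refine ⟨_, ?_, fun i => pm_apply (g w) (f w).rep i⟩
  have h1 := pm_pair_ne _ _ (h w)
  refine div_ne_zero ?_ (sumsq_pos (g w).rep_nonzero).ne'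
  simpa only [mul_comm] using h1

theorem hasQ_homotopy {K : Type*} [TopologicalSpace K] [CompactSpace K] (H : K × I → Pr m) (hH : Continuous H)
    (t t' : I) : HasQ (fun w => H (w, t)) (fun w => H (w, t')) := by
  refine PreconnectedSpace.induction₂' (fun t t' : I => HasQ (fun w => H (w, t)) (fun w => H (w, t'))) ?_
    ⟨fun a b c h1 h2 => h1.trans h2⟩ t t'
  intro t
  have hc : Continuous fun z : I × K => ∑ i, ∑ j, pm (H (z.2, t)) i j * pm (H (z.2, z.1)) i j := by
    refine continuous_finsetSum _ fun i _ => continuous_finsetSum _ fun j _ => Continuous.mul ?_ ?_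
    · exact (pm_cont i j).comp (hH.comp (by fun_prop))
    · exact (pm_cont i j).comp (hH.comp (by fun_prop))
  have := (isCompact_univ (X := K)).eventually_forall_of_forall_eventually (x₀ := t)
    (P := fun t' w => ∑ i, ∑ j, pm (H (w, t)) i j * pm (H (w, t')) i j ≠ 0) (by
      intro w _
      exact (hc.continuousAt (x := (t, w))).eventually_ne (pm_pair_self (H (w, t))))
  filter_upwards [this] with t' ht'
  refine ⟨hasQ_near (hH.comp (by fun_prop)) fun w => ht' w (Set.mem_univ _),
    hasQ_near (hH.comp (by fun_prop)) fun w => ?_⟩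
  have := ht' w (Set.mem_univ _)
  simpa only [mul_comm] using this

theorem HasQ.form {K : Type*} [TopologicalSpace K] {f g : K → Pr m} (h : HasQ f g) :
    ∃ Q : K → Fin m → Fin m → ℝ, Continuous Q ∧ ∀ w (x y : Fin m → ℝ) (hx : x ≠ 0) (hy : y ≠ 0),
      Projectivization.mk ℝ x hx = f w → Projectivization.mk ℝ y hy = g w →
      ∑ i, ∑ j, y i * Q w i j * x j ≠ 0 := by
  obtain ⟨Q, hQ, e⟩ := h
  refine ⟨Q, hQ, fun w x y hx hy hxf hyg => ?_⟩
  obtain ⟨c, hc, e⟩ := e w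
  obtain ⟨a, ha⟩ := Projectivization.exists_smul_eq_mk_rep ℝ x hx
  obtain ⟨b, hb⟩ := Projectivization.exists_smul_eq_mk_rep ℝ y hy
  rw [hxf] at ha
  rw [hyg] at hb
  have ha0 : (a : ℝ) ≠ 0 := a.ne_zero
  have hb0 : (b : ℝ) ≠ 0 := b.ne_zero
  have hx' : ∀ i, x i = (a : ℝ)⁻¹ * (f w).rep i := by
    intro i; rw [← ha]
    change x i = (a : ℝ)⁻¹ * ((a : ℝ) * x i)
    field_simp
  have hy' : ∀ i, (g w).rep i = (b : ℝ) * y i := by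
    intro i; rw [← hb]; rfl
  have : ∀ i, ∑ j, y i * Q w i j * x j = (a : ℝ)⁻¹ * c * b * y i ^ 2 := by
    intro i
    have h1 : ∀ j, y i * Q w i j * x j = ((a : ℝ)⁻¹ * y i) * (Q w i j * (f w).rep j) := by
      intro j; rw [hx']; ring
    simp only [h1, ← Finset.mul_sum, e, hy']
    ring
  simp only [this, ← Finset.mul_sum]
  have := (sumsq_pos hy).ne'
  positivity

end transport

section planner
variable {X : Type} [TopologicalSpace X] {n m : ℕ}

/-- A (homotopy) motion planner over `U` makes all projections line-transportable over compact subsets. -/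
theorem planner_hasQ (U : Set (Fin n → X)) (sec : C(U, C(I, X))) (H : C(U × I, Fin n → X))
    (h0 : ∀ v : U, H (v, 0) = tcPi X n (sec v)) (h1 : ∀ v : U, H (v, 1) = (v : Fin n → X))
    (K : Set (Fin n → X)) (hK : IsCompact K) (hKU : K ⊆ U) (pr : X → Pr m) (hpr : Continuous pr) (j j' : Fin n) :
    HasQ (fun w : K => pr (w.1 j)) (fun w : K => pr (w.1 j')) := by
  have : CompactSpace K := isCompact_iff_compactSpace.1 hK
  let ι : K → U := fun w => ⟨w.1, hKU w.2⟩
  have hι : Continuous ι := by fun_prop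
  have hH : ∀ (j : Fin n) (t t' : I), HasQ (fun w : K => pr (H (ι w, t) j)) (fun w : K => pr (H (ι w, t') j)) := by
    intro j t t'
    refine hasQ_homotopy (fun z : K × I => pr (H (ι z.1, z.2) j)) ?_ t t'
    fun_prop
  have hS : ∀ (t t' : I), HasQ (fun w : K => pr (sec (ι w) t)) (fun w : K => pr (sec (ι w) t')) := by
    intro t t'
    refine hasQ_homotopy (fun z : K × I => pr (sec (ι z.1) z.2)) ?_ t t'
    fun_prop
  have e1 := hH j 1 0
  have e2 := hH j' 0 1
  simp only [h0, h1] at e1 e2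
  exact (e1.trans (hS _ _)).trans e2

end planner
end MilnorTC

open scoped unitInterval

namespace MilnorTC

open Classical in
/-- The point of projective space of a nonzero vector, with a default value at zero. -/
noncomputable def toPr {m : ℕ} (x : Fin (m + 1) → ℝ) : Pr (m + 1) :=
  if h : x ≠ 0 then Projectivization.mk ℝ x h
  else Projectivization.mk ℝ (fun _ => 1) (fun h => by simpa using congrFun h 0)

theorem toPr_of_ne {m : ℕ} {x : Fin (m + 1) → ℝ} (h : x ≠ 0) : toPr x = Projectivization.mk ℝ x h := by
  simp only [toPr, dif_pos h]

theorem sg_ne (a : ZMod 2) : sg a ≠ 0 := by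
  unfold sg
  split_ifs <;> norm_num

theorem toPr_sg {m : ℕ} (a : ZMod 2) (x : Fin (m + 1) → ℝ) : toPr (fun i => sg a * x i) = toPr x := by
  by_cases h : x = 0
  · subst h
    congr 1
    funext i
    simp
  · have h' : (fun i => sg a * x i) ≠ 0 := by
      intro h2
      apply h
      funext i
      have := congrFun h2 i
      simpa [sg_ne] using this
    rw [toPr_of_ne h, toPr_of_ne h', Projectivization.mk_eq_mk_iff']
    exact ⟨sg a, rfl⟩

theorem toPr_contOn {m : ℕ} : ContinuousOn (toPr (m := m)) {x | x ≠ 0} := by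
  rw [continuousOn_iff_continuous_domRestrict]
  have := mk_cont (m + 1)
  refine this.congr fun x => ?_
  exact (toPr_of_ne x.2).symm

/-- Restriction to the first `s + 1` coordinates. -/
def rs {r s : ℕ} (hsr : s ≤ r) (x : Fin (r + 1) → ℝ) : Fin (s + 1) → ℝ :=
  fun i => x (Fin.castLE (by omega) i)

theorem rs_cont {r s : ℕ} (hsr : s ≤ r) : Continuous (rs hsr) := by
  unfold rs
  fun_prop

/-- bilinear form -/
def bil {m : ℕ} (Q : Fin m → Fin m → ℝ) (x y : Fin m → ℝ) : ℝ := ∑ i, ∑ j, y i * Q i j * x j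

theorem bil_smul {m : ℕ} (Q : Fin m → Fin m → ℝ) (x y : Fin m → ℝ) (a b : ℝ) :
    bil Q (fun i => a * x i) (fun i => b * y i) = a * b * bil Q x y := by
  simp only [bil, Finset.mul_sum]
  refine Finset.sum_congr rfl fun i _ => Finset.sum_congr rfl fun j _ => ?_
  ring

theorem form_ext {X : Type} [TopologicalSpace X] [CompactSpace X] {n m : ℕ} {Y : Type} [TopologicalSpace Y]
    [CompactSpace Y] [T2Space Y] (e : (Fin n → X) → Y) (he : Continuous e) (hei : Function.Injective e)
    (U : Set (Fin n → X)) (sec : C(U, C(I, X))) (H : C(U × I, Fin n → X))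
    (h0 : ∀ v : U, H (v, 0) = tcPi X n (sec v)) (h1 : ∀ v : U, H (v, 1) = (v : Fin n → X))
    (K : Set (Fin n → X)) (hK : IsClosed K) (hKU : K ⊆ U) (pr : X → Pr m) (hpr : Continuous pr) (j j' : Fin n) :
    ∃ Q : Y → Fin m → Fin m → ℝ, Continuous Q ∧ ∀ w ∈ K, ∀ (x y : Fin m → ℝ) (hx : x ≠ 0) (hy : y ≠ 0),
      Projectivization.mk ℝ x hx = pr (w j) → Projectivization.mk ℝ y hy = pr (w j') →
      bil (Q (e w)) x y ≠ 0 := by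
  have : CompactSpace K := isCompact_iff_compactSpace.1 hK.isCompact
  obtain ⟨Q, hQ, hf⟩ := (planner_hasQ U sec H h0 h1 K hK.isCompact hKU pr hpr j j').form
  have hemb : Topology.IsClosedEmbedding (fun w : K => e w.1) :=
    Continuous.isClosedEmbedding (by fun_prop) (hei.comp Subtype.val_injective)
  have hext : ∀ a b, ∃ g : C(Y, ℝ), ∀ w : K, g (e w.1) = Q w a b := by
    intro a b
    obtain ⟨g, hg⟩ := ContinuousMap.exists_extension hemb (⟨fun w => Q w a b, by fun_prop⟩ : C(K, ℝ))
    exact ⟨g, fun w => congrArg (fun h : C(K, ℝ) => h w) hg⟩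
  choose g hg using hext
  refine ⟨fun y a b => g a b y, by fun_prop, fun w hw x y hx hy ex ey => ?_⟩
  have := hf ⟨w, hw⟩ x y hx hy ex ey
  simp only [bil, hg _ _ ⟨w, hw⟩]
  exact this

section main
variable {r s N p q : ℕ}

/-- The common parametrisation of tuples of points by vectors. -/
noncomputable def Yv (hsr : s ≤ r) (v : Fin (N + 2) ⊕ Fin (N + 2) → Fin (r + 1) → ℝ) :
    Fin (N + 2) → Pr (r + 1) × Pr (s + 1) :=
  fun j => (toPr (v (Sum.inl j)), toPr (rs hsr (v (Sum.inr j))))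

theorem Yv_sg (hsr : s ≤ r) (g : Fin (N + 2) ⊕ Fin (N + 2) → ZMod 2) (v) :
    Yv hsr (fun k i => sg (g k) * v k i) = Yv (s := s) hsr v := by
  funext j
  simp only [Yv]
  refine Prod.ext (toPr_sg _ _) ?_
  exact toPr_sg (g (Sum.inr j)) (rs hsr (v (Sum.inr j)))

theorem Kset_inl_ne {d : Fin (N + 2) ⊕ Fin (N + 2) → ℕ} {v} (hv : v ∈ Kset d (r + 1)) (k) : v k ≠ 0 := by
  intro h
  have := (hv k).1
  rw [h] at this
  simp at this

theorem Kset_inr_ne (hsr : s ≤ r) {d : Fin (N + 2) ⊕ Fin (N + 2) → ℕ} {v} (hv : v ∈ Kset d (r + 1)) (k)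
    (hd : d k ≤ s) : rs hsr (v k) ≠ 0 := by
  intro h
  refine Kset_inl_ne hv k (funext fun i => ?_)
  by_cases hi : (i : ℕ) ≤ s
  · exact congrFun h ⟨i, by omega⟩
  · exact (hv k).2 i (by omega)

theorem dd_inl_le (hp : p + 1 ≤ r) (j) : dd N p q (Sum.inl j) ≤ r := by
  refine Fin.cases ?_ (fun j => ?_) j
  · simpa [dd] using hp
  · refine Fin.cases ?_ (fun j => ?_) j
    · simp [dd]; omega
    · simpa [dd] using hp

theorem dd_inr_le (hq : q ≤ s) (j) : dd N p q (Sum.inr j) ≤ s := by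
  refine Fin.cases ?_ (fun j => ?_) j
  · simp [dd]; omega
  · refine Fin.cases ?_ (fun j => ?_) j
    · simp [dd]; omega
    · simpa [dd] using hq

theorem Yv_contOn (hsr : s ≤ r) (d : Fin (N + 2) ⊕ Fin (N + 2) → ℕ) (hd : ∀ j, d (Sum.inr j) ≤ s) :
    ContinuousOn (Yv (s := s) hsr) (Kset d (r + 1)) := by
  refine continuousOn_pi.2 fun j => ContinuousOn.prodMk ?_ ?_
  · exact toPr_contOn.comp (by fun_prop) fun v hv => Kset_inl_ne hv _
  · have := rs_cont (s := s) hsr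
    exact toPr_contOn.comp (f := fun v : Fin (N + 2) ⊕ Fin (N + 2) → Fin (r + 1) → ℝ => rs hsr (v (Sum.inr j)))
      (by fun_prop) fun v hv => Kset_inr_ne hsr hv _ (hd j)

/-- The equivariant functions. -/
noncomputable def ff (hsr : s ≤ r) (Q : Lam N p q → Fin (N + 2) → (Fin (N + 2) → Pr (r + 1) × Pr (s + 1)) →
      Fin (r + 1) → Fin (r + 1) → ℝ)
    (Q' : Lam N p q → Fin (N + 2) → (Fin (N + 2) → Pr (r + 1) × Pr (s + 1)) → Fin (s + 1) → Fin (s + 1) → ℝ) :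
    Fin (N + 2) ⊕ Lam N p q → (Fin (N + 2) ⊕ Fin (N + 2) → Fin (r + 1) → ℝ) → ℝ
  | Sum.inl j => fun v => dot hsr (v (Sum.inl j)) (rs hsr (v (Sum.inr j)))
  | Sum.inr (Sum.inl x) => fun v => bil (Q (Sum.inl x) x.1 (Yv hsr v)) (v (Sum.inl 0)) (v (Sum.inl x.1))
  | Sum.inr (Sum.inr x) => fun v => bil (Q' (Sum.inr x) x.1 (Yv hsr v)) (rs hsr (v (Sum.inr 0)))
      (rs hsr (v (Sum.inr x.1)))

theorem ff_cont (hsr : s ≤ r) (Q : Lam N p q → Fin (N + 2) → (Fin (N + 2) → Pr (r + 1) × Pr (s + 1)) →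
      Fin (r + 1) → Fin (r + 1) → ℝ)
    (Q' : Lam N p q → Fin (N + 2) → (Fin (N + 2) → Pr (r + 1) × Pr (s + 1)) → Fin (s + 1) → Fin (s + 1) → ℝ)
    (hQ : ∀ l j, Continuous (Q l j)) (hQ' : ∀ l j, Continuous (Q' l j))
    (d : Fin (N + 2) ⊕ Fin (N + 2) → ℕ) (hd : ∀ j, d (Sum.inr j) ≤ s) (t) :
    ContinuousOn (ff hsr Q Q' t) (Kset d (r + 1)) := by
  have hY := Yv_contOn (r := r) hsr d hd
  have hrs := rs_cont (s := s) hsr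
  rcases t with j | x | x
  · apply Continuous.continuousOn
    simp only [ff, dot, rs]
    fun_prop
  · have hq := (hQ (Sum.inl x) x.1).comp_continuousOn hY
    simp only [ff, bil]
    refine continuousOn_finsetSum _ fun a _ => continuousOn_finsetSum _ fun b _ => ?_
    refine ContinuousOn.mul (ContinuousOn.mul (by fun_prop) ?_) (by fun_prop)
    exact continuousOn_pi.1 (continuousOn_pi.1 hq a) b
  · have hq := (hQ' (Sum.inr x) x.1).comp_continuousOn hY
    simp only [ff, bil, rs]
    refine continuousOn_finsetSum _ fun a _ => continuousOn_finsetSum _ fun b _ => ?_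
    refine ContinuousOn.mul (ContinuousOn.mul (by fun_prop) ?_) (by fun_prop)
    exact continuousOn_pi.1 (continuousOn_pi.1 hq a) b

theorem ff_equiv (hsr : s ≤ r) (Q : Lam N p q → Fin (N + 2) → (Fin (N + 2) → Pr (r + 1) × Pr (s + 1)) →
      Fin (r + 1) → Fin (r + 1) → ℝ)
    (Q' : Lam N p q → Fin (N + 2) → (Fin (N + 2) → Pr (r + 1) × Pr (s + 1)) → Fin (s + 1) → Fin (s + 1) → ℝ)
    (t) (g : Fin (N + 2) ⊕ Fin (N + 2) → ZMod 2) (v) :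
    ff hsr Q Q' t (fun k i => sg (g k) * v k i) = sg (∑ k ∈ Xs N p q t, g k) * ff hsr Q Q' t v := by
  rcases t with j | x | x
  · simp only [Xs]
    rw [Finset.sum_pair (by simp), sg_add]
    simp only [ff, dot, rs, Finset.mul_sum]
    refine Finset.sum_congr rfl fun i _ => ?_
    ring
  · simp only [Xs]
    rw [Finset.sum_pair (by simpa using (mu_pos_ne x).symm), sg_add]
    simp only [ff, Yv_sg]
    exact bil_smul _ _ _ _ _
  · simp only [Xs]
    rw [Finset.sum_pair (by simpa using (mu_pos_ne x).symm), sg_add]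
    simp only [ff, Yv_sg]
    exact bil_smul _ (rs hsr (v (Sum.inr 0))) (rs hsr (v (Sum.inr x.1))) _ _

end main

theorem lower_bound {r s : ℕ} (N α β : ℕ) (hsr : s ≤ r) (hp : 2 ^ α + 1 ≤ r) (hq : 2 ^ β ≤ s)
    [MulAction Circle (RealMilnor r s)] (k : ℕ) (hk : k ∈ tcSet (RealMilnor r s) (N + 2)) :
    (N + 2) * (2 ^ α + 2 ^ β) - 1 ≤ k := by
  classical
  have hcX : CompactSpace (RealMilnor r s) := milnor_compact hsr
  by_contra hlt
  obtain ⟨hk0, U, hU, hcov, -, hsec⟩ := hk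
  have hp1 : 1 ≤ 2 ^ α := Nat.one_le_two_pow
  have hq1 : 1 ≤ 2 ^ β := Nat.one_le_two_pow
  have hcard := card_Lam N (2 ^ α) (2 ^ β) hp1 hq1
  have hle : Fintype.card (Fin k) ≤ Fintype.card (Lam N (2 ^ α) (2 ^ β)) := by
    rw [hcard, Fintype.card_fin]; omega
  obtain ⟨ψ⟩ := Function.Embedding.nonempty_of_card_le hle
  have : Nonempty (Fin k) := ⟨⟨0, hk0⟩⟩
  have hφ : Function.Surjective (Function.invFun ψ) := Function.invFun_surjective ψ.injective
  generalize Function.invFun ψ = φ at hφ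
  obtain ⟨K, hKcov, hKc, hKU⟩ := exists_iUnion_eq_closed_subset hU (fun x => Set.toFinite _) hcov
  choose sec hs1 H h0 h1 h2 using hsec
  let e : (Fin (N + 2) → RealMilnor r s) → Fin (N + 2) → Pr (r + 1) × Pr (s + 1) := fun w j => (w j).1
  have he : Continuous e := by fun_prop
  have hei : Function.Injective e := fun a b h => funext fun j => Subtype.ext (congrFun h j)
  have hA := fun (i : Fin k) (j : Fin (N + 2)) => form_ext e he hei (U i) (sec i) (H i) (h0 i) (h1 i) (K i) (hKc i)
    (hKU i) (fun x => x.1.1) (by fun_prop) 0 j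
  have hB := fun (i : Fin k) (j : Fin (N + 2)) => form_ext e he hei (U i) (sec i) (H i) (h0 i) (h1 i) (K i) (hKc i)
    (hKU i) (fun x => x.1.2) (by fun_prop) 0 j
  choose Q hQ hQn using hA
  choose Q' hQ' hQn' using hB
  have hdr : ∀ j, dd N (2 ^ α) (2 ^ β) (Sum.inr j) ≤ s := dd_inr_le hq
  obtain ⟨v, hv, hz⟩ := bu (dd N (2 ^ α) (2 ^ β)) (r + 1) (by
      rintro (j | j)
      · have := dd_inl_le (N := N) (q := 2 ^ β) hp j
        omega
      · have := hdr j
        omega) (Xs N (2 ^ α) (2 ^ β))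
    (ff hsr (fun l j => Q (φ l) j) (fun l j => Q' (φ l) j))
    (ff_cont hsr _ _ (fun l j => hQ _ _) (fun l j => hQ' _ _) _ hdr)
    (ff_equiv hsr _ _) (alg_coeff N α β)
  have hx : ∀ j, v (Sum.inl j) ≠ 0 := fun j => Kset_inl_ne hv _
  have hy : ∀ j, rs hsr (v (Sum.inr j)) ≠ 0 := fun j => Kset_inr_ne hsr hv _ (hdr j)
  let w : Fin (N + 2) → RealMilnor r s := fun j =>
    ⟨(Projectivization.mk ℝ _ (hx j), Projectivization.mk ℝ _ (hy j)),
      (mem_milnor_mk hsr _ _ _ _).2 (hz (Sum.inl j))⟩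
  have hew : e w = Yv hsr v := by
    funext j
    simp only [e, w, Yv, toPr_of_ne (hx j), toPr_of_ne (hy j)]
  have hwK : w ∈ ⋃ i, K i := by rw [hKcov]; trivial
  obtain ⟨i, hi⟩ := Set.mem_iUnion.1 hwK
  obtain ⟨l, rfl⟩ := hφ i
  rcases l with x | x
  · have := hz (Sum.inr (Sum.inl x))
    simp only [ff, ← hew] at this
    exact hQn _ _ w hi _ _ (hx 0) (hx x.1) rfl rfl this
  · have := hz (Sum.inr (Sum.inr x))
    simp only [ff, ← hew] at this
    exact hQn' _ _ w hi _ _ (hy 0) (hy x.1) rfl rfl this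

end MilnorTC

open MilnorTC in
/-- For odd `0 ≤ s ≤ r` with `s ≥ 2^{t₁}+1, r ≥ 2^{t₂}` (or
`r ≥ 2^{t₁}+1, s ≥ 2^{t₂}`), any free (continuous) circle action on `ℝH_{r,s}`
satisfies, for `n ≥ 2`: `n(2^{t₁}+2^{t₂}) - 1 ≤ TC_{S¹,n}(ℝH_{r,s}) ≤ n(s+r-1)`. -/
theorem eqHigherTC_circle_milnor (r s n t₁ t₂ : ℕ) (hsr : s ≤ r)
    (hrodd : Odd r) (hsodd : Odd s) (ht₁ : 0 < t₁) (ht₂ : 0 < t₂)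
    (hcase : (2 ^ t₁ + 1 ≤ s ∧ 2 ^ t₂ ≤ r) ∨ (2 ^ t₁ + 1 ≤ r ∧ 2 ^ t₂ ≤ s)) (hn : 2 ≤ n)
    [MulAction Circle (↥(RealMilnor r s))]
    [ContinuousSMul Circle (↥(RealMilnor r s))]
    (hfree : ∀ (g : Circle) (x : ↥(RealMilnor r s)), g • x = x → g = 1) :
    n * (2 ^ t₁ + 2 ^ t₂) - 1 ≤ eqHigherTC Circle (↥(RealMilnor r s)) n ∧
      eqHigherTC Circle (↥(RealMilnor r s)) n ≤ n * (s + r - 1) := by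
  have hcX : CompactSpace (RealMilnor r s) := milnor_compact hsr
  have hs0 := hsodd.pos
  have h2 : 2 ≤ 2 ^ t₂ := by
    calc 2 = 2 ^ 1 := rfl
      _ ≤ 2 ^ t₂ := Nat.pow_le_pow_right (by norm_num) ht₂
  have h1 : 2 ≤ 2 ^ t₁ := by
    calc 2 = 2 ^ 1 := rfl
      _ ≤ 2 ^ t₁ := Nat.pow_le_pow_right (by norm_num) ht₁
  have hmem := upper_mem (basePt hsr hsodd) (r + s - 1) n hn (by omega) (milnor_locModel hsr hsodd) hfree
  rw [eqHigherTC_eq, Nat.add_comm s r]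
  refine ⟨?_, Nat.sInf_le hmem⟩
  have hinf := Nat.sInf_mem ⟨_, hmem⟩
  obtain ⟨N, rfl⟩ : ∃ N, n = N + 2 := ⟨n - 2, by omega⟩
  rcases hcase with ⟨ha, hb⟩ | ⟨ha, hb⟩
  · rw [Nat.add_comm (2 ^ t₁)]
    refine lower_bound N t₂ t₁ hsr ?_ (by omega) _ hinf
    have heven : Even (2 ^ t₂) := (Nat.even_pow.2 ⟨even_two, ht₂.ne'⟩)
    have : 2 ^ t₂ ≠ r := by
      rintro h
      rw [h] at heven
      exact (Nat.not_even_iff_odd.2 hrodd) heven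
    omega
  · exact lower_bound N t₁ t₂ hsr ha hb _ hinf
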